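/- arXiv:2310.20342 — 4 statements merged into one kernel-verified Lean document; each statement's English description precedes it below -/
import Mathlib

section
/- There is a constant c > 0 such that for all real Z ≥ 2, the sum over integers 1 ≤ z ≤ Z of z/φ(z) equals (315·ζ(3)/(2π⁴))·Z + O(log Z), i.e. the error term is bounded by c·log Z. -/
open ArithmeticFunction in
/-- The function `μ²(n)/φ(n)`. -/
noncomputable def gfun : ArithmeticFunction ℝ :=
  ⟨fun n => if Squarefree n then 1 / (Nat.totient n : ℝ) else 0, by simp⟩

lemma gfun_apply (n : ℕ) : gfun n = if Squarefree n then 1 / (Nat.totient n : ℝ) else 0 := rfl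

/-- The function `n/φ(n)`. -/
noncomputable def afun : ArithmeticFunction ℝ :=
  ⟨fun n => (n : ℝ) / (Nat.totient n : ℝ), by simp⟩

lemma afun_apply (n : ℕ) : afun n = (n : ℝ) / (Nat.totient n : ℝ) := rfl

/-- The function `μ²(n)/(n φ(n))`. -/
noncomputable def ffun : ArithmeticFunction ℝ :=
  ⟨fun n => gfun n / n, by simp⟩

lemma ffun_apply (n : ℕ) : ffun n = gfun n / n := rfl

lemma gfun_mult : gfun.IsMultiplicative := by
  refine ⟨by simp [gfun_apply], ?_⟩
  intro m n h
  simp only [gfun_apply, Nat.squarefree_mul h, Nat.totient_mul h]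
  by_cases hm : Squarefree m <;> by_cases hn : Squarefree n <;> simp [hm, hn, mul_comm]

lemma afun_mult : afun.IsMultiplicative := by
  refine ⟨by simp [afun_apply], ?_⟩
  intro m n h
  simp only [afun_apply, Nat.totient_mul h]
  push_cast
  rw [div_mul_div_comm]

lemma ffun_mult : ffun.IsMultiplicative := by
  refine ⟨by simp [ffun_apply, gfun_mult.1], ?_⟩
  intro m n h
  simp only [ffun_apply, gfun_mult.2 h]
  push_cast
  rw [div_mul_div_comm]

lemma gfun_pow_zero_of (p i : ℕ) (hp : p.Prime) : gfun (p ^ (i + 2)) = 0 := by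
  rw [gfun_apply, if_neg]
  rw [Nat.squarefree_pow_iff hp.ne_one (by omega)]
  omega

lemma gfun_prime (p : ℕ) (hp : p.Prime) : gfun p = 1 / ((p : ℝ) - 1) := by
  rw [gfun_apply, if_pos hp.prime.squarefree, Nat.totient_prime hp, Nat.cast_sub hp.one_le]
  simp

lemma gfun_mul_zeta : gfun * (ArithmeticFunction.zeta : ArithmeticFunction ℝ) = afun := by
  rw [ArithmeticFunction.IsMultiplicative.eq_iff_eq_on_prime_powers _
    (gfun_mult.mul ArithmeticFunction.isMultiplicative_zeta.natCast) _ afun_mult]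
  intro p i hp
  have hp1 : (1 : ℝ) < p := by exact_mod_cast hp.one_lt
  have hp2 : (p : ℝ) - 1 ≠ 0 := by linarith
  rw [ArithmeticFunction.coe_mul_zeta_apply, Nat.sum_divisors_prime_pow hp]
  rcases i with _ | i
  · simp [gfun_mult.1, afun_mult.1]
  · rw [Finset.sum_range_succ', Finset.sum_range_succ', Finset.sum_eq_zero]
    · simp only [zero_add, pow_one, pow_zero, gfun_mult.1, gfun_prime p hp, afun_apply,
        Nat.totient_prime_pow_succ hp]
      push_cast [Nat.cast_sub hp.one_le]
      field_simp
      ring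
    · intro j _
      exact gfun_pow_zero_of p j hp

lemma squarefree_le (n : ℕ) (hn : Squarefree n) : n ≤ 2 * n.totient ^ 2 := by
  have h1 := Nat.totient_mul_prod_primeFactors n
  rw [Nat.prod_primeFactors_of_squarefree hn, mul_comm] at h1
  have h2 := Nat.eq_of_mul_eq_mul_left (Nat.pos_of_ne_zero hn.ne_zero) h1
  rw [h2]
  calc n = ∏ p ∈ n.primeFactors, p := (Nat.prod_primeFactors_of_squarefree hn).symm
    _ ≤ ∏ p ∈ n.primeFactors, ((if p = 2 then 2 else 1) * (p - 1) ^ 2) := by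
        apply Finset.prod_le_prod'
        intro p hp
        have := (Nat.prime_of_mem_primeFactors hp).two_le
        obtain ⟨q, rfl⟩ : ∃ q, p = q + 2 := ⟨p - 2, by omega⟩
        split_ifs with h
        · have : q = 0 := by omega
          subst this; simp
        · have : 1 ≤ q := by omega
          have : q + 2 - 1 = q + 1 := by omega
          rw [this]; nlinarith
    _ ≤ _ := by
        rw [Finset.prod_mul_distrib, Finset.prod_pow]
        gcongr
        rw [Finset.prod_ite_eq']
        split_ifs <;> simp

lemma gfun_nonneg (n : ℕ) : 0 ≤ gfun n := by
  rw [gfun_apply]; split_ifs <;> positivity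

lemma gfun_le (n : ℕ) : gfun n ≤ afun n / n := by
  rw [gfun_apply, afun_apply]
  rcases Nat.eq_zero_or_pos n with rfl | hn
  · simp
  have h1 : (0 : ℝ) < n := by exact_mod_cast hn
  have h2 : (0 : ℝ) < n.totient := by exact_mod_cast Nat.totient_pos.2 hn
  split_ifs
  · apply le_of_eq; field_simp
  · positivity

lemma ffun_nonneg (n : ℕ) : 0 ≤ ffun n := by
  rw [ffun_apply]; have := gfun_nonneg n; positivity

lemma ffun_summable : Summable (fun n => ffun n) := by
  have h := (Real.summable_nat_rpow_inv (p := 3 / 2)).2 (by norm_num)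
  refine Summable.of_nonneg_of_le ffun_nonneg ?_ (h.mul_left (Real.sqrt 2))
  intro n
  rw [ffun_apply, gfun_apply]
  split_ifs with hs
  · have hn : 0 < n := Nat.pos_of_ne_zero hs.ne_zero
    have h1 : (0 : ℝ) < n := by exact_mod_cast hn
    have h2 : (0 : ℝ) < n.totient := by exact_mod_cast Nat.totient_pos.2 hn
    have h3 : (n : ℝ) ≤ 2 * (n.totient : ℝ) ^ 2 := by exact_mod_cast squarefree_le n hs
    have h4 : Real.sqrt n ≤ Real.sqrt 2 * n.totient := by
      rw [Real.sqrt_le_left (by positivity), mul_pow, Real.sq_sqrt (by norm_num)]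
      exact h3
    have h5 : (n : ℝ) ^ (3 / 2 : ℝ) = n * Real.sqrt n := by
      rw [Real.sqrt_eq_rpow, show (3 / 2 : ℝ) = 1 + 1 / 2 by norm_num, Real.rpow_add h1,
        Real.rpow_one]
    rw [h5]
    have h6 : 0 < Real.sqrt n := Real.sqrt_pos.2 h1
    rw [← div_eq_mul_inv, div_div, div_le_div_iff₀ (by positivity) (by positivity)]
    nlinarith
  · rw [zero_div]; positivity

/-- The constant. -/
noncomputable def Acst : ℝ := ∑' n, ffun n

lemma bern6 : bernoulli 6 = 1 / 42 := by
  rw [bernoulli_eq_bernoulli'_of_ne_one (by norm_num)]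
  have h5 : bernoulli' 5 = 0 := bernoulli'_eq_zero_of_odd (by decide) (by norm_num)
  have c2 : Nat.choose 6 2 = 15 := by decide
  have c4 : Nat.choose 6 4 = 15 := by decide
  rw [bernoulli'_def]
  norm_num [Finset.sum_range_succ, h5, c2, c4]

lemma zeta6 : riemannZeta 6 = (Real.pi : ℂ) ^ 6 / 945 := by
  have h := riemannZeta_two_mul_nat (k := 3) (by norm_num)
  norm_num [bern6, Nat.factorial] at h
  rw [h]; ring

lemma hasProd_f : HasProd (fun p : Nat.Primes => (((1 + 1 / ((p : ℝ) * ((p : ℝ) - 1))) : ℝ) : ℂ))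
    (Acst : ℂ) := by
  have h := ffun_mult.eulerProduct_hasProd (by simpa [abs_of_nonneg (ffun_nonneg _)] using ffun_summable)
  have h2 := h.map Complex.ofRealHom Complex.continuous_ofReal
  convert! h2 using 1
  ext p
  have hp := p.2
  have hs : ∑' e, ffun ((p : ℕ) ^ e) = ∑ e ∈ Finset.range 2, ffun ((p : ℕ) ^ e) := by
    apply tsum_eq_sum
    intro b hb
    obtain ⟨c, rfl⟩ : ∃ c, b = c + 2 := ⟨b - 2, by simp at hb; omega⟩
    rw [ffun_apply, gfun_pow_zero_of _ _ hp, zero_div]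
  simp only [Function.comp, hs, Finset.sum_range_succ, Finset.sum_range_zero, pow_zero, pow_one,
    ffun_mult.1, zero_add, Complex.ofRealHom_eq_coe]
  rw [ffun_apply, gfun_prime _ hp, div_div, mul_comm]

lemma zprod (k : ℕ) (hk : 2 ≤ k) :
    HasProd (fun p : Nat.Primes => (((1 - ((p : ℝ) ^ k)⁻¹)⁻¹ : ℝ) : ℂ)) (riemannZeta k) := by
  have h := riemannZeta_eulerProduct_hasProd (s := k) (by simp; omega)
  convert! h using 1
  ext p
  rw [Complex.cpow_neg, Complex.cpow_natCast]
  push_cast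
  rfl

lemma A_mul : (Acst : ℂ) * riemannZeta 6 = riemannZeta 2 * riemannZeta 3 := by
  have h1 := hasProd_f.mul (zprod 6 (by norm_num))
  have h2 := (zprod 2 (by norm_num)).mul (zprod 3 (by norm_num))
  have c6 : ((6 : ℕ) : ℂ) = 6 := by norm_num
  have c2 : ((2 : ℕ) : ℂ) = 2 := by norm_num
  have c3 : ((3 : ℕ) : ℂ) = 3 := by norm_num
  rw [c6] at h1
  rw [c2, c3] at h2
  refine HasProd.unique h1 ?_
  convert! h2 using 1
  ext p
  rw [← Complex.ofReal_mul, ← Complex.ofReal_mul]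
  congr 1
  have hp1 : (1 : ℝ) < (p : ℕ) := by exact_mod_cast p.2.one_lt
  have hpow : ∀ k : ℕ, k ≠ 0 → ((p : ℕ) : ℝ) ^ k - 1 ≠ 0 := fun k hk => by
    have := one_lt_pow₀ hp1 hk
    linarith
  have a1 := hpow 1 (by norm_num)
  have a2 := hpow 2 (by norm_num)
  have a3 := hpow 3 (by norm_num)
  have a6 := hpow 6 (by norm_num)
  rw [pow_one] at a1
  have hp0 : ((p : ℕ) : ℝ) ≠ 0 := by positivity
  generalize ((p : ℕ) : ℝ) = x at *
  have e : ∀ k : ℕ, x ^ k - 1 ≠ 0 → (1 - (x ^ k)⁻¹)⁻¹ = x ^ k / (x ^ k - 1) := fun k hk => by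
    have : x ^ k ≠ 0 := pow_ne_zero _ hp0
    have h3 : 1 - (x ^ k)⁻¹ = (x ^ k - 1) / x ^ k := by field_simp
    rw [h3, inv_div]
  rw [e 2 a2, e 3 a3, e 6 a6, show 1 + 1 / (x * (x - 1)) = (x * (x - 1) + 1) / (x * (x - 1)) by
    field_simp]
  rw [div_mul_div_comm, div_mul_div_comm, div_eq_div_iff (by positivity) (by positivity)]
  ring

lemma A_eq : Acst = 315 * (riemannZeta 3).re / (2 * Real.pi ^ 4) := by
  have h := A_mul
  rw [zeta6, riemannZeta_two] at h
  have hpi : (Real.pi : ℂ) ≠ 0 := by exact_mod_cast Real.pi_ne_zero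
  have h' : (Acst : ℂ) * ((2 * Real.pi ^ 4 : ℝ) : ℂ) = ((315 : ℝ) : ℂ) * riemannZeta 3 := by
    push_cast
    have h2 : (Real.pi : ℂ) ^ 2 ≠ 0 := pow_ne_zero _ hpi
    apply mul_left_cancel₀ h2
    linear_combination 1890 * h
  have h3 := congrArg Complex.re h'
  rw [← Complex.ofReal_mul, Complex.ofReal_re, Complex.re_ofReal_mul] at h3
  rw [eq_div_iff (by positivity), h3]

open Finset

lemma S_eq (N : ℕ) : ∑ n ∈ Ioc 0 N, afun n = ∑ n ∈ Ioc 0 N, gfun n * ((N / n : ℕ) : ℝ) := by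
  rw [← gfun_mul_zeta]
  exact ArithmeticFunction.sum_Ioc_mul_zeta_eq_sum gfun N

lemma A_nonneg : 0 ≤ Acst := tsum_nonneg ffun_nonneg

lemma S_le (N : ℕ) : ∑ n ∈ Ioc 0 N, afun n ≤ Acst * N := by
  rw [S_eq]
  calc _ ≤ ∑ n ∈ Ioc 0 N, ffun n * N := by
        apply sum_le_sum
        intro n hn
        rw [ffun_apply, div_mul_eq_mul_div, mul_div_assoc]
        exact mul_le_mul_of_nonneg_left Nat.cast_div_le (gfun_nonneg n)
    _ = (∑ n ∈ Ioc 0 N, ffun n) * N := by rw [sum_mul]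
    _ ≤ _ := by
        gcongr
        exact ffun_summable.sum_le_tsum _ fun i _ => ffun_nonneg i

lemma sum_g_le (N : ℕ) (hN : 1 ≤ N) : ∑ n ∈ Ioc 0 N, gfun n ≤ Acst * (2 + Real.log N) := by
  have key : ∀ N : ℕ, 1 ≤ N → ∑ n ∈ Ioc 0 N, afun n / n ≤
      (∑ n ∈ Ioc 0 N, afun n) / N + Acst * (harmonic N : ℝ) := by
    intro N hN
    induction N, hN using Nat.le_induction with
    | base => have := A_nonneg; simp [harmonic]; positivity
    | succ N hN ih =>
      rw [sum_Ioc_succ_top (by omega), sum_Ioc_succ_top (by omega), harmonic_succ]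
      have h1 := S_le N
      have hN' : (0 : ℝ) < N := by exact_mod_cast hN
      generalize ∑ n ∈ Ioc 0 N, afun n = S at *
      push_cast
      have : S / N - S / (N + 1) ≤ Acst * ((N : ℝ) + 1)⁻¹ := by
        rw [div_sub_div _ _ (by positivity) (by positivity), div_le_iff₀ (by positivity)]
        field_simp
        linarith
      rw [add_div]
      linarith
  have h1 := key N hN
  have h2 := harmonic_le_one_add_log N
  have h3 := S_le N
  have hN' : (0 : ℝ) < N := by exact_mod_cast hN
  have h4 : (∑ n ∈ Ioc 0 N, afun n) / N ≤ Acst := by rwa [div_le_iff₀ hN']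
  have h5 := mul_le_mul_of_nonneg_left h2 A_nonneg
  calc _ ≤ ∑ n ∈ Ioc 0 N, afun n / n := sum_le_sum fun n _ => gfun_le n
    _ ≤ _ := by linarith

lemma tail_aux (N : ℕ) (hN : 1 ≤ N) (M : ℕ) (hM : N ≤ M) :
    ∑ n ∈ Ioc 0 M, ffun n ≤ ∑ n ∈ Ioc 0 N, ffun n +
      (∑ n ∈ Ioc 0 M, afun n) / M ^ 2 + 2 * Acst * (1 / N - 1 / M) := by
  induction M, hM using Nat.le_induction with
  | base =>
    have : 0 ≤ (∑ n ∈ Ioc 0 N, afun n) / N ^ 2 :=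
      div_nonneg (sum_nonneg fun n _ => by rw [afun_apply]; positivity) (by positivity)
    linarith
  | succ M hM ih =>
    rw [sum_Ioc_succ_top (by omega), sum_Ioc_succ_top (b := M) (by omega)]
    have h1 := S_le M
    have h0 := A_nonneg
    have hM' : (0 : ℝ) < M := by exact_mod_cast (by omega : 0 < M)
    generalize ∑ n ∈ Ioc 0 M, afun n = S at *
    have h2 : ffun (M + 1) ≤ afun (M + 1) / ((M + 1 : ℕ) : ℝ) ^ 2 := by
      rw [ffun_apply, pow_two, ← div_div]
      exact div_le_div_of_nonneg_right (gfun_le _) (by positivity)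
    have h3 : S / M ^ 2 - S / ((M : ℝ) + 1) ^ 2 ≤ 2 * Acst * (1 / M - 1 / ((M : ℝ) + 1)) := by
      have e1 : S / M ^ 2 - S / ((M : ℝ) + 1) ^ 2 =
          S * ((2 * M + 1) / (M ^ 2 * ((M : ℝ) + 1) ^ 2)) := by field_simp; ring
      have e2 : 2 * Acst * (1 / M - 1 / ((M : ℝ) + 1)) =
          Acst * M * ((2 * M + 2) / (M ^ 2 * ((M : ℝ) + 1) ^ 2)) := by field_simp; ring
      rw [e1, e2]
      gcongr
      linarith
    push_cast at *
    rw [add_div]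
    linarith

lemma tail_le (N : ℕ) (hN : 1 ≤ N) : Acst ≤ ∑ n ∈ Ioc 0 N, ffun n + 2 * Acst / N := by
  apply Real.tsum_le_of_sum_range_le ffun_nonneg
  intro n
  have h0 := A_nonneg
  set M := max n N
  have hMN : N ≤ M := le_max_right _ _
  have hM' : (0 : ℝ) < M := by exact_mod_cast (by omega : 0 < M)
  have h1 := tail_aux N hN M hMN
  have h2 : (∑ n ∈ Ioc 0 M, afun n) / M ^ 2 ≤ Acst * (1 / M) := by
    rw [div_le_iff₀ (by positivity)]
    have := S_le M
    field_simp
    linarith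
  have h3 : ∑ i ∈ range n, ffun i ≤ ∑ i ∈ Ioc 0 M, ffun i := by
    have : ∑ i ∈ Ioc 0 M, ffun i = ∑ i ∈ range (M + 1), ffun i := by
      apply sum_subset
      · intro x; simp
      · intro x hx hx'
        have : x = 0 := by simp at hx hx'; omega
        simp [this]
    rw [this]
    apply sum_le_sum_of_subset_of_nonneg
    · intro x; have : n ≤ M := le_max_left _ _
      simp; omega
    · intro i _ _; exact ffun_nonneg i
  have h4 : 0 ≤ Acst * (1 / M) := by positivity
  have h5 : 2 * Acst / N = 2 * Acst * (1 / N) := by ring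
  rw [h5]
  linarith

lemma S_ge (N : ℕ) (hN : 1 ≤ N) :
    Acst * N - 2 * Acst - Acst * (2 + Real.log N) ≤ ∑ n ∈ Ioc 0 N, afun n := by
  have hN' : (0 : ℝ) < N := by exact_mod_cast hN
  have h1 : (∑ n ∈ Ioc 0 N, ffun n) * N - ∑ n ∈ Ioc 0 N, gfun n ≤ ∑ n ∈ Ioc 0 N, afun n := by
    rw [S_eq, sum_mul, ← sum_sub_distrib]
    apply sum_le_sum
    intro n hn
    have hn0 : 0 < n := (mem_Ioc.1 hn).1
    have hb : (N : ℝ) / n - 1 ≤ ((N / n : ℕ) : ℝ) := by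
      rw [← Nat.floor_div_eq_div (K := ℝ)]
      exact (Nat.sub_one_lt_floor _).le
    have := mul_le_mul_of_nonneg_left hb (gfun_nonneg n)
    rw [ffun_apply]
    calc _ = gfun n * ((N : ℝ) / n - 1) := by ring
      _ ≤ _ := this
  have h2 := sum_g_le N hN
  have h3 := mul_le_mul_of_nonneg_right (tail_le N hN) hN'.le
  rw [add_mul, div_mul_cancel₀ _ hN'.ne'] at h3
  linarith

open Real in
theorem sum_z_div_phi : ∃ c : ℝ, 0 < c ∧ ∀ Z : ℝ, 2 ≤ Z →
    |(∑ z ∈ Finset.Icc 1 ⌊Z⌋₊, (z : ℝ) / (Nat.totient z : ℝ)) -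
      315 * (riemannZeta 3).re / (2 * π ^ 4) * Z| ≤ c * Real.log Z := by
  have h0 := A_nonneg
  refine ⟨11 * Acst + 1, by positivity, fun Z hZ => ?_⟩
  rw [← A_eq]
  have hN : 1 ≤ ⌊Z⌋₊ := Nat.le_floor (by push_cast; linarith)
  have hlo := Nat.floor_le (by linarith : 0 ≤ Z)
  have hhi := Nat.lt_floor_add_one Z
  have e : ∑ z ∈ Finset.Icc 1 ⌊Z⌋₊, (z : ℝ) / (Nat.totient z : ℝ) = ∑ n ∈ Ioc 0 ⌊Z⌋₊, afun n := rfl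
  rw [e]
  have h1 := S_le ⌊Z⌋₊
  have h2 := S_ge ⌊Z⌋₊ hN
  have hN' : (1 : ℝ) ≤ ⌊Z⌋₊ := by exact_mod_cast hN
  have h3 : Real.log ⌊Z⌋₊ ≤ Real.log Z := Real.log_le_log (by linarith) hlo
  have h4 : 1 / 2 ≤ Real.log Z := by
    have := Real.log_le_log (by norm_num) hZ
    have := Real.log_two_gt_d9
    linarith
  have h5 := mul_le_mul_of_nonneg_left h3 h0
  have h6 := mul_le_mul_of_nonneg_left h4 h0
  have h7 := mul_le_mul_of_nonneg_left hlo h0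
  have h8 := mul_le_mul_of_nonneg_left hhi.le h0
  rw [abs_le]
  constructor <;> nlinarith
end

section
/- Let q be prime and r₁, r₂, r₃ nonzero integers with |r₁|+|r₂|+|r₃| ≤ R. For λ a nonzero residue modulo q, the number J of triples (y₁,y₂,y₃) of nonzero integers with |y_i| ≤ h_i satisfying λ·y₁^{r₁}·y₂^{r₂}·y₃^{r₃} ≡ 1 (mod q) satisfies J ≪_R h₁h₂h₃/q + (h₁h₂h₃)^{1/2}·log q. -/
lemma cmc_block (q n H t y0 m a : ℤ) (hn : 0 < n) (hq : n * n ≤ q) (ha : |a| ≤ n) (hH : 0 ≤ H)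
    (hm : n * t = m * q + a) (hc : IsCoprime m n) :
    |((((Finset.Icc 1 H ×ˢ Finset.Ico 0 n).filter
      (fun p : ℤ × ℤ => q ∣ p.1 - t * (y0 + p.2))).card : ℕ) : ℝ) - n * H / q| ≤ 4 := by
  have hq0 : 0 < q := by nlinarith
  have hqR : (0:ℝ) < q := by exact_mod_cast hq0
  have hnR : (0:ℝ) < n := by exact_mod_cast hn
  have hnq : (n:ℝ) * n ≤ q := by exact_mod_cast hq
  have hn1 : (1:ℝ) ≤ n := by exact_mod_cast hn
  have haj : ∀ j : ℤ, 0 ≤ j → j < n → -(n*n) ≤ a * j ∧ a * j ≤ n * n := by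
    intro j h0 h1
    rw [← abs_le, abs_mul]
    exact mul_le_mul ha (by rw [abs_of_nonneg h0]; omega) (abs_nonneg _) hn.le
  set B := (Finset.Icc 1 H ×ˢ Finset.Ico 0 n).filter
      (fun p : ℤ × ℤ => q ∣ p.1 - t * (y0 + p.2)) with hB
  have key : ∀ p ∈ B, q * (n * ((p.1 - t * (y0 + p.2)) / q) + m * p.2)
      = n * (p.1 - t * y0) - a * p.2 := by
    intro p hp
    have hd := (Finset.mem_filter.1 hp).2
    have := Int.mul_ediv_cancel' hd
    calc _ = n * (q * ((p.1 - t * (y0 + p.2)) / q)) + m * q * p.2 := by ring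
      _ = _ := by rw [this]; linear_combination (-p.2) * hm
  rw [abs_le]
  constructor
  · -- lower bound
    set A : ℝ := (n * (1 - t * y0) + n * n) / q with hA
    set D : ℝ := (n * (H - t * y0) - n * n) / q with hD
    have hsub : Finset.Icc ⌈A⌉ ⌊D⌋ ⊆
        B.image (fun p => n * ((p.1 - t * (y0 + p.2)) / q) + m * p.2) := by
      intro l hl
      rw [Finset.mem_Icc, Int.ceil_le, Int.le_floor, hA, hD, div_le_iff₀ hqR, le_div_iff₀ hqR] at hl
      obtain ⟨h1, h2⟩ := hl
      have h1' : n * (1 - t * y0) + n * n ≤ l * q := by exact_mod_cast h1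
      have h2' : l * q ≤ n * (H - t * y0) - n * n := by exact_mod_cast h2
      obtain ⟨u, v, huv⟩ := hc
      have hj0 := Int.emod_nonneg (u * l) hn.ne'
      have hj1 := Int.emod_lt_of_pos (u * l) hn
      have hj2 := Int.emod_add_mul_ediv (u * l) n
      set j := (u * l) % n
      set e := (u * l) / n
      -- l - m j = n * k
      obtain ⟨k, hk⟩ : ∃ k, l - m * j = n * k := ⟨v * l + m * e, by
        linear_combination (-l) * huv + (-m) * hj2⟩
      have hx : n * (t * (y0 + j) + q * k) = n * t * y0 + a * j + q * l := by
        linear_combination j * hm - q * hk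
      obtain ⟨b1, b2⟩ := haj j hj0 hj1
      have hx1 : 1 ≤ t * (y0 + j) + q * k := by
        by_contra hcon
        have : t * (y0 + j) + q * k ≤ 0 := by omega
        nlinarith
      have hx2 : t * (y0 + j) + q * k ≤ H := by
        by_contra hcon
        have : H + 1 ≤ t * (y0 + j) + q * k := by omega
        nlinarith
      rw [Finset.mem_image]
      refine ⟨(t * (y0 + j) + q * k, j), ?_, ?_⟩
      · rw [hB, Finset.mem_filter, Finset.mem_product, Finset.mem_Icc, Finset.mem_Ico]
        refine ⟨⟨⟨hx1, hx2⟩, hj0, hj1⟩, ⟨k, by ring⟩⟩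
      · have : (t * (y0 + j) + q * k - t * (y0 + j)) / q = k := by
          rw [add_sub_cancel_left, Int.mul_ediv_cancel_left _ hq0.ne']
        simp only [this]
        linarith
    have hcard := (Finset.card_le_card hsub).trans Finset.card_image_le
    rw [Int.card_Icc] at hcard
    have h3 : ((⌊D⌋ + 1 - ⌈A⌉ : ℤ) : ℝ) ≤ (B.card : ℝ) := by
      have : (⌊D⌋ + 1 - ⌈A⌉ : ℤ) ≤ (B.card : ℤ) := by omega
      exact_mod_cast this
    push_cast at h3
    have h4 := Int.lt_floor_add_one D
    have h5 := Int.ceil_lt_add_one A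
    have h6 : D - A = n * H / q - (n / q + 2 * (n * n / q)) := by
      rw [hA, hD]; field_simp; ring
    have h7 : (n:ℝ) * n / q ≤ 1 := by rw [div_le_one hqR]; exact hnq
    have h8 : (n:ℝ) / q ≤ 1 := by rw [div_le_one hqR]; nlinarith
    linarith
  · set A : ℝ := (n * (1 - t * y0) - n * n) / q with hA
    set D : ℝ := (n * (H - t * y0) + n * n) / q with hD
    have hcard : B.card ≤ (Finset.Icc ⌈A⌉ ⌊D⌋).card := by
      apply Finset.card_le_card_of_injOn
        (fun p => n * ((p.1 - t * (y0 + p.2)) / q) + m * p.2)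
      · intro p hp
        have hk := key p hp
        have hp' := hp
        rw [Finset.mem_coe, hB, Finset.mem_filter, Finset.mem_product, Finset.mem_Icc,
          Finset.mem_Ico] at hp'
        obtain ⟨⟨⟨c1, c2⟩, c3, c4⟩, -⟩ := hp'
        obtain ⟨b1, b2⟩ := haj p.2 c3 c4
        simp only [Finset.coe_Icc, Set.mem_Icc]
        rw [Int.ceil_le, Int.le_floor, hA, hD, div_le_iff₀ hqR, le_div_iff₀ hqR]
        set l := n * ((p.1 - t * (y0 + p.2)) / q) + m * p.2
        constructor
        · have : n * (1 - t * y0) - n * n ≤ l * q := by nlinarith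
          exact_mod_cast this
        · have : l * q ≤ n * (H - t * y0) + n * n := by nlinarith
          exact_mod_cast this
      · intro p hp p' hp' heq
        have hk := key p hp
        have hk' := key p' hp'
        simp only at heq
        rw [Finset.mem_coe, hB, Finset.mem_filter, Finset.mem_product, Finset.mem_Icc,
          Finset.mem_Ico] at hp hp'
        obtain ⟨⟨⟨c1, c2⟩, c3, c4⟩, -⟩ := hp
        obtain ⟨⟨⟨d1, d2⟩, d3, d4⟩, -⟩ := hp'
        have hdvd : n ∣ m * (p.2 - p'.2) :=
          ⟨(p'.1 - t * (y0 + p'.2)) / q - (p.1 - t * (y0 + p.2)) / q, by linarith⟩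
        have hdvd2 : n ∣ p.2 - p'.2 := hc.symm.dvd_of_dvd_mul_left hdvd
        have h2 : p.2 = p'.2 := by
          have := Int.eq_zero_of_abs_lt_dvd hdvd2 (by rw [abs_lt]; constructor <;> linarith)
          linarith
        rw [heq, hk', h2] at hk
        have h1 : p.1 = p'.1 := by
          have : n * (p.1 - p'.1) = 0 := by linarith
          rcases mul_eq_zero.1 this with h | h
          · omega
          · linarith
        exact Prod.ext h1 h2
    rw [Int.card_Icc] at hcard
    have h6 : D - A = n * H / q - n / q + 2 * (n * n / q) := by
      rw [hA, hD]; field_simp; ring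
    have h7 : (n:ℝ) * n / q ≤ 1 := by rw [div_le_one hqR]; exact hnq
    have h8 : (0:ℝ) ≤ n / q := by positivity
    have h4 := Int.floor_le D
    have h5 := Int.le_ceil A
    rcases le_or_gt 0 (⌊D⌋ + 1 - ⌈A⌉) with h | h
    · have : (B.card : ℤ) ≤ ⌊D⌋ + 1 - ⌈A⌉ := by omega
      have h3 : (B.card : ℝ) ≤ ((⌊D⌋ + 1 - ⌈A⌉ : ℤ) : ℝ) := by exact_mod_cast this
      push_cast at h3
      linarith
    · have h0 : B.card = 0 := by omega
      rw [h0]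
      have : (0:ℝ) ≤ n * H / q := by
        have : (0:ℝ) ≤ H := by exact_mod_cast hH
        positivity
      push_cast; linarith

lemma cmc_range_mul (f : ℕ → ℝ) (n K : ℕ) :
    ∑ y ∈ Finset.range (K * n), f y = ∑ k ∈ Finset.range K, ∑ j ∈ Finset.range n, f (k * n + j) := by
  induction K with
  | zero => simp
  | succ K ih =>
    rw [Finset.sum_range_succ, ← ih, Nat.succ_mul, Finset.sum_range_add]

lemma cmc_sum_blocks (f : ℕ → ℝ) (hf : ∀ y, 0 ≤ f y) (n H : ℕ) (hn : 0 < n) (hnH : n ≤ H)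
    (μ : ℝ) (hμ0 : 0 ≤ μ) (hμ : n * μ ≤ H / n)
    (hb : ∀ y0, |∑ j ∈ Finset.range n, f (y0 + j) - n * μ| ≤ 4) :
    |∑ y ∈ Finset.range H, f y - H * μ| ≤ 9 * (H / n) := by
  have hnR : (0:ℝ) < n := by exact_mod_cast hn
  set K := H / n with hK
  have hKle : K * n ≤ H := Nat.div_mul_le_self H n
  have hKge : H ≤ (K + 1) * n := by
    have := Nat.lt_div_mul_add (a := H) hn
    rw [← hK] at this
    nlinarith
  have hKR : (K : ℝ) ≤ H / n := by rw [le_div_iff₀ hnR]; exact_mod_cast hKle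
  have hKleR : (K : ℝ) * n ≤ H := by exact_mod_cast hKle
  have hKgeR : (H : ℝ) ≤ (K + 1) * n := by exact_mod_cast hKge
  have h1 : (1:ℝ) ≤ H / n := by rw [le_div_iff₀ hnR, one_mul]; exact_mod_cast hnH
  have hlow : ∑ y ∈ Finset.range (K * n), f y ≤ ∑ y ∈ Finset.range H, f y :=
    Finset.sum_le_sum_of_subset_of_nonneg (Finset.range_subset_range.2 hKle) (fun _ _ _ => hf _)
  have hup : ∑ y ∈ Finset.range H, f y ≤ ∑ y ∈ Finset.range ((K + 1) * n), f y :=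
    Finset.sum_le_sum_of_subset_of_nonneg (Finset.range_subset_range.2 hKge) (fun _ _ _ => hf _)
  rw [cmc_range_mul] at hlow hup
  have hlow2 : ∑ k ∈ Finset.range K, (n * μ - 4) ≤
      ∑ k ∈ Finset.range K, ∑ j ∈ Finset.range n, f (k * n + j) :=
    Finset.sum_le_sum fun k _ => by have := (abs_le.1 (hb (k * n))).1; linarith
  have hup2 : ∑ k ∈ Finset.range (K + 1), ∑ j ∈ Finset.range n, f (k * n + j) ≤
      ∑ k ∈ Finset.range (K + 1), (n * μ + 4) :=
    Finset.sum_le_sum fun k _ => by have := (abs_le.1 (hb (k * n))).2; linarith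
  rw [Finset.sum_const, Finset.card_range, nsmul_eq_mul] at hlow2 hup2
  push_cast at hup2
  have a1 := mul_le_mul_of_nonneg_right hKleR hμ0
  have a2 := mul_le_mul_of_nonneg_right hKgeR hμ0
  rw [abs_le]
  constructor <;> nlinarith

/-- Number of points of the lattice `x = t y` in the box. -/
noncomputable def cmcN (q H : ℕ) (t : ZMod q) : ℕ :=
  ((Finset.Icc (1:ℤ) H ×ˢ Finset.Icc (1:ℤ) H).filter
    (fun p : ℤ × ℤ => (p.1 : ZMod q) = t * (p.2 : ZMod q))).card

lemma cmc_sum_Ico (g : ℤ → ℕ) (c : ℤ) (n : ℕ) :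
    ∑ j ∈ Finset.Ico c (c + n), g j = ∑ j ∈ Finset.range n, g (c + j) := by
  induction n with
  | zero => simp
  | succ n ih =>
    rw [Finset.sum_range_succ, ← ih]
    have : Finset.Ico c (c + (n + 1 : ℕ)) = insert (c + n : ℤ) (Finset.Ico c (c + n)) := by
      ext x; simp only [Finset.mem_Ico, Finset.mem_insert]; push_cast; omega
    rw [this, Finset.sum_insert (by simp), add_comm]

lemma cmc_card_prod (A B : Finset ℤ) (P : ℤ → ℤ → Prop) [∀ x y, Decidable (P x y)] :
    ((A ×ˢ B).filter (fun p : ℤ × ℤ => P p.1 p.2)).card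
      = ∑ y ∈ B, (A.filter (fun x => P x y)).card := by
  rw [Finset.card_filter, Finset.sum_product_right]
  simp only [Finset.card_filter]

lemma cmc_asymp_one (q H n : ℕ) [NeZero q] (t : ZMod q) (a : ℤ) (hn : 0 < n) (hnq : n * n ≤ q)
    (hnH : n ≤ H) (ha : |a| ≤ n) (hat : (a : ZMod q) = t * n)
    (hmin : ∀ n' : ℕ, 0 < n' → n' < n → ∀ a' : ℤ, |a'| ≤ n' → (a' : ZMod q) ≠ t * n') :
    |(cmcN q H t : ℝ) - H * (H / q)| ≤ 9 * (H / n) := by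
  have hq0 : 0 < q := by nlinarith
  have hqR : (0:ℝ) < q := by exact_mod_cast hq0
  have hnR : (0:ℝ) < n := by exact_mod_cast hn
  obtain ⟨T, hT⟩ : ∃ T : ℤ, (T : ZMod q) = t := ⟨t.val, by simp⟩
  have hdvd : ∀ x y : ℤ, (x : ZMod q) = t * (y : ZMod q) ↔ (q : ℤ) ∣ x - T * y := by
    intro x y
    rw [← hT, ← ZMod.intCast_zmod_eq_zero_iff_dvd]
    push_cast
    rw [sub_eq_zero]
  obtain ⟨m, hm⟩ : ∃ m : ℤ, (n : ℤ) * T = m * q + a := by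
    have : (q : ℤ) ∣ a - T * n := (hdvd a n).1 (by simpa using hat)
    obtain ⟨k, hk⟩ := this
    exact ⟨-k, by linear_combination -hk⟩
  have hc : IsCoprime m (n : ℤ) := by
    rw [Int.isCoprime_iff_gcd_eq_one]
    by_contra hg
    set d := Int.gcd m n with hd
    have hdn : (d : ℤ) ∣ n := Int.gcd_dvd_right ..
    have hdm : (d : ℤ) ∣ m := Int.gcd_dvd_left ..
    have hd0 : 0 < d := Int.gcd_pos_of_ne_zero_right _ (by exact_mod_cast hn.ne')
    have hd2 : 2 ≤ d := by omega
    obtain ⟨n', hn'⟩ := Int.natCast_dvd_natCast.1 hdn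
    obtain ⟨m', hm'⟩ := hdm
    have hn'0 : 0 < n' := by
      rcases Nat.eq_zero_or_pos n' with h | h
      · subst h; omega
      · exact h
    have ha' : a = d * (n' * T - m' * q) := by
      have : (n : ℤ) = d * n' := by exact_mod_cast hn'
      rw [this, hm'] at hm
      linear_combination -hm
    refine hmin n' hn'0 (by nlinarith) (n' * T - m' * q) ?_ ?_
    · rw [ha', abs_mul, hn', Nat.cast_mul, abs_of_nonneg (by positivity : (0:ℤ) ≤ d)] at ha
      exact le_of_mul_le_mul_left ha (by exact_mod_cast hd0)
    · push_cast
      rw [hT]; simp [mul_comm]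
  set f : ℕ → ℕ := fun y => ((Finset.Icc (1:ℤ) H).filter
    (fun x => (q : ℤ) ∣ x - T * (1 + y))).card with hf
  have hN : cmcN q H t = ∑ y ∈ Finset.range H, f y := by
    unfold cmcN
    simp only [hdvd]
    rw [cmc_card_prod _ _ (fun x y => (q : ℤ) ∣ x - T * y)]
    have : Finset.Icc (1:ℤ) H = Finset.Ico (1:ℤ) (1 + H) := by
      ext x; simp only [Finset.mem_Icc, Finset.mem_Ico]; omega
    conv_lhs => rw [this]
    rw [cmc_sum_Ico]
    rw [← this]
  rw [hN]
  push_cast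
  refine cmc_sum_blocks (fun y => (f y : ℝ)) (fun _ => by positivity) n H hn hnH _
    (by positivity) ?_ ?_
  · rw [← mul_div_assoc, div_le_div_iff₀ hqR hnR]
    have : (n:ℝ) * n ≤ q := by exact_mod_cast hnq
    have hH : (0:ℝ) ≤ H := by positivity
    nlinarith
  · intro y0
    have hb := cmc_block q n H T (1 + y0) m a (by exact_mod_cast hn) (by exact_mod_cast hnq) ha
      (by positivity) hm hc
    rw [cmc_card_prod _ _ (fun x y => (q : ℤ) ∣ x - T * (1 + y0 + y))] at hb
    have h0 := cmc_sum_Ico (fun y => ((Finset.Icc (1:ℤ) H).filter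
      (fun x => (q : ℤ) ∣ x - T * (1 + y0 + y))).card) 0 n
    rw [zero_add] at h0
    rw [h0] at hb
    simp only [hf]
    push_cast at hb ⊢
    simpa only [zero_add, add_assoc, mul_div_assoc] using hb

lemma cmcN_inv (q H : ℕ) [Fact q.Prime] (t : ZMod q) (ht : t ≠ 0) :
    cmcN q H t⁻¹ = cmcN q H t := by
  unfold cmcN
  refine Finset.card_bij' (fun p _ => p.swap) (fun p _ => p.swap) ?_ ?_ ?_ ?_
  · intro p hp
    simp only [Finset.mem_filter, Finset.mem_product, Prod.fst_swap, Prod.snd_swap] at hp ⊢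
    refine ⟨hp.1.symm, ?_⟩
    rw [hp.2]; field_simp
  · intro p hp
    simp only [Finset.mem_filter, Finset.mem_product, Prod.fst_swap, Prod.snd_swap] at hp ⊢
    refine ⟨hp.1.symm, ?_⟩
    rw [hp.2]; field_simp
  · intro p _; simp
  · intro p _; simp

lemma cmc_thue (q : ℕ) [Fact q.Prime] (t : ZMod q) (ht : t ≠ 0) : ∃ n : ℕ, (0 < n ∧
    ∃ a : ℤ, |a| ≤ n ∧ ((a : ZMod q) = t * n ∨ (a : ZMod q) = t⁻¹ * n)) ∧ n * n ≤ q := by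
  have hqp : q.Prime := Fact.out
  have hq2 := hqp.two_le
  have hqR : (0:ℝ) < q := by exact_mod_cast hqp.pos
  obtain ⟨T, hT⟩ : ∃ T : ℤ, (T : ZMod q) = t := ⟨t.val, by simp⟩
  set N := Nat.sqrt q with hN
  have hN0 : 0 < N := Nat.sqrt_pos.2 hqp.pos
  have hN1 : N * N ≤ q := Nat.sqrt_le q
  have hN2 : q < (N + 1) * (N + 1) := Nat.lt_succ_sqrt q
  obtain ⟨j, k, hk0, hkN, h⟩ := Real.exists_int_int_abs_mul_sub_le ((T : ℝ) / q) hN0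
  set a : ℤ := k * T - j * q with ha
  have haN : |a| ≤ N := by
    have h1 : |(a : ℝ)| < N + 1 := by
      have : (a : ℝ) = q * (k * (T / q) - j) := by rw [ha]; push_cast; field_simp
      rw [this, abs_mul, abs_of_pos hqR]
      have hN2R : (q : ℝ) < (N + 1) * (N + 1) := by exact_mod_cast hN2
      calc (q : ℝ) * |(k:ℝ) * ((T:ℝ) / q) - j| ≤ q * (1 / (N + 1)) := by gcongr
        _ < N + 1 := by rw [mul_one_div, div_lt_iff₀ (by positivity)]; exact hN2R
    have : |a| < N + 1 := by exact_mod_cast h1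
    omega
  have hat : (a : ZMod q) = t * (k : ZMod q) := by
    rw [ha]; push_cast; rw [hT]; simp [mul_comm]
  rcases le_or_gt |a| k with hak | hak
  · lift k to ℕ using hk0.le
    refine ⟨k, ⟨by exact_mod_cast hk0, a, hak, Or.inl (by simpa using hat)⟩, ?_⟩
    have : k ≤ N := by exact_mod_cast hkN
    nlinarith
  · have hab := Int.natCast_natAbs a
    refine ⟨a.natAbs, ⟨by omega, ?_⟩, ?_⟩
    · have hk : (k : ZMod q) = t⁻¹ * (a : ZMod q) := by rw [hat]; field_simp
      rcases abs_cases a with ⟨h1, h2⟩ | ⟨h1, h2⟩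
      · refine ⟨k, ?_, Or.inr ?_⟩
        · rw [abs_of_pos hk0]; omega
        · rw [hk]; congr 1
          have : ((a.natAbs : ℤ) : ZMod q) = (a : ZMod q) := by congr 1; omega
          rw [← this]; simp
      · refine ⟨-k, ?_, Or.inr ?_⟩
        · rw [abs_neg, abs_of_pos hk0]; omega
        · push_cast
          rw [hk, ← mul_neg]; congr 1
          have : ((a.natAbs : ℤ) : ZMod q) = ((-a : ℤ) : ZMod q) := by congr 1; omega
          push_cast at this
          rw [← this]; simp
    · have : a.natAbs ≤ N := by omega
      nlinarith

lemma cmc_short (q H : ℕ) [Fact q.Prime] (t : ZMod q) (ht : t ≠ 0) :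
    (cmcN q H t = 0 ∧ H * H ≤ q) ∨
    ∃ n : ℕ, 0 < n ∧ n ≤ H ∧ (∃ a : ℤ, |a| ≤ n ∧ ((a : ZMod q) = t * n ∨ (a : ZMod q) = t⁻¹ * n)) ∧
      |(cmcN q H t : ℝ) - H * (H / q)| ≤ 9 * (H / n) := by
  classical
  obtain ⟨n0, hn0, hn0q⟩ := cmc_thue q t ht
  set P : ℕ → Prop := fun n => 0 < n ∧ ∃ a : ℤ, |a| ≤ n ∧
    ((a : ZMod q) = t * n ∨ (a : ZMod q) = t⁻¹ * n) with hP
  have hex : ∃ n, P n := ⟨n0, hn0⟩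
  set n := Nat.find hex with hn
  have hPn : P n := Nat.find_spec hex
  have hmin : ∀ k < n, ¬ P k := fun k hk => Nat.find_min hex hk
  have hnn0 : n ≤ n0 := Nat.find_le hn0
  have hnq : n * n ≤ q := by nlinarith
  rcases le_or_gt n H with hnH | hnH
  · right
    refine ⟨n, hPn.1, hnH, hPn.2, ?_⟩
    obtain ⟨hnpos, a, ha, h | h⟩ := hPn
    · exact cmc_asymp_one q H n t a hnpos hnq hnH ha h
        (fun n' h0 h1 a' ha' he => hmin n' h1 ⟨h0, a', ha', Or.inl he⟩)
    · rw [← cmcN_inv q H t ht]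
      exact cmc_asymp_one q H n t⁻¹ a hnpos hnq hnH ha h
        (fun n' h0 h1 a' ha' he => hmin n' h1 ⟨h0, a', ha', Or.inr he⟩)
  · left
    refine ⟨?_, by nlinarith⟩
    unfold cmcN
    rw [Finset.card_eq_zero, Finset.filter_eq_empty_iff]
    rintro ⟨x, y⟩ hp he
    simp only [Finset.mem_product, Finset.mem_Icc] at hp he
    obtain ⟨⟨hx1, hx2⟩, hy1, hy2⟩ := hp
    lift x to ℕ using by omega
    lift y to ℕ using by omega
    rcases le_total x y with hxy | hxy
    · refine hmin y (by omega) ⟨by omega, x, ?_, Or.inl (by simpa using he)⟩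
      rw [abs_of_nonneg] <;> omega
    · refine hmin x (by omega) ⟨by omega, y, ?_, Or.inr ?_⟩
      · rw [abs_of_nonneg] <;> omega
      · simp only [Int.cast_natCast] at he ⊢
        rw [he]; field_simp

lemma cmc_variance (q H : ℕ) [Fact q.Prime] (hH : 0 < H) (hHq : H < q) :
    ∑ t ∈ (Finset.univ : Finset (ZMod q)).filter (· ≠ 0), ((cmcN q H t : ℝ) - H * (H / q)) ^ 2
      ≤ 487 * H ^ 2 * (1 + Real.log q) := by
  have hqp : q.Prime := Fact.out
  have hqR : (0:ℝ) < q := by exact_mod_cast hqp.pos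
  have hHR : (0:ℝ) < H := by exact_mod_cast hH
  set I1 : ZMod q → ℕ → ℤ → ℝ := fun t n a => if (a : ZMod q) = t * n then 1 else 0 with hI1
  set I2 : ZMod q → ℕ → ℤ → ℝ := fun t n a => if (a : ZMod q) = t⁻¹ * n then 1 else 0 with hI2
  have hI1n : ∀ t n a, 0 ≤ I1 t n a := fun t n a => by simp only [hI1]; split_ifs <;> norm_num
  have hI2n : ∀ t n a, 0 ≤ I2 t n a := fun t n a => by simp only [hI2]; split_ifs <;> norm_num
  have hterm : ∀ (t : ZMod q) (n : ℕ) (a : ℤ), 0 ≤ 81 * (H:ℝ) ^ 2 / n ^ 2 * (I1 t n a + I2 t n a) :=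
    fun t n a => mul_nonneg (by positivity) (add_nonneg (hI1n t n a) (hI2n t n a))
  have hpt : ∀ t : ZMod q, t ≠ 0 → ((cmcN q H t : ℝ) - H * (H / q)) ^ 2 ≤ H ^ 2 / q +
      ∑ n ∈ Finset.Icc 1 H, ∑ a ∈ Finset.Icc (-(n:ℤ)) n,
        81 * (H:ℝ) ^ 2 / n ^ 2 * (I1 t n a + I2 t n a) := by
    intro t ht
    rcases cmc_short q H t ht with ⟨h0, hHH⟩ | ⟨n, hn0, hnH, ⟨a, ha, hor⟩, hE⟩
    · have h1 : ((cmcN q H t : ℝ) - H * (H / q)) ^ 2 ≤ H ^ 2 / q := by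
        rw [h0]
        have : (H:ℝ) * H ≤ q := by exact_mod_cast hHH
        have h2 : (H:ℝ) ^ 2 / q ≤ 1 := by rw [div_le_one hqR]; nlinarith
        have h3 : (0:ℝ) ≤ (H:ℝ) ^ 2 / q := by positivity
        have h4 : (((0:ℕ):ℝ) - H * (H / q)) ^ 2 = ((H:ℝ) ^ 2 / q) * ((H:ℝ) ^ 2 / q) := by
          push_cast; ring
        rw [h4]; nlinarith
      have := Finset.sum_nonneg (s := Finset.Icc 1 H) fun n _ =>
        Finset.sum_nonneg (s := Finset.Icc (-(n:ℤ)) n) fun a _ => hterm t n a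
      linarith
    · have h1 : ((cmcN q H t : ℝ) - H * (H / q)) ^ 2 ≤ 81 * (H:ℝ) ^ 2 / n ^ 2 := by
        have h0 : (0:ℝ) ≤ 9 * (H / n) := by positivity
        have := sq_le_sq' (by linarith [(abs_le.1 hE).1]) (abs_le.1 hE).2
        refine this.trans (le_of_eq (by ring))
      have h2 : 81 * (H:ℝ) ^ 2 / n ^ 2 ≤ 81 * (H:ℝ) ^ 2 / n ^ 2 * (I1 t n a + I2 t n a) := by
        have : 1 ≤ I1 t n a + I2 t n a := by
          rcases hor with h | h
          · have : I1 t n a = 1 := by simp only [hI1]; rw [if_pos h]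
            linarith [hI2n t n a]
          · have : I2 t n a = 1 := by simp only [hI2]; rw [if_pos h]
            linarith [hI1n t n a]
        exact le_mul_of_one_le_right (by positivity) this
      have h3 : 81 * (H:ℝ) ^ 2 / n ^ 2 * (I1 t n a + I2 t n a) ≤ ∑ a ∈ Finset.Icc (-(n:ℤ)) n,
        81 * (H:ℝ) ^ 2 / n ^ 2 * (I1 t n a + I2 t n a) :=
        Finset.single_le_sum (f := fun a => 81 * (H:ℝ) ^ 2 / n ^ 2 * (I1 t n a + I2 t n a))
          (fun a _ => hterm t n a) (Finset.mem_Icc.2 (abs_le.1 ha))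
      have h4 := Finset.single_le_sum (s := Finset.Icc 1 H)
          (f := fun n : ℕ => ∑ a ∈ Finset.Icc (-(n:ℤ)) n,
            81 * (H:ℝ) ^ 2 / n ^ 2 * (I1 t n a + I2 t n a))
          (fun n _ => Finset.sum_nonneg fun a _ => hterm t n a) (Finset.mem_Icc.2 ⟨hn0, hnH⟩)
      have h5 : (0:ℝ) ≤ (H:ℝ) ^ 2 / q := by positivity
      linarith
  set U := (Finset.univ : Finset (ZMod q)).filter (· ≠ 0) with hU
  have hUcard : (U.card : ℝ) ≤ q := by
    have : U.card ≤ q := (Finset.card_filter_le _ _).trans (by simp [ZMod.card])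
    exact_mod_cast this
  have hnz : ∀ n ∈ Finset.Icc 1 H, (n : ZMod q) ≠ 0 := by
    intro n hn h
    rw [Finset.mem_Icc] at hn
    rw [ZMod.natCast_eq_zero_iff] at h
    have := Nat.le_of_dvd (by omega) h
    omega
  have hs1 : ∀ n ∈ Finset.Icc 1 H, ∀ a : ℤ, ∑ t ∈ U, I1 t n a ≤ 1 := by
    intro n hn a
    simp only [hI1]
    rw [Finset.sum_boole]
    have : (U.filter (fun t => (a : ZMod q) = t * n)).card ≤ 1 := by
      rw [Finset.card_le_one]
      intro x hx y hy
      have e := (Finset.mem_filter.1 hx).2.symm.trans (Finset.mem_filter.1 hy).2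
      exact mul_right_cancel₀ (hnz n hn) e
    exact_mod_cast this
  have hs2 : ∀ n ∈ Finset.Icc 1 H, ∀ a : ℤ, ∑ t ∈ U, I2 t n a ≤ 1 := by
    intro n hn a
    simp only [hI2]
    rw [Finset.sum_boole]
    have : (U.filter (fun t => (a : ZMod q) = t⁻¹ * n)).card ≤ 1 := by
      rw [Finset.card_le_one]
      intro x hx y hy
      have e := (Finset.mem_filter.1 hx).2.symm.trans (Finset.mem_filter.1 hy).2
      exact inv_injective (mul_right_cancel₀ (hnz n hn) e)
    exact_mod_cast this
  have hharm : ∑ n ∈ Finset.Icc 1 H, ((n:ℝ))⁻¹ ≤ 1 + Real.log q := by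
    have h1 := harmonic_le_one_add_log H
    rw [harmonic_eq_sum_Icc] at h1
    push_cast at h1
    have h2 : Real.log H ≤ Real.log q := Real.log_le_log hHR (by exact_mod_cast hHq.le)
    linarith
  have hlog : 0 ≤ Real.log q := Real.log_natCast_nonneg q
  calc _ ≤ ∑ t ∈ U, ((H:ℝ) ^ 2 / q + ∑ n ∈ Finset.Icc 1 H, ∑ a ∈ Finset.Icc (-(n:ℤ)) n,
        81 * (H:ℝ) ^ 2 / n ^ 2 * (I1 t n a + I2 t n a)) :=
        Finset.sum_le_sum fun t ht => hpt t (Finset.mem_filter.1 ht).2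
    _ = U.card * ((H:ℝ) ^ 2 / q) + ∑ n ∈ Finset.Icc 1 H, ∑ a ∈ Finset.Icc (-(n:ℤ)) n,
        81 * (H:ℝ) ^ 2 / n ^ 2 * (∑ t ∈ U, I1 t n a + ∑ t ∈ U, I2 t n a) := by
        rw [Finset.sum_add_distrib, Finset.sum_const, nsmul_eq_mul, Finset.sum_comm]
        congr 1
        refine Finset.sum_congr rfl fun n _ => ?_
        rw [Finset.sum_comm]
        refine Finset.sum_congr rfl fun a _ => ?_
        rw [← Finset.mul_sum, Finset.sum_add_distrib]
    _ ≤ q * ((H:ℝ) ^ 2 / q) + ∑ n ∈ Finset.Icc 1 H, ∑ a ∈ Finset.Icc (-(n:ℤ)) n,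
        81 * (H:ℝ) ^ 2 / n ^ 2 * (1 + 1) := by
        refine add_le_add (mul_le_mul_of_nonneg_right hUcard (by positivity)) ?_
        refine Finset.sum_le_sum fun n hn => Finset.sum_le_sum fun a _ => ?_
        exact mul_le_mul_of_nonneg_left (add_le_add (hs1 n hn a) (hs2 n hn a)) (by positivity)
    _ ≤ (H:ℝ) ^ 2 + ∑ n ∈ Finset.Icc 1 H, 486 * (H:ℝ) ^ 2 * (n:ℝ)⁻¹ := by
        refine add_le_add (le_of_eq (by field_simp)) ?_
        refine Finset.sum_le_sum fun n hn => ?_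
        rw [Finset.sum_const, nsmul_eq_mul, Int.card_Icc]
        have hn1 : 1 ≤ n := (Finset.mem_Icc.1 hn).1
        have hnR : (1:ℝ) ≤ n := by exact_mod_cast hn1
        have : ((n:ℤ) + 1 - -(n:ℤ)).toNat = 2 * n + 1 := by omega
        rw [this]
        push_cast
        have h3 : (2 * (n:ℝ) + 1) ≤ 3 * n := by linarith
        calc (2 * (n:ℝ) + 1) * (81 * (H:ℝ) ^ 2 / n ^ 2 * (1 + 1))
            ≤ (3 * n) * (81 * (H:ℝ) ^ 2 / n ^ 2 * (1 + 1)) :=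
              mul_le_mul_of_nonneg_right h3 (by positivity)
          _ = _ := by field_simp; ring
    _ ≤ (H:ℝ) ^ 2 * 1 + 486 * (H:ℝ) ^ 2 * (1 + Real.log q) := by
        rw [← Finset.mul_sum, mul_one]
        gcongr
    _ ≤ _ := by nlinarith [sq_nonneg (H:ℝ)]

lemma cmc_conj (q : ℕ) [Fact q.Prime] (χ : DirichletCharacter ℂ q) (a : ZMod q) :
    (starRingEnd ℂ) (χ a) = χ a⁻¹ := by
  rw [← MulChar.inv_apply', ← MulChar.star_apply']; rfl

lemma cmc_totient (q : ℕ) [Fact q.Prime] : ((q.totient : ℕ) : ℝ) = q - 1 := by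
  have hqp : q.Prime := Fact.out
  rw [Nat.totient_prime hqp, Nat.cast_sub hqp.one_le]; simp

lemma cmc_parseval (q : ℕ) [Fact q.Prime] (g : ZMod q → ℂ) :
    ∑ χ : DirichletCharacter ℂ q, ‖∑ t, g t * χ t‖ ^ 2
      = (q - 1) * ∑ t ∈ (Finset.univ : Finset (ZMod q)).filter (· ≠ 0), ‖g t‖ ^ 2 := by
  have h : ((∑ χ : DirichletCharacter ℂ q, ‖∑ t, g t * χ t‖ ^ 2 : ℝ) : ℂ)
      = (((q.totient : ℝ) * ∑ t ∈ (Finset.univ : Finset (ZMod q)).filter (· ≠ 0), ‖g t‖ ^ 2 : ℝ) : ℂ) := by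
    push_cast
    calc _ = ∑ χ : DirichletCharacter ℂ q, ∑ s, ∑ t,
          ((starRingEnd ℂ) (g s) * g t) * (χ s⁻¹ * χ t) := by
          refine Finset.sum_congr rfl fun χ _ => ?_
          rw [← Complex.conj_mul', map_sum, Finset.sum_mul_sum]
          refine Finset.sum_congr rfl fun s _ => Finset.sum_congr rfl fun t _ => ?_
          rw [map_mul, cmc_conj]; ring
      _ = ∑ s, ∑ t, ((starRingEnd ℂ) (g s) * g t) *
          ∑ χ : DirichletCharacter ℂ q, (χ s⁻¹ * χ t) := by
          rw [Finset.sum_comm]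
          refine Finset.sum_congr rfl fun s _ => ?_
          rw [Finset.sum_comm]
          refine Finset.sum_congr rfl fun t _ => ?_
          rw [Finset.mul_sum]
      _ = ∑ s, if s ≠ 0 then (q.totient : ℂ) * (‖g s‖ : ℂ) ^ 2 else 0 := by
          refine Finset.sum_congr rfl fun s _ => ?_
          split_ifs with hs
          · have : ∀ t, ∑ χ : DirichletCharacter ℂ q, (χ s⁻¹ * χ t)
                = if s = t then (q.totient : ℂ) else 0 := fun t =>
              DirichletCharacter.sum_char_inv_mul_char_eq ℂ (isUnit_iff_ne_zero.2 hs) t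
            simp only [this, mul_ite, mul_zero, Finset.sum_ite_eq, Finset.mem_univ, if_true]
            rw [Complex.conj_mul', mul_comm]
          · have hs0 : s = 0 := by simpa using hs
            subst hs0
            refine Finset.sum_eq_zero fun t _ => ?_
            simp [MulChar.map_zero]
      _ = _ := by
          rw [← Finset.sum_filter, Finset.mul_sum]
  rw [← cmc_totient q]
  exact_mod_cast h

lemma cmc_fiber {α : Type*} (q : ℕ) [Fact q.Prime] (A : Finset α) (φ : α → ZMod q) (F : ZMod q → ℂ) :
    ∑ x ∈ A, F (φ x) = ∑ t, ((A.filter (fun x => φ x = t)).card : ℂ) * F t := by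
  rw [← Finset.sum_fiberwise A φ (fun x => F (φ x))]
  refine Finset.sum_congr rfl fun t _ => ?_
  rw [← nsmul_eq_mul, ← Finset.sum_const]
  refine Finset.sum_congr rfl fun x hx => ?_
  rw [(Finset.mem_filter.1 hx).2]

/-- Character sum over `1..h`. -/
noncomputable def cmcS (q h : ℕ) (χ : DirichletCharacter ℂ q) : ℂ :=
  ∑ x ∈ Finset.Icc (1:ℤ) h, χ (x : ZMod q)

lemma cmc_cast_ne (q h : ℕ) (hh : h < q) (x : ℤ) (hx : |x| ≤ h) (h0 : x ≠ 0) :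
    (x : ZMod q) ≠ 0 := by
  intro h
  rw [ZMod.intCast_zmod_eq_zero_iff_dvd] at h
  have := Int.eq_zero_of_abs_lt_dvd h (by omega)
  exact h0 this

lemma cmc_second (q h : ℕ) [Fact q.Prime] (hh : h < q) :
    ∑ χ : DirichletCharacter ℂ q, ‖cmcS q h χ‖ ^ 2 ≤ (q - 1) * h := by
  have hqp : q.Prime := Fact.out
  set g : ZMod q → ℕ := fun t => ((Finset.Icc (1:ℤ) h).filter (fun x : ℤ => (x : ZMod q) = t)).card with hg
  have h1 : ∀ χ : DirichletCharacter ℂ q, cmcS q h χ = ∑ t, ((g t : ℕ) : ℂ) * χ t := fun χ =>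
    cmc_fiber q (Finset.Icc (1:ℤ) h) (fun x : ℤ => (x : ZMod q)) (fun t => χ t)
  simp only [h1]
  rw [cmc_parseval]
  have hq1 : (0:ℝ) ≤ q - 1 := by
    have : (1:ℝ) ≤ q := by exact_mod_cast hqp.one_le
    linarith
  refine mul_le_mul_of_nonneg_left ?_ hq1
  have hg1 : ∀ t, g t ≤ 1 := by
    intro t
    rw [hg, Finset.card_le_one]
    intro x hx y hy
    rw [Finset.mem_filter, Finset.mem_Icc] at hx hy
    by_contra hne
    refine cmc_cast_ne q h hh (x - y) (by rw [abs_le]; omega) (sub_ne_zero.2 hne) ?_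
    push_cast
    rw [hx.2, hy.2, sub_self]
  have hsum : ∑ t, g t = h := by
    have := Finset.card_eq_sum_card_fiberwise (s := Finset.Icc (1:ℤ) h)
      (t := (Finset.univ : Finset (ZMod q))) (f := fun x : ℤ => (x : ZMod q)) (fun _ _ => by simp)
    rw [Int.card_Icc] at this
    simp only [hg]
    rw [← this]; omega
  calc _ ≤ ∑ t, ‖((g t : ℕ) : ℂ)‖ ^ 2 :=
        Finset.sum_le_sum_of_subset_of_nonneg (Finset.filter_subset _ _) fun _ _ _ => by positivity
    _ ≤ ∑ t, (g t : ℝ) := by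
        refine Finset.sum_le_sum fun t _ => ?_
        rw [Complex.norm_natCast]
        have : (g t : ℝ) ≤ 1 := by exact_mod_cast hg1 t
        have : (0:ℝ) ≤ g t := by positivity
        nlinarith
    _ = h := by exact_mod_cast hsum

lemma cmc_fourth (q h : ℕ) [Fact q.Prime] (h0 : 0 < h) (hh : h < q) :
    ∑ χ ∈ (Finset.univ : Finset (DirichletCharacter ℂ q)).filter (· ≠ 1), ‖cmcS q h χ‖ ^ 4
      ≤ (q - 1) * (487 * h ^ 2 * (1 + Real.log q)) := by
  have hqp : q.Prime := Fact.out
  have hq1 : (0:ℝ) ≤ q - 1 := by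
    have : (1:ℝ) ≤ q := by exact_mod_cast hqp.one_le
    linarith
  set c : ℝ := h * (h / q) with hc
  set g : ZMod q → ℂ := fun t => (((cmcN q h t : ℝ) - c : ℝ) : ℂ) with hg
  have hN : ∀ χ : DirichletCharacter ℂ q,
      cmcS q h χ * (starRingEnd ℂ) (cmcS q h χ) = ∑ t, ((cmcN q h t : ℕ) : ℂ) * χ t := by
    intro χ
    unfold cmcS
    rw [map_sum, Finset.sum_mul_sum, ← Finset.sum_product']
    have : ∀ p : ℤ × ℤ, χ (p.1 : ZMod q) * (starRingEnd ℂ) (χ (p.2 : ZMod q))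
        = χ ((p.1 : ZMod q) * (p.2 : ZMod q)⁻¹) := by
      intro p; rw [cmc_conj, map_mul]
    simp only [this]
    rw [cmc_fiber q _ (fun p : ℤ × ℤ => (p.1 : ZMod q) * (p.2 : ZMod q)⁻¹)]
    refine Finset.sum_congr rfl fun t _ => ?_
    congr 2
    unfold cmcN
    congr 1
    refine Finset.filter_congr fun p hp => ?_
    rw [Finset.mem_product, Finset.mem_Icc, Finset.mem_Icc] at hp
    have : (p.2 : ZMod q) ≠ 0 := cmc_cast_ne q h hh p.2 (by rw [abs_le]; omega) (by omega)
    rw [mul_inv_eq_iff_eq_mul₀ this]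
  have hχ : ∀ χ : DirichletCharacter ℂ q, χ ≠ 1 → ‖cmcS q h χ‖ ^ 4 = ‖∑ t, g t * χ t‖ ^ 2 := by
    intro χ hne
    have h1 : ∑ t, g t * χ t = cmcS q h χ * (starRingEnd ℂ) (cmcS q h χ) := by
      rw [hN]
      have : ∀ t, g t * χ t = ((cmcN q h t : ℕ) : ℂ) * χ t - c * χ t := by
        intro t; simp only [hg]; push_cast; ring
      simp only [this]
      rw [Finset.sum_sub_distrib, ← Finset.mul_sum, MulChar.sum_eq_zero_of_ne_one hne]
      simp
    rw [h1, norm_mul, RCLike.norm_conj]; ring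
  calc _ = ∑ χ ∈ (Finset.univ : Finset (DirichletCharacter ℂ q)).filter (· ≠ 1),
        ‖∑ t, g t * χ t‖ ^ 2 :=
        Finset.sum_congr rfl fun χ h => hχ χ (Finset.mem_filter.1 h).2
    _ ≤ ∑ χ : DirichletCharacter ℂ q, ‖∑ t, g t * χ t‖ ^ 2 :=
        Finset.sum_le_sum_of_subset_of_nonneg (Finset.filter_subset _ _) fun _ _ _ => by positivity
    _ ≤ _ := by
        rw [cmc_parseval]
        refine mul_le_mul_of_nonneg_left ?_ hq1
        refine le_trans (le_of_eq ?_) (cmc_variance q h h0 hh)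
        refine Finset.sum_congr rfl fun t _ => ?_
        simp only [hg]
        rw [Complex.norm_real, Real.norm_eq_abs, sq_abs]

/-- Normalised size of the nontrivial character sums. -/
noncomputable def cmcG (q h : ℕ) (χ : DirichletCharacter ℂ q) : ℝ :=
  open Classical in if χ = 1 then 0 else ‖cmcS q h χ‖ / Real.sqrt h

lemma cmcG_nonneg (q h : ℕ) (χ : DirichletCharacter ℂ q) : 0 ≤ cmcG q h χ := by
  unfold cmcG; split_ifs <;> positivity

lemma cmc_third (q h : ℕ) [Fact q.Prime] (h0 : 0 < h) (hh : h < q) :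
    ∑ χ : DirichletCharacter ℂ q, cmcG q h χ ^ 3 ≤ (q - 1) * (488 * (1 + Real.log q)) := by
  classical
  have hqp : q.Prime := Fact.out
  have hq1 : (0:ℝ) ≤ q - 1 := by
    have : (1:ℝ) ≤ q := by exact_mod_cast hqp.one_le
    linarith
  have hhR : (0:ℝ) < h := by exact_mod_cast h0
  have hlog : 0 ≤ Real.log q := Real.log_natCast_nonneg q
  have hs : Real.sqrt h ^ 2 = h := Real.sq_sqrt hhR.le
  have hs4 : Real.sqrt h ^ 4 = h ^ 2 := by
    calc Real.sqrt (h:ℝ) ^ 4 = (Real.sqrt (h:ℝ) ^ 2) ^ 2 := by ring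
      _ = (h:ℝ) ^ 2 := by rw [hs]
  have h2 : ∑ χ : DirichletCharacter ℂ q, cmcG q h χ ^ 2 ≤ q - 1 := by
    calc _ ≤ ∑ χ : DirichletCharacter ℂ q, ‖cmcS q h χ‖ ^ 2 / h := by
          refine Finset.sum_le_sum fun χ _ => ?_
          unfold cmcG
          split_ifs
          · rw [zero_pow (by norm_num)]; positivity
          · rw [div_pow, hs]
      _ ≤ _ := by
          rw [← Finset.sum_div, div_le_iff₀ hhR]
          exact cmc_second q h hh
  have h4 : ∑ χ : DirichletCharacter ℂ q, cmcG q h χ ^ 4 ≤ (q - 1) * (487 * (1 + Real.log q)) := by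
    calc _ = ∑ χ ∈ (Finset.univ : Finset (DirichletCharacter ℂ q)).filter (· ≠ 1),
            ‖cmcS q h χ‖ ^ 4 / h ^ 2 := by
          rw [Finset.sum_filter]
          refine Finset.sum_congr rfl fun χ _ => ?_
          unfold cmcG
          by_cases hχ : χ = 1
          · simp [hχ]
          · rw [if_neg hχ, if_pos hχ, div_pow, hs4]
      _ ≤ _ := by
          rw [← Finset.sum_div, div_le_iff₀ (by positivity)]
          refine le_trans ?_ ((cmc_fourth q h h0 hh).trans (le_of_eq (by ring)))
          apply le_of_eq
          refine Finset.sum_congr ?_ fun _ _ => rfl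
          ext; simp
  calc _ ≤ ∑ χ : DirichletCharacter ℂ q, (cmcG q h χ ^ 2 + cmcG q h χ ^ 4) := by
        refine Finset.sum_le_sum fun χ _ => ?_
        nlinarith [sq_nonneg (cmcG q h χ), sq_nonneg (cmcG q h χ * (cmcG q h χ - 1)),
          cmcG_nonneg q h χ, sq_nonneg (cmcG q h χ ^ 2)]
    _ ≤ (q - 1) + (q - 1) * (487 * (1 + Real.log q)) := by
        rw [Finset.sum_add_distrib]; exact add_le_add h2 h4
    _ ≤ _ := by nlinarith [mul_nonneg hq1 hlog]

lemma cmc_kernel (q : ℕ) [Fact q.Prime] (r : ℤ) (hr : r ≠ 0) [DecidableEq (DirichletCharacter ℂ q)] :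
    ((Finset.univ : Finset (DirichletCharacter ℂ q)).filter (fun χ => χ ^ r = 1)).card ≤ r.natAbs := by
  obtain ⟨e⟩ := DirichletCharacter.mulEquiv_units ℂ q
  have : IsCyclic (DirichletCharacter ℂ q) := isCyclic_of_surjective e.symm e.symm.surjective
  have := IsCyclic.card_pow_eq_one_le (α := DirichletCharacter ℂ q) (n := r.natAbs) (by omega)
  refine le_trans (le_of_eq ?_) this
  congr 1
  refine Finset.filter_congr fun χ _ => ?_
  rcases Int.natAbs_eq r with h | h
  · conv_lhs => rw [h]
    rw [zpow_natCast]
  · conv_lhs => rw [h]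
    rw [zpow_neg, zpow_natCast, inv_eq_one]

lemma cmc_sum_pow (q : ℕ) [Fact q.Prime] (r : ℤ) (hr : r ≠ 0) (F : DirichletCharacter ℂ q → ℝ)
    (hF : ∀ χ, 0 ≤ F χ) :
    ∑ χ : DirichletCharacter ℂ q, F (χ ^ r) ≤ r.natAbs * ∑ χ : DirichletCharacter ℂ q, F χ := by
  classical
  rw [← Finset.sum_fiberwise Finset.univ (fun χ : DirichletCharacter ℂ q => χ ^ r), Finset.mul_sum]
  refine Finset.sum_le_sum fun ψ _ => ?_
  have h1 : ∑ χ ∈ Finset.univ.filter (fun χ : DirichletCharacter ℂ q => χ ^ r = ψ), F (χ ^ r)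
      = (Finset.univ.filter (fun χ : DirichletCharacter ℂ q => χ ^ r = ψ)).card * F ψ := by
    rw [← nsmul_eq_mul, ← Finset.sum_const]
    exact Finset.sum_congr rfl fun x hx => by rw [(Finset.mem_filter.1 hx).2]
  rw [h1]
  refine mul_le_mul_of_nonneg_right ?_ (hF ψ)
  have : (Finset.univ.filter (fun χ : DirichletCharacter ℂ q => χ ^ r = ψ)).card ≤ r.natAbs := by
    rcases (Finset.univ.filter (fun χ : DirichletCharacter ℂ q => χ ^ r = ψ)).eq_empty_or_nonempty
      with h | ⟨χ₀, h⟩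
    · rw [h]; simp
    · refine le_trans ?_ (cmc_kernel q r hr)
      have h' := (Finset.mem_filter.1 h).2
      apply Finset.card_le_card_of_injOn (fun χ => χ * χ₀⁻¹)
      · intro χ hχ
        have hχ' := (Finset.mem_filter.1 hχ).2
        simp only [Finset.coe_filter, Finset.mem_univ, true_and, Set.mem_ofPred_eq]
        rw [mul_zpow, hχ', inv_zpow, h', mul_inv_cancel]
      · intro a _ b _ hab
        exact mul_right_cancel hab
  exact_mod_cast this

lemma cmcS_le (q h : ℕ) (χ : DirichletCharacter ℂ q) : ‖cmcS q h χ‖ ≤ h := by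
  unfold cmcS
  refine (norm_sum_le _ _).trans ?_
  refine (Finset.sum_le_sum (s := Finset.Icc (1:ℤ) h)
    (f := fun x : ℤ => ‖χ (x : ZMod q)‖) (g := fun _ => (1:ℝ)) fun x _ => DirichletCharacter.norm_le_one χ (x : ZMod q)).trans ?_
  rw [Finset.sum_const, Int.card_Icc]
  simp

lemma cmcT_le (q h : ℕ) (χ : DirichletCharacter ℂ q) :
    ‖∑ y ∈ (Finset.Icc (-(h:ℤ)) h).filter (· ≠ 0), χ (y : ZMod q)‖ ≤ 2 * ‖cmcS q h χ‖ := by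
  have hsplit : (Finset.Icc (-(h:ℤ)) h).filter (· ≠ 0) =
      Finset.Icc (1:ℤ) h ∪ (Finset.Icc (1:ℤ) h).image (fun x => -x) := by
    ext x
    simp only [Finset.mem_filter, Finset.mem_union, Finset.mem_image, Finset.mem_Icc]
    constructor
    · rintro ⟨h1, h2⟩
      rcases lt_or_gt_of_ne h2 with h3 | h3
      · exact Or.inr ⟨-x, by omega, by omega⟩
      · exact Or.inl (by omega)
    · rintro (h1 | ⟨y, hy, rfl⟩) <;> omega
  have hdis : Disjoint (Finset.Icc (1:ℤ) h) ((Finset.Icc (1:ℤ) h).image (fun x => -x)) := by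
    rw [Finset.disjoint_left]
    intro x hx hx'
    simp only [Finset.mem_image, Finset.mem_Icc] at hx hx'
    obtain ⟨y, hy, hxy⟩ := hx'
    omega
  rw [hsplit, Finset.sum_union hdis, Finset.sum_image (fun a _ b _ hab => neg_injective hab)]
  have : ∑ x ∈ Finset.Icc (1:ℤ) h, χ ((-x : ℤ) : ZMod q) = χ (-1) * cmcS q h χ := by
    unfold cmcS
    rw [Finset.mul_sum]
    refine Finset.sum_congr rfl fun x _ => ?_
    rw [← map_mul]; push_cast; congr 1; ring
  rw [this]
  change ‖cmcS q h χ + χ (-1) * cmcS q h χ‖ ≤ _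
  refine (norm_add_le _ _).trans ?_
  rw [norm_mul]
  have := DirichletCharacter.norm_le_one χ (-1)
  nlinarith [norm_nonneg (cmcS q h χ)]

lemma cmc_zpow (q : ℕ) [Fact q.Prime] (χ : DirichletCharacter ℂ q) (r : ℤ) (y : ZMod q) (hy : y ≠ 0) :
    χ (y ^ r) = (χ ^ r) y := by
  have := MulChar.zpow_apply_coe χ r (Units.mk0 y hy)
  simpa using this.symm

lemma cmc_count (q : ℕ) [Fact q.Prime] (r₁ r₂ r₃ : ℤ) (lam : ZMod q) (A₁ A₂ A₃ : Finset ℤ)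
    (h₁ : ∀ y ∈ A₁, (y : ZMod q) ≠ 0) (h₂ : ∀ y ∈ A₂, (y : ZMod q) ≠ 0)
    (h₃ : ∀ y ∈ A₃, (y : ZMod q) ≠ 0) :
    ((((A₁ ×ˢ A₂ ×ˢ A₃).filter (fun y : ℤ × ℤ × ℤ => lam * ((y.1 : ZMod q)) ^ r₁ *
      ((y.2.1 : ZMod q)) ^ r₂ * ((y.2.2 : ZMod q)) ^ r₃ = 1)).card : ℕ) : ℝ) * (q - 1) ≤
    ∑ χ : DirichletCharacter ℂ q, ‖∑ y ∈ A₁, (χ ^ r₁) (y : ZMod q)‖ *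
      ‖∑ y ∈ A₂, (χ ^ r₂) (y : ZMod q)‖ * ‖∑ y ∈ A₃, (χ ^ r₃) (y : ZMod q)‖ := by
  set J := ((A₁ ×ˢ A₂ ×ˢ A₃).filter (fun y : ℤ × ℤ × ℤ => lam * ((y.1 : ZMod q)) ^ r₁ *
      ((y.2.1 : ZMod q)) ^ r₂ * ((y.2.2 : ZMod q)) ^ r₃ = 1)).card with hJ
  have key : (J : ℂ) * (q.totient : ℂ) = ∑ χ : DirichletCharacter ℂ q, χ lam *
      ((∑ y ∈ A₁, (χ ^ r₁) (y : ZMod q)) * ((∑ y ∈ A₂, (χ ^ r₂) (y : ZMod q)) *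
       (∑ y ∈ A₃, (χ ^ r₃) (y : ZMod q)))) := by
    calc (J : ℂ) * (q.totient : ℂ) = ∑ y ∈ A₁ ×ˢ A₂ ×ˢ A₃, ∑ χ : DirichletCharacter ℂ q,
          χ (lam * ((y.1 : ZMod q)) ^ r₁ * ((y.2.1 : ZMod q)) ^ r₂ * ((y.2.2 : ZMod q)) ^ r₃) := by
          simp only [DirichletCharacter.sum_characters_eq]
          rw [← Finset.sum_filter, Finset.sum_const, nsmul_eq_mul]
      _ = _ := by
          rw [Finset.sum_comm]
          refine Finset.sum_congr rfl fun χ _ => ?_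
          rw [Finset.sum_product]
          rw [Finset.sum_mul_sum, Finset.sum_mul_sum]
          simp only [Finset.sum_product, Finset.mul_sum]
          refine Finset.sum_congr rfl fun a ha => Finset.sum_congr rfl fun b hb =>
            Finset.sum_congr rfl fun c hc => ?_
          rw [map_mul, map_mul, map_mul, cmc_zpow q χ r₁ _ (h₁ a ha), cmc_zpow q χ r₂ _ (h₂ b hb),
            cmc_zpow q χ r₃ _ (h₃ c hc)]
          ring
  have h2 : (J : ℝ) * (q - 1) = ‖(J : ℂ) * (q.totient : ℂ)‖ := by
    rw [norm_mul, Complex.norm_natCast, Complex.norm_natCast, cmc_totient]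
  rw [h2, key]
  refine (norm_sum_le _ _).trans (Finset.sum_le_sum fun χ _ => ?_)
  rw [norm_mul, norm_mul, norm_mul, mul_assoc]
  exact mul_le_of_le_one_left (by positivity) (DirichletCharacter.norm_le_one χ lam)

theorem count_multiplicative_congruence (R : ℕ) :
    ∃ C : ℝ, 0 < C ∧ ∀ (q : ℕ) [Fact q.Prime] (r₁ r₂ r₃ : ℤ)
      (lam : ZMod q) (h₁ h₂ h₃ : ℕ),
      r₁ ≠ 0 → r₂ ≠ 0 → r₃ ≠ 0 → r₁.natAbs + r₂.natAbs + r₃.natAbs ≤ R →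
      lam ≠ 0 → 0 < h₁ → h₁ < q → 0 < h₂ → h₂ < q → 0 < h₃ → h₃ < q →
      (((Finset.Icc (-(h₁ : ℤ)) h₁ ×ˢ Finset.Icc (-(h₂ : ℤ)) h₂ ×ˢ
          Finset.Icc (-(h₃ : ℤ)) h₃).filter
        (fun y : ℤ × ℤ × ℤ => y.1 ≠ 0 ∧ y.2.1 ≠ 0 ∧ y.2.2 ≠ 0 ∧
          lam * ((y.1 : ZMod q)) ^ r₁ * ((y.2.1 : ZMod q)) ^ r₂ *
            ((y.2.2 : ZMod q)) ^ r₃ = 1)).card : ℝ)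
      ≤ C * ((h₁ * h₂ * h₃ : ℝ) / q +
          Real.sqrt ((h₁ : ℝ) * h₂ * h₃) * Real.log q) := by
  classical
  refine ⟨16000 * (R + 1), by positivity, ?_⟩
  intro q _ r₁ r₂ r₃ lam h₁ h₂ h₃ hr₁ hr₂ hr₃ hR hlam p₁ l₁ p₂ l₂ p₃ l₃
  have hqp : q.Prime := Fact.out
  have hq2 : (2:ℝ) ≤ q := by exact_mod_cast hqp.two_le
  have hqR : (0:ℝ) < q := by linarith
  have hq1 : (0:ℝ) < q - 1 := by linarith
  have hlog : 1 / 2 ≤ Real.log q := by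
    have h1 : Real.log 2 ≤ Real.log q := Real.log_le_log (by norm_num) hq2
    have := Real.log_two_gt_d9
    linarith
  have hset : (Finset.Icc (-(h₁ : ℤ)) h₁ ×ˢ Finset.Icc (-(h₂ : ℤ)) h₂ ×ˢ
          Finset.Icc (-(h₃ : ℤ)) h₃).filter
        (fun y : ℤ × ℤ × ℤ => y.1 ≠ 0 ∧ y.2.1 ≠ 0 ∧ y.2.2 ≠ 0 ∧
          lam * ((y.1 : ZMod q)) ^ r₁ * ((y.2.1 : ZMod q)) ^ r₂ *
            ((y.2.2 : ZMod q)) ^ r₃ = 1) =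
      ((Finset.Icc (-(h₁ : ℤ)) h₁).filter (· ≠ 0) ×ˢ (Finset.Icc (-(h₂ : ℤ)) h₂).filter (· ≠ 0) ×ˢ
          (Finset.Icc (-(h₃ : ℤ)) h₃).filter (· ≠ 0)).filter
        (fun y : ℤ × ℤ × ℤ =>
          lam * ((y.1 : ZMod q)) ^ r₁ * ((y.2.1 : ZMod q)) ^ r₂ *
            ((y.2.2 : ZMod q)) ^ r₃ = 1) := by
    ext y
    simp only [Finset.mem_filter, Finset.mem_product]
    tauto
  rw [hset]
  have hne : ∀ h : ℕ, h < q → ∀ y ∈ (Finset.Icc (-(h : ℤ)) h).filter (· ≠ 0), (y : ZMod q) ≠ 0 := by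
    intro h hh y hy
    rw [Finset.mem_filter, Finset.mem_Icc] at hy
    exact cmc_cast_ne q h hh y (abs_le.2 hy.1) hy.2
  have hcount := cmc_count q r₁ r₂ r₃ lam _ _ _ (hne h₁ l₁) (hne h₂ l₂) (hne h₃ l₃)
  set J : ℝ := (((((Finset.Icc (-(h₁ : ℤ)) h₁).filter (· ≠ 0) ×ˢ
        (Finset.Icc (-(h₂ : ℤ)) h₂).filter (· ≠ 0) ×ˢ
          (Finset.Icc (-(h₃ : ℤ)) h₃).filter (· ≠ 0)).filter
        (fun y : ℤ × ℤ × ℤ =>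
          lam * ((y.1 : ZMod q)) ^ r₁ * ((y.2.1 : ZMod q)) ^ r₂ *
            ((y.2.2 : ZMod q)) ^ r₃ = 1)).card : ℕ) : ℝ) with hJ
  set P : ℝ := (h₁ : ℝ) * h₂ * h₃ with hP
  have hP0 : 0 ≤ P := by positivity
  set I : ℤ → DirichletCharacter ℂ q → ℝ := fun r χ => if χ ^ r = 1 then 1 else 0 with hI
  have hI0 : ∀ r χ, 0 ≤ I r χ := fun r χ => by simp only [hI]; split_ifs <;> norm_num
  have hIsum : ∀ r : ℤ, r ≠ 0 → ∑ χ : DirichletCharacter ℂ q, I r χ ≤ r.natAbs := by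
    intro r hr
    simp only [hI]
    rw [Finset.sum_boole]
    exact_mod_cast cmc_kernel q r hr
  have hsqrt : Real.sqrt P = Real.sqrt h₁ * Real.sqrt h₂ * Real.sqrt h₃ := by
    rw [hP, Real.sqrt_mul (by positivity), Real.sqrt_mul (by positivity)]
  have hpt : ∀ χ : DirichletCharacter ℂ q,
      ‖∑ y ∈ (Finset.Icc (-(h₁ : ℤ)) h₁).filter (· ≠ 0), (χ ^ r₁) (y : ZMod q)‖ *
      ‖∑ y ∈ (Finset.Icc (-(h₂ : ℤ)) h₂).filter (· ≠ 0), (χ ^ r₂) (y : ZMod q)‖ *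
      ‖∑ y ∈ (Finset.Icc (-(h₃ : ℤ)) h₃).filter (· ≠ 0), (χ ^ r₃) (y : ZMod q)‖ ≤
      8 * (P * (I r₁ χ + I r₂ χ + I r₃ χ) + Real.sqrt P *
        (cmcG q h₁ (χ ^ r₁) ^ 3 + cmcG q h₂ (χ ^ r₂) ^ 3 + cmcG q h₃ (χ ^ r₃) ^ 3)) := by
    intro χ
    have hb : ‖cmcS q h₁ (χ ^ r₁)‖ * ‖cmcS q h₂ (χ ^ r₂)‖ * ‖cmcS q h₃ (χ ^ r₃)‖ ≤
        P * (I r₁ χ + I r₂ χ + I r₃ χ) + Real.sqrt P *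
        (cmcG q h₁ (χ ^ r₁) ^ 3 + cmcG q h₂ (χ ^ r₂) ^ 3 + cmcG q h₃ (χ ^ r₃) ^ 3) := by
      have g1 := cmcG_nonneg q h₁ (χ ^ r₁)
      have g2 := cmcG_nonneg q h₂ (χ ^ r₂)
      have g3 := cmcG_nonneg q h₃ (χ ^ r₃)
      by_cases hbad : χ ^ r₁ = 1 ∨ χ ^ r₂ = 1 ∨ χ ^ r₃ = 1
      · have h1 : 1 ≤ I r₁ χ + I r₂ χ + I r₃ χ := by
          have i1 := hI0 r₁ χ
          have i2 := hI0 r₂ χ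
          have i3 := hI0 r₃ χ
          rcases hbad with h | h | h
          · have : I r₁ χ = 1 := if_pos h
            linarith
          · have : I r₂ χ = 1 := if_pos h
            linarith
          · have : I r₃ χ = 1 := if_pos h
            linarith
        have h2 : ‖cmcS q h₁ (χ ^ r₁)‖ * ‖cmcS q h₂ (χ ^ r₂)‖ * ‖cmcS q h₃ (χ ^ r₃)‖ ≤ P := by
          rw [hP]
          gcongr <;> exact cmcS_le _ _ _
        have h3 : 0 ≤ Real.sqrt P *
          (cmcG q h₁ (χ ^ r₁) ^ 3 + cmcG q h₂ (χ ^ r₂) ^ 3 + cmcG q h₃ (χ ^ r₃) ^ 3) := by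
          positivity
        nlinarith
      · push Not at hbad
        have hG : ∀ (h : ℕ) (ψ : DirichletCharacter ℂ q), 0 < h → ψ ≠ 1 →
            ‖cmcS q h ψ‖ = Real.sqrt h * cmcG q h ψ := by
          intro h ψ hh hψ
          have : Real.sqrt h ≠ 0 := by
            have : (0:ℝ) < h := by exact_mod_cast hh
            positivity
          unfold cmcG
          rw [if_neg hψ]; field_simp
        rw [hG _ _ p₁ hbad.1, hG _ _ p₂ hbad.2.1, hG _ _ p₃ hbad.2.2]
        have h3 : ∀ x y z : ℝ, 0 ≤ x → 0 ≤ y → 0 ≤ z → x * y * z ≤ x ^ 3 + y ^ 3 + z ^ 3 := by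
          intro x y z hx hy hz
          nlinarith [mul_nonneg (add_nonneg (add_nonneg hx hy) hz) (add_nonneg (add_nonneg
            (sq_nonneg (x - y)) (sq_nonneg (y - z))) (sq_nonneg (x - z))),
            mul_nonneg (mul_nonneg hx hy) hz]
        have h4 := mul_le_mul_of_nonneg_left (h3 _ _ _ g1 g2 g3) (Real.sqrt_nonneg P)
        have h5 : 0 ≤ P * (I r₁ χ + I r₂ χ + I r₃ χ) :=
          mul_nonneg hP0 (add_nonneg (add_nonneg (hI0 _ _) (hI0 _ _)) (hI0 _ _))
        refine le_trans (le_of_eq ?_) (h4.trans (le_add_of_nonneg_left h5))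
        rw [hsqrt]; ring
    calc _ ≤ (2 * ‖cmcS q h₁ (χ ^ r₁)‖) * (2 * ‖cmcS q h₂ (χ ^ r₂)‖) *
          (2 * ‖cmcS q h₃ (χ ^ r₃)‖) := by
          gcongr <;> exact cmcT_le _ _ _
      _ = 8 * (‖cmcS q h₁ (χ ^ r₁)‖ * ‖cmcS q h₂ (χ ^ r₂)‖ * ‖cmcS q h₃ (χ ^ r₃)‖) := by ring
      _ ≤ _ := by gcongr
  have hthird : ∀ (r : ℤ) (h : ℕ), r ≠ 0 → 0 < h → h < q →
      ∑ χ : DirichletCharacter ℂ q, cmcG q h (χ ^ r) ^ 3 ≤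
        r.natAbs * ((q - 1) * (1464 * Real.log q)) := by
    intro r h hr hp hl
    refine (cmc_sum_pow q r hr (fun χ => cmcG q h χ ^ 3)
      (fun χ => pow_nonneg (cmcG_nonneg q h χ) 3)).trans ?_
    refine mul_le_mul_of_nonneg_left ((cmc_third q h hp hl).trans ?_) (by positivity)
    refine mul_le_mul_of_nonneg_left ?_ hq1.le
    linarith
  have hRR : (r₁.natAbs : ℝ) + r₂.natAbs + r₃.natAbs ≤ R := by exact_mod_cast hR
  have htotal : J * (q - 1) ≤ 8 * (P * R + Real.sqrt P * (R * ((q - 1) * (1464 * Real.log q)))) := by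
    refine hcount.trans ((Finset.sum_le_sum fun χ _ => hpt χ).trans ?_)
    rw [← Finset.mul_sum, Finset.sum_add_distrib, ← Finset.mul_sum, ← Finset.mul_sum,
      Finset.sum_add_distrib, Finset.sum_add_distrib, Finset.sum_add_distrib,
      Finset.sum_add_distrib]
    have i1 := hIsum r₁ hr₁
    have i2 := hIsum r₂ hr₂
    have i3 := hIsum r₃ hr₃
    have t1 := hthird r₁ h₁ hr₁ p₁ l₁
    have t2 := hthird r₂ h₂ hr₂ p₂ l₂
    have t3 := hthird r₃ h₃ hr₃ p₃ l₃
    have hX : 0 ≤ (q - 1) * (1464 * Real.log q) := mul_nonneg hq1.le (by linarith)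
    have h6 := mul_le_mul_of_nonneg_right hRR hX
    have h7 : ∑ χ : DirichletCharacter ℂ q, I r₁ χ + ∑ χ : DirichletCharacter ℂ q, I r₂ χ +
      ∑ χ : DirichletCharacter ℂ q, I r₃ χ ≤ R := by linarith
    have h8 : ∑ χ : DirichletCharacter ℂ q, cmcG q h₁ (χ ^ r₁) ^ 3 +
      ∑ χ : DirichletCharacter ℂ q, cmcG q h₂ (χ ^ r₂) ^ 3 +
      ∑ χ : DirichletCharacter ℂ q, cmcG q h₃ (χ ^ r₃) ^ 3 ≤
        R * ((q - 1) * (1464 * Real.log q)) := by linarith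
    gcongr
  have hfin : J ≤ 8 * (P * R) / (q - 1) + 8 * (Real.sqrt P * (R * (1464 * Real.log q))) := by
    rw [← mul_le_mul_iff_left₀ hq1]
    refine htotal.trans (le_of_eq ?_)
    field_simp
  refine hfin.trans ?_
  have h9 : 8 * (P * R) / (q - 1) ≤ 16 * (P * R) / q := by
    rw [div_le_div_iff₀ hq1 hqR]
    have : 0 ≤ P * R := by positivity
    nlinarith
  have hL : 0 ≤ Real.sqrt P * Real.log q := mul_nonneg (Real.sqrt_nonneg _) (by linarith)
  have hPq : 0 ≤ P / q := by positivity
  have hR0 : (0:ℝ) ≤ R := by positivity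
  have h10 : 16 * (P * R) / q = 16 * R * (P / q) := by ring
  rw [h10] at h9
  nlinarith [mul_nonneg hR0 hL, mul_nonneg hR0 hPq]
end

section
/- For a fixed integer ν ≥ 1, the Dirichlet series ∑_{z≥1} τ(z^ν)/z^s factors as ζ(s)^{ν+1}·F₀(s), where F₀(s) = ∑ a_n/n^s is a Dirichlet series supported on squarefull integers; consequently the partial sums of its coefficients satisfy ∑_{n≤N} a_n ≪ N^{1/2}. -/
/-- `tauK k n` is the number of ways to write `n` as an ordered product of `k`
positive integers (the `k`-fold divisor function `τ_k`). -/
def tauK : ℕ → ℕ → ℕ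
  | 0, n => if n = 1 then 1 else 0
  | k + 1, n => ∑ d ∈ n.divisors, tauK k d

/-- `n` is squarefull if `p ∣ n → p² ∣ n` for all primes `p`. -/
def Squarefull (n : ℕ) : Prop := ∀ p : ℕ, p.Prime → p ∣ n → p ^ 2 ∣ n

section A1
open Complex

/-- Correction terms in the Euler–Maclaurin type formula for zeta. -/
noncomputable def emTerm (n : ℕ) (s : ℂ) : ℂ :=
  (s - 1) * ((n : ℂ) + 1) ^ (-s) - (n : ℂ) ^ (1 - s) + ((n : ℂ) + 1) ^ (1 - s)

lemma hasDerivAt_ofReal_cpow_aux (u : ℝ) (hu : 0 < u) (r : ℂ) :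
    HasDerivAt (fun y : ℝ => (y : ℂ) ^ r) (r * (u : ℂ) ^ (r - 1)) u := by
  have h1 : HasDerivAt (fun z : ℂ => z ^ r) (r * (u : ℂ) ^ (r - 1)) (u : ℂ) := by
    have := (hasDerivAt_id (u : ℂ)).cpow_const (c := r) (Or.inl (by simpa using hu))
    simpa using this
  exact h1.comp_ofReal

lemma norm_emTerm_le (n : ℕ) (hn : 1 ≤ n) (s : ℂ) (hs : 0 < s.re) :
    ‖emTerm n s‖ ≤ ‖s‖ * ‖s - 1‖ * (n : ℝ) ^ (-s.re - 1) := by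
  have hn0 : (0 : ℝ) < n := by exact_mod_cast hn
  set S : Set ℝ := Set.Icc (n : ℝ) (n + 1) with hS
  have hconv : Convex ℝ S := convex_Icc _ _
  have hpos : ∀ u ∈ S, 0 < u := fun u hu => hn0.trans_le hu.1
  have hmem1 : ((n : ℝ) + 1) ∈ S := ⟨by linarith, le_refl _⟩
  have hmem0 : (n : ℝ) ∈ S := ⟨le_refl _, by linarith⟩
  -- first estimate
  have h1 : ∀ u ∈ S, ‖(((n : ℝ) + 1 : ℝ) : ℂ) ^ (-s) - (u : ℂ) ^ (-s)‖
      ≤ ‖s‖ * (n : ℝ) ^ (-s.re - 1) := by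
    intro u hu
    have := hconv.norm_image_sub_le_of_norm_hasDerivWithin_le
      (f := fun y : ℝ => (y : ℂ) ^ (-s)) (f' := fun y : ℝ => (-s) * (y : ℂ) ^ (-s - 1))
      (C := ‖s‖ * (n : ℝ) ^ (-s.re - 1))
      (fun y hy => (hasDerivAt_ofReal_cpow_aux y (hpos y hy) (-s)).hasDerivWithinAt)
      (fun y hy => by
        rw [norm_mul, norm_neg, Complex.norm_cpow_eq_rpow_re_of_pos (hpos y hy)]
        gcongr
        simp only [sub_re, neg_re, one_re]
        exact Real.rpow_le_rpow_of_nonpos hn0 hy.1 (by linarith)) hu hmem1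
    refine this.trans ?_
    have h2 : ‖(n : ℝ) + 1 - u‖ ≤ 1 := by
      rw [Real.norm_eq_abs, abs_le]; constructor <;> linarith [hu.1, hu.2]
    have h3 : 0 ≤ ‖s‖ * (n : ℝ) ^ (-s.re - 1) := by positivity
    nlinarith
  have := hconv.norm_image_sub_le_of_norm_hasDerivWithin_le
      (f := fun y : ℝ => (y : ℂ) ^ (1 - s) + (y : ℂ) * ((s - 1) * (((n : ℝ) + 1 : ℝ) : ℂ) ^ (-s)))
      (f' := fun y : ℝ => (1 - s) * (y : ℂ) ^ (1 - s - 1)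
        + 1 * ((s - 1) * (((n : ℝ) + 1 : ℝ) : ℂ) ^ (-s)))
      (C := ‖s - 1‖ * (‖s‖ * (n : ℝ) ^ (-s.re - 1)))
      (fun y hy => ((hasDerivAt_ofReal_cpow_aux y (hpos y hy) (1 - s)).add
        ((Complex.ofRealCLM.hasDerivAt).mul_const _)).hasDerivWithinAt)
      (fun y hy => by
        have : (1 - s) * (y : ℂ) ^ (1 - s - 1)
          + 1 * ((s - 1) * (((n : ℝ) + 1 : ℝ) : ℂ) ^ (-s))
          = (s - 1) * ((((n : ℝ) + 1 : ℝ) : ℂ) ^ (-s) - (y : ℂ) ^ (-s)) := by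
          rw [show (1 - s - 1) = -s by ring]; ring
        rw [this, norm_mul]
        gcongr
        exact h1 y hy) hmem0 hmem1
  have e : emTerm n s = ((((n : ℝ) + 1 : ℝ) : ℂ) ^ (1 - s)
        + (((n : ℝ) + 1 : ℝ) : ℂ) * ((s - 1) * (((n : ℝ) + 1 : ℝ) : ℂ) ^ (-s)))
      - (((n : ℝ) : ℂ) ^ (1 - s) + ((n : ℝ) : ℂ) * ((s - 1) * (((n : ℝ) + 1 : ℝ) : ℂ) ^ (-s))) := by
    simp only [emTerm]; push_cast; ring
  rw [e]
  refine this.trans (le_of_eq ?_)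
  simp; ring

lemma differentiable_emTerm (n : ℕ) (hn : 1 ≤ n) : Differentiable ℂ (emTerm n) := by
  have h0 : (n : ℂ) ≠ 0 := by exact_mod_cast (by omega : n ≠ 0)
  have h1 : (n : ℂ) + 1 ≠ 0 := by exact_mod_cast (by omega : n + 1 ≠ 0)
  intro s
  unfold emTerm
  have d1 : DifferentiableAt ℂ (fun s : ℂ => ((n : ℂ) + 1) ^ (-s)) s :=
    (differentiableAt_id.neg).const_cpow (Or.inl h1)
  have d2 : DifferentiableAt ℂ (fun s : ℂ => (n : ℂ) ^ (1 - s)) s :=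
    ((differentiableAt_const _).sub differentiableAt_id).const_cpow (Or.inl h0)
  have d3 : DifferentiableAt ℂ (fun s : ℂ => ((n : ℂ) + 1) ^ (1 - s)) s :=
    ((differentiableAt_const _).sub differentiableAt_id).const_cpow (Or.inl h1)
  exact (((differentiableAt_id.sub (differentiableAt_const _)).mul d1).sub d2).add d3

lemma sum_emTerm (N : ℕ) (s : ℂ) :
    ∑ n ∈ Finset.range N, emTerm (n + 1) s =
      (s - 1) * (∑ n ∈ Finset.range (N + 1), ((n : ℂ) + 1) ^ (-s) - 1) - 1
        + ((N : ℂ) + 1) ^ (1 - s) := by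
  induction N with
  | zero => simp
  | succ k ih =>
    rw [Finset.sum_range_succ, ih, Finset.sum_range_succ (n := k + 1)]
    simp only [emTerm]; push_cast; ring

lemma summable_aux {a : ℝ} (ha : a < -1) : Summable (fun n : ℕ => ((n + 1 : ℕ) : ℝ) ^ a) :=
  (summable_nat_add_iff 1).2 (Real.summable_nat_rpow.2 ha)

lemma summable_emTerm {s : ℂ} (hs : 0 < s.re) : Summable (fun n : ℕ => emTerm (n + 1) s) := by
  refine Summable.of_norm_bounded
    ((summable_aux (a := -s.re - 1) (by linarith)).mul_left (‖s‖ * ‖s - 1‖)) fun n => ?_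
  exact norm_emTerm_le (n + 1) (by omega) s hs

lemma zeta1_eq_of_one_lt {s : ℂ} (hs : 1 < s.re) :
    riemannZeta₁ s = s + ∑' n : ℕ, emTerm (n + 1) s := by
  have hs1 : s ≠ 1 := by rintro rfl; simp at hs
  have hz : riemannZeta₁ s = (s - 1) * riemannZeta s := by
    rw [riemannZeta_eq_inv_sub_mul hs1]
    field_simp [sub_ne_zero.2 hs1]
  have hsum := (summable_emTerm (s := s) (by linarith)).hasSum.tendsto_sum_nat
  have hzs : HasSum (fun n : ℕ => ((n : ℂ) + 1) ^ (-s)) (riemannZeta s) := by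
    rw [zeta_eq_tsum_one_div_nat_add_one_cpow hs]
    have : Summable (fun n : ℕ => 1 / ((n : ℂ) + 1) ^ s) := by
      have := (summable_nat_add_iff 1).2 (Complex.summable_one_div_nat_cpow.2 hs)
      simpa using this
    convert this.hasSum using 2 with n
    rw [Complex.cpow_neg, one_div]
  have h2 : Filter.Tendsto (fun N : ℕ => ((N : ℂ) + 1) ^ (1 - s)) Filter.atTop (nhds 0) := by
    rw [tendsto_zero_iff_norm_tendsto_zero]
    have h3 : Filter.Tendsto (fun N : ℕ => ((N + 1 : ℕ) : ℝ) ^ (-(s.re - 1))) Filter.atTop (nhds 0) :=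
      (tendsto_rpow_neg_atTop (by linarith)).comp
        (tendsto_natCast_atTop_atTop.comp (Filter.tendsto_add_atTop_nat 1))
    refine h3.congr fun N => ?_
    have := Complex.norm_cpow_eq_rpow_re_of_pos (x := ((N + 1 : ℕ) : ℝ)) (by positivity) (1 - s)
    push_cast at this ⊢
    rw [this]; simp
  have h3 := (((hzs.tendsto_sum_nat.comp (Filter.tendsto_add_atTop_nat 1)).sub_const 1).const_mul
    (s - 1)).sub_const 1 |>.add h2
  have := tendsto_nhds_unique hsum (h3.congr fun N => by rw [sum_emTerm]; simp)
  rw [this, hz]; ring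

lemma zeta1_eq {s : ℂ} (hs : 1 / 2 < s.re) :
    riemannZeta₁ s = s + ∑' n : ℕ, emTerm (n + 1) s := by
  set R : ℝ := ‖s‖ + 3 with hR
  have hR0 : 0 ≤ R := by positivity
  set U : Set ℂ := {z | 1 / 2 < z.re} ∩ Metric.ball 0 R with hU
  have hUo : IsOpen U := (isOpen_lt continuous_const Complex.continuous_re).inter Metric.isOpen_ball
  have hUc : Convex ℝ U := (convex_halfSpace_re_gt _).inter (convex_ball _ _)
  have hd : DifferentiableOn ℂ (fun w : ℂ => ∑' n : ℕ, emTerm (n + 1) w) U := by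
    refine differentiableOn_tsum_of_summable_norm
      ((summable_aux (a := -(3 / 2)) (by norm_num)).mul_left (R * (R + 1)))
      (fun n => (differentiable_emTerm (n + 1) (by omega)).differentiableOn) hUo ?_
    rintro n w ⟨hw1, hw2⟩
    have hw1 : 1 / 2 < w.re := hw1
    have hw3 : ‖w‖ < R := by simpa using hw2
    refine (norm_emTerm_le (n + 1) (by omega) w (by linarith)).trans ?_
    have : ‖w - 1‖ ≤ R + 1 := (norm_sub_le _ _).trans (by simp; linarith)
    gcongr
    · push_cast; linarith [(Nat.cast_nonneg n : (0 : ℝ) ≤ n)]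
    · linarith
  have h1 : AnalyticOnNhd ℂ (fun w : ℂ => w + ∑' n : ℕ, emTerm (n + 1) w) U :=
    (differentiableOn_id.add hd).analyticOnNhd hUo
  have h2 : AnalyticOnNhd ℂ riemannZeta₁ U :=
    (differentiable_riemannZeta₁.differentiableOn).analyticOnNhd hUo
  have h2U : (2 : ℂ) ∈ U := by
    refine ⟨by simp; norm_num, ?_⟩
    simp [hR]; linarith [norm_nonneg s]
  have hev : riemannZeta₁ =ᶠ[nhds 2] (fun w : ℂ => w + ∑' n : ℕ, emTerm (n + 1) w) := by
    have : {z : ℂ | 1 < z.re} ∈ nhds (2 : ℂ) :=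
      (isOpen_lt continuous_const Complex.continuous_re).mem_nhds (by simp)
    filter_upwards [this] with z hz using zeta1_eq_of_one_lt hz
  exact h2.eqOn_of_preconnected_of_eventuallyEq h1 hUc.isPreconnected h2U hev
    ⟨hs, by simp [hR]⟩

lemma zeta1_eq_nat {s : ℂ} (hs : 1 / 2 < s.re) (N : ℕ) :
    riemannZeta₁ s = (s - 1) * (∑ n ∈ Finset.range (N + 1), ((n : ℂ) + 1) ^ (-s))
        + ((N : ℂ) + 1) ^ (1 - s) + ∑' n : ℕ, emTerm (n + N + 1) s := by
  rw [zeta1_eq hs, ← (summable_emTerm (s := s) (by linarith)).sum_add_tsum_nat_add N, sum_emTerm]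
  ring

/-- Upper bound for `(s-1)ζ(s)` near the line `Re s = 1`. -/
lemma zeta1_upper {δ : ℝ} (hδ : 0 < δ) (hδ2 : δ < 1 / 2) :
    ∃ C : ℝ, 0 < C ∧ ∀ s : ℂ, 1 - δ ≤ s.re → s.re ≤ 4 →
      ‖riemannZeta₁ s‖ ≤ C * (3 + |s.im|) ^ (1 + 2 * δ) := by
  set K : ℝ := ∑' n : ℕ, ((n + 1 : ℕ) : ℝ) ^ (-1 - δ) with hK
  have hKs : Summable (fun n : ℕ => ((n + 1 : ℕ) : ℝ) ^ (-1 - δ)) := summable_aux (by linarith)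
  have hK0 : 0 ≤ K := tsum_nonneg fun n => by positivity
  refine ⟨2 * K + 1 + 8 * K, by positivity, fun s hs1 hs2 => ?_⟩
  set X : ℝ := 3 + |s.im| with hX
  have hX3 : 3 ≤ X := by have := abs_nonneg s.im; linarith
  have hX0 : 0 < X := by linarith
  have hsn : ‖s‖ ≤ 2 * X := by
    refine (Complex.norm_le_abs_re_add_abs_im s).trans ?_
    have : |s.re| ≤ 4 := abs_le.2 ⟨by linarith, hs2⟩
    linarith [abs_nonneg s.im]
  have hsn1 : ‖s - 1‖ ≤ 2 * X := by
    refine (Complex.norm_le_abs_re_add_abs_im _).trans ?_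
    have : |(s - 1).re| ≤ 4 := abs_le.2 ⟨by simp; linarith, by simp; linarith⟩
    have h2 : (s - 1).im = s.im := by simp
    rw [h2]
    linarith [abs_nonneg s.im]
  set N : ℕ := ⌊X⌋₊ - 1 with hN
  have hfl : 3 ≤ ⌊X⌋₊ := Nat.le_floor (by exact_mod_cast hX3)
  have hN1 : ((N : ℝ) + 1) = (⌊X⌋₊ : ℝ) := by
    rw [hN]; push_cast [Nat.cast_sub (show 1 ≤ ⌊X⌋₊ by omega)]; ring
  have hNX : (N : ℝ) + 1 ≤ X := by rw [hN1]; exact Nat.floor_le hX0.le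
  have hXN : X / 2 ≤ (N : ℝ) + 1 := by
    rw [hN1]; have := Nat.lt_floor_add_one X; linarith
  rw [zeta1_eq_nat (by linarith) N]
  have b1 : ‖∑ n ∈ Finset.range (N + 1), ((n : ℂ) + 1) ^ (-s)‖ ≤ X ^ (2 * δ) * K := by
    refine (norm_sum_le _ _).trans ?_
    refine le_trans ?_ (mul_le_mul_of_nonneg_left
      (hKs.sum_le_tsum (Finset.range (N + 1)) (fun n _ => by positivity)) (by positivity))
    rw [Finset.mul_sum]
    refine Finset.sum_le_sum fun n hn => ?_
    have hn' : n ≤ N := by simpa [Nat.lt_succ_iff] using hn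
    have := Complex.norm_cpow_eq_rpow_re_of_pos (x := ((n + 1 : ℕ) : ℝ)) (by positivity) (-s)
    push_cast at this ⊢
    rw [this]
    have hn1 : (1 : ℝ) ≤ (n : ℝ) + 1 := by linarith [(Nat.cast_nonneg n : (0 : ℝ) ≤ n)]
    calc ((n : ℝ) + 1) ^ (-s).re ≤ ((n : ℝ) + 1) ^ (2 * δ + (-1 - δ)) :=
          Real.rpow_le_rpow_of_exponent_le hn1 (by simp; linarith)
      _ = ((n : ℝ) + 1) ^ (2 * δ) * ((n : ℝ) + 1) ^ (-1 - δ) := Real.rpow_add (by linarith) _ _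
      _ ≤ _ := by
        gcongr
        have : (n : ℝ) ≤ N := by exact_mod_cast hn'
        linarith
  have b2 : ‖((N : ℂ) + 1) ^ (1 - s)‖ ≤ X ^ (2 * δ) := by
    have := Complex.norm_cpow_eq_rpow_re_of_pos (x := ((N + 1 : ℕ) : ℝ)) (by positivity) (1 - s)
    push_cast at this ⊢
    rw [this]
    have hn1 : (1 : ℝ) ≤ (N : ℝ) + 1 := by linarith [(Nat.cast_nonneg N : (0 : ℝ) ≤ N)]
    calc ((N : ℝ) + 1) ^ (1 - s).re ≤ ((N : ℝ) + 1) ^ (2 * δ) :=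
          Real.rpow_le_rpow_of_exponent_le hn1 (by simp; linarith)
      _ ≤ _ := by gcongr
  have b3 : ‖∑' n : ℕ, emTerm (n + N + 1) s‖ ≤ 4 * X ^ 2 * (2 * X ^ (-1 + 2 * δ)) * K := by
    have hsK := (summable_nat_add_iff N).2 hKs
    have hb : ∀ n : ℕ, ‖emTerm (n + N + 1) s‖
        ≤ 4 * X ^ 2 * (2 * X ^ (-1 + 2 * δ)) * ((n + N + 1 : ℕ) : ℝ) ^ (-1 - δ) := by
      intro n
      refine (norm_emTerm_le (n + N + 1) (by omega) s (by linarith)).trans ?_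
      have hm1 : (1 : ℝ) ≤ ((n + N + 1 : ℕ) : ℝ) := by exact_mod_cast (by omega : 1 ≤ n + N + 1)
      have hmN : X / 2 ≤ ((n + N + 1 : ℕ) : ℝ) := by
        push_cast; linarith [(Nat.cast_nonneg n : (0 : ℝ) ≤ n)]
      have e1 : ((n + N + 1 : ℕ) : ℝ) ^ (-s.re - 1)
          ≤ (2 * X ^ (-1 + 2 * δ)) * ((n + N + 1 : ℕ) : ℝ) ^ (-1 - δ) := by
        calc ((n + N + 1 : ℕ) : ℝ) ^ (-s.re - 1)
            ≤ ((n + N + 1 : ℕ) : ℝ) ^ ((-1 + 2 * δ) + (-1 - δ)) :=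
              Real.rpow_le_rpow_of_exponent_le hm1 (by linarith)
          _ = ((n + N + 1 : ℕ) : ℝ) ^ (-1 + 2 * δ) * ((n + N + 1 : ℕ) : ℝ) ^ (-1 - δ) :=
              Real.rpow_add (by linarith) _ _
          _ ≤ _ := by
            gcongr
            calc ((n + N + 1 : ℕ) : ℝ) ^ (-1 + 2 * δ) ≤ (X / 2) ^ (-1 + 2 * δ) :=
                  Real.rpow_le_rpow_of_nonpos (by linarith) hmN (by linarith)
              _ = X ^ (-1 + 2 * δ) * ((2 : ℝ) ^ (-1 + 2 * δ))⁻¹ := by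
                  rw [Real.div_rpow hX0.le (by norm_num)]; rfl
              _ = X ^ (-1 + 2 * δ) * (2 : ℝ) ^ (-(-1 + 2 * δ)) := by
                  rw [Real.rpow_neg (by norm_num)]
              _ ≤ X ^ (-1 + 2 * δ) * (2 : ℝ) ^ (1 : ℝ) := by
                  gcongr
                  · norm_num
                  · linarith
              _ = _ := by rw [Real.rpow_one]; ring
      calc ‖s‖ * ‖s - 1‖ * ((n + N + 1 : ℕ) : ℝ) ^ (-s.re - 1)
          ≤ (2 * X) * (2 * X) * ((2 * X ^ (-1 + 2 * δ)) * ((n + N + 1 : ℕ) : ℝ) ^ (-1 - δ)) := by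
            gcongr
        _ = _ := by ring
    refine (tsum_of_norm_bounded (hsK.mul_left _).hasSum hb).trans ?_
    rw [tsum_mul_left]
    gcongr
    have := hKs.sum_add_tsum_nat_add N
    rw [hK, ← this]
    have : 0 ≤ ∑ i ∈ Finset.range N, ((i + 1 : ℕ) : ℝ) ^ (-1 - δ) :=
      Finset.sum_nonneg fun n _ => by positivity
    linarith
  have eX : X ^ (1 + 2 * δ) = X * X ^ (2 * δ) := by rw [Real.rpow_add hX0, Real.rpow_one]
  have eX2 : X ^ 2 * X ^ (-1 + 2 * δ) = X * X ^ (2 * δ) := by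
    rw [← eX, ← Real.rpow_natCast X 2, ← Real.rpow_add hX0]; congr 1; push_cast; ring
  have hq : 0 < X ^ (2 * δ) := by positivity
  calc _ ≤ ‖s - 1‖ * ‖∑ n ∈ Finset.range (N + 1), ((n : ℂ) + 1) ^ (-s)‖
        + ‖((N : ℂ) + 1) ^ (1 - s)‖ + ‖∑' n : ℕ, emTerm (n + N + 1) s‖ := by
        refine (norm_add_le _ _).trans ?_
        gcongr
        refine (norm_add_le _ _).trans ?_
        rw [norm_mul]
    _ ≤ (2 * X) * (X ^ (2 * δ) * K) + X ^ (2 * δ) + 4 * X ^ 2 * (2 * X ^ (-1 + 2 * δ)) * K := by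
        gcongr
    _ = (2 * K + 8 * K) * (X * X ^ (2 * δ)) + X ^ (2 * δ) := by
        rw [← eX2]
        linear_combination (2 * K) * (-eX2)
    _ ≤ _ := by
        rw [eX]
        nlinarith

end A1

section A2
open Complex

lemma zeta1_eq_mul {s : ℂ} (hs1 : s ≠ 1) : riemannZeta₁ s = (s - 1) * riemannZeta s := by
  rw [riemannZeta_eq_inv_sub_mul hs1]
  field_simp [sub_ne_zero.2 hs1]

lemma zeta1_deriv {δ : ℝ} (hδ : 0 < δ) (hδ2 : δ < 1 / 2) :
    ∃ C : ℝ, 0 < C ∧ ∀ s : ℂ, 1 - δ / 2 ≤ s.re → s.re ≤ 7 / 2 →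
      ‖deriv riemannZeta₁ s‖ ≤ C * (3 + |s.im|) ^ (1 + 2 * δ) := by
  obtain ⟨C, hC, h⟩ := zeta1_upper hδ hδ2
  refine ⟨C * 2 ^ (1 + 2 * δ) / (δ / 2), by positivity, fun s h1 h2 => ?_⟩
  have hX : 3 ≤ 3 + |s.im| := by linarith [abs_nonneg s.im]
  have := Complex.norm_deriv_le_of_forall_mem_sphere_norm_le (f := riemannZeta₁) (c := s)
    (R := δ / 2) (C := C * 2 ^ (1 + 2 * δ) * (3 + |s.im|) ^ (1 + 2 * δ)) (by positivity)
    differentiable_riemannZeta₁.diffContOnCl (fun z hz => by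
      have hz' : ‖z - s‖ = δ / 2 := by simpa [dist_eq_norm] using hz
      have hre : |(z - s).re| ≤ δ / 2 := hz' ▸ Complex.abs_re_le_norm _
      have him : |(z - s).im| ≤ δ / 2 := hz' ▸ Complex.abs_im_le_norm _
      rw [abs_le] at hre
      simp only [sub_re] at hre
      refine (h z (by linarith) (by linarith)).trans ?_
      rw [mul_assoc, ← Real.mul_rpow (by norm_num) (by linarith)]
      gcongr
      have : |z.im| ≤ |s.im| + |(z - s).im| := by
        have := abs_add_le s.im (z - s).im
        simpa using this
      linarith)
  refine this.trans (le_of_eq ?_)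
  ring

lemma zeta_341 {x : ℝ} (hx : 0 < x) (y : ℝ) :
    1 ≤ ‖riemannZeta (1 + x)‖ ^ 3 * ‖riemannZeta (1 + x + I * y)‖ ^ 4
      * ‖riemannZeta (1 + x + 2 * I * y)‖ := by
  have := DirichletCharacter.norm_LFunction_product_ge_one (N := 1) 1 hx y
  simp only [DirichletCharacter.LFunctionTrivChar, one_pow,
    DirichletCharacter.LFunction_modOne_eq, norm_mul, norm_pow] at this
  exact this

/-- Lower bound for `(s-1)ζ(s)` near the line `Re s = 1`. -/
lemma zeta1_lower {ε : ℝ} (hε : 0 < ε) (hε1 : ε < 1) :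
    ∃ c : ℝ, 0 < c ∧ c ≤ 1 / 4 ∧ ∀ s : ℂ, 1 ≤ |s.im| → 1 - c * (3 + |s.im|) ^ (-ε) ≤ s.re →
      s.re ≤ 3 → c * (3 + |s.im|) ^ (1 - ε) ≤ ‖riemannZeta₁ s‖ := by
  set δ : ℝ := ε / 20 with hδ
  have hδ0 : 0 < δ := by positivity
  have hδ2 : δ < 1 / 2 := by linarith
  obtain ⟨C₁, hC₁, hup⟩ := zeta1_upper hδ0 hδ2
  obtain ⟨C₂, hC₂, hder⟩ := zeta1_deriv hδ0 hδ2
  -- the bound on the real axis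
  set K : ℝ := C₁ * 3 ^ (1 + 2 * δ) with hK
  have hK0 : 0 < K := by positivity
  -- lower bound in the form of fourth powers
  set c₀ : ℝ := 1 / (K ^ 3 * 4 ^ 4 * (16 * C₁) + 1) with hc₀
  have hD0 : 0 < K ^ 3 * 4 ^ 4 * (16 * C₁) := by positivity
  have hc₀0 : 0 < c₀ := by positivity
  have hc₀1 : c₀ ≤ 1 := by
    rw [hc₀, div_le_one (by positivity)]; linarith
  have key : ∀ s : ℂ, 1 ≤ |s.im| → ∀ q : ℝ, 1 ≤ q → q ^ 4 = (3 + |s.im|) ^ (2 * δ) →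
      ∀ y : ℝ, 0 < y → 1 + y ^ 4 ≤ s.re → s.re ≤ 3 →
      c₀ * (3 + |s.im|) * y ^ 3 / q ≤ ‖riemannZeta₁ s‖ := by
    intro s ht q hq hqX y hy hsy hs3
    set X : ℝ := 3 + |s.im| with hX
    set x : ℝ := s.re - 1 with hx
    have hx0 : 0 < x := by have : 0 < y ^ 4 := by positivity
                           linarith
    have hxy : y ^ 4 ≤ x := by linarith
    have hX4 : 4 ≤ X := by linarith
    have h341 := zeta_341 hx0 s.im
    have hs_eq : (1 + x + I * s.im : ℂ) = s := by
      apply Complex.ext <;> simp [hx]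
    rw [hs_eq] at h341
    have hs1 : s ≠ 1 := by rintro rfl; simp at ht; linarith
    -- factor 1
    have f1 : ‖riemannZeta (1 + x)‖ ≤ K / x := by
      have h1 : (1 + x : ℂ) ≠ 1 := by
        intro h; have := congrArg Complex.re h; simp at this; linarith
      have h2 := hup (1 + x) (by simp; linarith) (by simp; linarith)
      rw [zeta1_eq_mul h1, norm_mul] at h2
      have h3 : ‖(1 + x - 1 : ℂ)‖ = x := by simp [abs_of_pos hx0]
      rw [h3] at h2
      rw [le_div_iff₀ hx0, mul_comm]
      simpa [hK] using h2
    have f2 : ‖riemannZeta s‖ ≤ 4 * ‖riemannZeta₁ s‖ / X := by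
      rw [zeta1_eq_mul hs1, norm_mul, le_div_iff₀ (by linarith)]
      have : |s.im| ≤ ‖s - 1‖ := by simpa using Complex.abs_im_le_norm (s - 1)
      nlinarith [norm_nonneg (riemannZeta s)]
    have f3 : ‖riemannZeta (1 + x + 2 * I * s.im)‖ ≤ 16 * C₁ * q ^ 4 := by
      set w : ℂ := 1 + x + 2 * I * s.im with hw
      have hwre : w.re = s.re := by simp [hw, hx]
      have hwim : w.im = 2 * s.im := by simp [hw]
      have h1 : w ≠ 1 := by
        intro h; have := congrArg Complex.re h; rw [hwre] at this; simp at this; linarith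
      have h2 := hup w (by rw [hwre]; linarith) (by linarith)
      rw [zeta1_eq_mul h1, norm_mul, hwim] at h2
      have h3 : 2 * |s.im| ≤ ‖w - 1‖ := by
        have := Complex.abs_im_le_norm (w - 1)
        simpa [hwim, abs_mul] using this
      have h4 : (3 + |2 * s.im|) ^ (1 + 2 * δ) ≤ 4 * (X * q ^ 4) := by
        rw [abs_mul, abs_two]
        calc (3 + 2 * |s.im|) ^ (1 + 2 * δ) ≤ (2 * X) ^ (1 + 2 * δ) := by
              gcongr; linarith
          _ = 2 ^ (1 + 2 * δ) * X ^ (1 + 2 * δ) := by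
              rw [Real.mul_rpow (by norm_num) (by linarith)]
          _ ≤ 2 ^ (2 : ℝ) * X ^ (1 + 2 * δ) := by
              gcongr
              · norm_num
              · linarith
          _ = _ := by
              rw [Real.rpow_add (by linarith : 0 < X), Real.rpow_one, hqX]; norm_num
      have h5 : X / 2 * ‖riemannZeta w‖ ≤ C₁ * (4 * (X * q ^ 4)) := by
        refine le_trans ?_ (h2.trans (by gcongr))
        gcongr
        linarith
      have hXp : 0 < X := by linarith
      have : X * ‖riemannZeta w‖ ≤ X * (8 * C₁ * q ^ 4) := by linarith
      have := le_of_mul_le_mul_left this hXp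
      have : 0 ≤ C₁ * q ^ 4 := by positivity
      linarith
    set Z : ℝ := ‖riemannZeta₁ s‖ with hZ
    have hZ0 : 0 ≤ Z := norm_nonneg _
    have hXp : 0 < X := by linarith
    have hall : 1 ≤ (K / x) ^ 3 * (4 * Z / X) ^ 4 * (16 * C₁ * q ^ 4) := by
      refine h341.trans ?_
      gcongr
    have hall2 : x ^ 3 * X ^ 4 ≤ (K ^ 3 * 4 ^ 4 * (16 * C₁)) * (Z * q) ^ 4 := by
      have e : (K / x) ^ 3 * (4 * Z / X) ^ 4 * (16 * C₁ * q ^ 4)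
        = ((K ^ 3 * 4 ^ 4 * (16 * C₁)) * (Z * q) ^ 4) / (x ^ 3 * X ^ 4) := by
        field_simp
      rw [e, le_div_iff₀ (by positivity)] at hall
      linarith
    have hfin : (c₀ * X * y ^ 3) ^ 4 ≤ (Z * q) ^ 4 := by
      have h1 : y ^ 12 ≤ x ^ 3 := by
        calc y ^ 12 = (y ^ 4) ^ 3 := by ring
          _ ≤ x ^ 3 := by gcongr
      have h2 : c₀ * (K ^ 3 * 4 ^ 4 * (16 * C₁)) ≤ 1 := by
        rw [hc₀, one_div, inv_mul_le_one₀ (by positivity)]; linarith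
      have h3 : c₀ ^ 4 ≤ c₀ := by
        calc c₀ ^ 4 ≤ c₀ ^ 1 := pow_le_pow_of_le_one hc₀0.le hc₀1 (by norm_num)
          _ = c₀ := pow_one _
      calc (c₀ * X * y ^ 3) ^ 4 = c₀ ^ 4 * (y ^ 12 * X ^ 4) := by ring
        _ ≤ c₀ * (x ^ 3 * X ^ 4) := by gcongr
        _ ≤ c₀ * ((K ^ 3 * 4 ^ 4 * (16 * C₁)) * (Z * q) ^ 4) := by gcongr
        _ = (c₀ * (K ^ 3 * 4 ^ 4 * (16 * C₁))) * (Z * q) ^ 4 := by ring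
        _ ≤ 1 * (Z * q) ^ 4 := by gcongr
        _ = _ := one_mul _
    rw [div_le_iff₀ (by linarith)]
    exact le_of_pow_le_pow_left₀ (by norm_num) (by positivity) hfin
  -- choose b
  set b : ℝ := min (1 / 2) (min (δ / 2) (c₀ / (4 * C₂))) with hb
  have hb0 : 0 < b := by positivity
  have hb1 : b ≤ 1 / 2 := min_le_left _ _
  have hb2 : b ≤ δ / 2 := (min_le_right _ _).trans (min_le_left _ _)
  have hb3 : b * (4 * C₂) ≤ c₀ := by
    rw [← le_div_iff₀ (by positivity)]
    exact (min_le_right _ _).trans (min_le_right _ _)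
  have hb41 : b ^ 4 ≤ b := by
    calc b ^ 4 ≤ b ^ 1 := pow_le_pow_of_le_one hb0.le (by linarith) (by norm_num)
      _ = b := pow_one _
  refine ⟨min (1 / 4) (min (b ^ 4) (c₀ * b ^ 3 / 2)), by positivity, min_le_left _ _, ?_⟩
  set c : ℝ := min (1 / 4) (min (b ^ 4) (c₀ * b ^ 3 / 2)) with hc
  have hcb : c ≤ b ^ 4 := (min_le_right _ _).trans (min_le_left _ _)
  have hcb2 : c ≤ c₀ * b ^ 3 / 2 := (min_le_right _ _).trans (min_le_right _ _)
  have hc0 : 0 < c := by positivity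
  intro s ht hs1 hs3
  set X : ℝ := 3 + |s.im| with hX
  have hX4 : 4 ≤ X := by linarith
  have hXp : 0 < X := by linarith
  set q : ℝ := X ^ (δ / 2) with hq
  have hq1 : 1 ≤ q := Real.one_le_rpow (by linarith) (by positivity)
  have hq0 : 0 < q := by linarith
  have hqpow : ∀ n : ℕ, q ^ n = X ^ (δ / 2 * n) := fun n => by
    rw [hq, ← Real.rpow_mul_natCast hXp.le]
  have hq4 : q ^ 4 = X ^ (2 * δ) := by rw [hqpow]; congr 1; push_cast; ring
  have hq40 : q ^ 40 = X ^ ε := by rw [hqpow]; congr 1; push_cast; rw [hδ]; ring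
  have hXe : X ^ (-ε) = 1 / q ^ 40 := by rw [Real.rpow_neg hXp.le, hq40, one_div]
  have hX1e : X ^ (1 - ε) = X / q ^ 40 := by rw [Real.rpow_sub hXp, Real.rpow_one, hq40]
  set y : ℝ := b / q ^ 5 with hy
  have hy0 : 0 < y := by positivity
  set x : ℝ := y ^ 4 with hx
  have hxe : x = b ^ 4 / q ^ 20 := by rw [hx, hy]; field_simp
  have hx0 : 0 < x := by positivity
  have hxb : x ≤ b := by
    rw [hxe]
    exact (div_le_self (by positivity) (one_le_pow₀ hq1)).trans hb41
  have hsx : 1 - x ≤ s.re := by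
    refine le_trans ?_ hs1
    rw [hXe, hxe]
    have : c * (1 / q ^ 40) ≤ b ^ 4 / q ^ 20 := by
      rw [mul_one_div]
      exact div_le_div₀ (by positivity) hcb (by positivity)
        (pow_le_pow_right₀ hq1 (by norm_num))
    linarith
  set s' : ℂ := ⟨max s.re (1 + x), s.im⟩ with hs'
  have hs're : s'.re = max s.re (1 + x) := rfl
  have hs'im : s'.im = s.im := rfl
  have hs'3 : s'.re ≤ 3 := by rw [hs're]; exact max_le hs3 (by linarith)
  have hlow := key s' (by rw [hs'im]; exact ht) q hq1 (by rw [hs'im, hq4]) y hy0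
    (by rw [hs're]; exact le_max_right _ _) hs'3
  rw [hs'im] at hlow
  change c₀ * X * y ^ 3 / q ≤ _ at hlow
  have hdist : ‖s' - s‖ ≤ 2 * x := by
    have : s' - s = ((max s.re (1 + x) - s.re : ℝ) : ℂ) := by
      apply Complex.ext <;> simp [hs']
    rw [this, Complex.norm_real, Real.norm_eq_abs, abs_le]
    constructor
    · linarith [le_max_left s.re (1 + x)]
    · have : max s.re (1 + x) ≤ s.re + 2 * x := max_le (by linarith) (by linarith)
      linarith
  have hconv : Convex ℝ (Set.Icc (1 - δ / 2) (7 / 2) ×ℂ {s.im}) :=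
    ((convex_Icc (1 - δ / 2) (7 / 2)).linear_preimage Complex.reLm).inter
      ((convex_singleton s.im).linear_preimage Complex.imLm)
  have hmv := hconv.norm_image_sub_le_of_norm_deriv_le (𝕜 := ℂ) (f := riemannZeta₁)
    (C := C₂ * X ^ (1 + 2 * δ)) (fun z _ => differentiable_riemannZeta₁ z)
    (fun z hz => by
      rw [Complex.mem_reProdIm] at hz
      obtain ⟨⟨h1, h2⟩, h3⟩ := hz
      have h3 : z.im = s.im := h3
      have := hder z h1 h2
      rwa [h3] at this)
    (x := s) (y := s') (by rw [Complex.mem_reProdIm]; exact ⟨⟨by linarith, by linarith⟩, rfl⟩)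
    (by rw [Complex.mem_reProdIm, hs're]
        exact ⟨⟨(by linarith : 1 - δ / 2 ≤ s.re).trans (le_max_left _ _), by rw [← hs're]; linarith⟩,
          rfl⟩)
  have hX12 : X ^ (1 + 2 * δ) = X * q ^ 4 := by rw [Real.rpow_add hXp, Real.rpow_one, hq4]
  have hdiff : ‖riemannZeta₁ s' - riemannZeta₁ s‖ ≤ c₀ * b ^ 3 / 2 * (X / q ^ 16) := by
    calc ‖riemannZeta₁ s' - riemannZeta₁ s‖ ≤ C₂ * X ^ (1 + 2 * δ) * (2 * x) := by
          refine hmv.trans ?_; gcongr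
      _ = (b * (4 * C₂)) * b ^ 3 / 2 * (X / q ^ 16) := by
          rw [hX12, hxe]; field_simp; norm_num
      _ ≤ _ := by gcongr
  have hlow2 : c₀ * b ^ 3 * (X / q ^ 16) ≤ ‖riemannZeta₁ s'‖ := by
    refine le_trans (le_of_eq ?_) hlow
    rw [hy]; field_simp
  have htri : ‖riemannZeta₁ s'‖ ≤ ‖riemannZeta₁ s' - riemannZeta₁ s‖ + ‖riemannZeta₁ s‖ := by
    simpa using norm_add_le (riemannZeta₁ s' - riemannZeta₁ s) (riemannZeta₁ s)
  have : c * X ^ (1 - ε) ≤ c₀ * b ^ 3 / 2 * (X / q ^ 16) := by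
    rw [hX1e]
    gcongr
    norm_num
  linarith

/-- `1/(s² ζ(s))`, extended over `s = 1`. -/
noncomputable def HH (s : ℂ) : ℂ := (s - 1) / (riemannZeta₁ s * s ^ 2)

lemma zeta1_ne_zero {s : ℂ} (hs : 1 ≤ s.re) : riemannZeta₁ s ≠ 0 := by
  by_cases h : s = 1
  · rw [h, riemannZeta₁_one]; exact one_ne_zero
  · rw [zeta1_eq_mul h]
    exact mul_ne_zero (sub_ne_zero.2 h) (riemannZeta_ne_zero_of_one_le_re hs)

def UU : Set ℂ := {s | riemannZeta₁ s * s ^ 2 ≠ 0}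

lemma isOpen_UU : IsOpen UU :=
  isOpen_ne_fun (differentiable_riemannZeta₁.continuous.mul (continuous_id.pow 2)) continuous_const

lemma mem_UU {s : ℂ} (hs : 1 ≤ s.re) : s ∈ UU := by
  refine mul_ne_zero (zeta1_ne_zero hs) (pow_ne_zero 2 ?_)
  rintro rfl; simp at hs; linarith

lemma differentiableOn_HH : DifferentiableOn ℂ HH UU := by
  intro s hs
  have : DifferentiableAt ℂ HH s := by
    unfold HH
    exact (differentiableAt_id.sub (differentiableAt_const _)).div
      ((differentiable_riemannZeta₁ s).mul (differentiableAt_id.pow 2)) hs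
  exact this.differentiableWithinAt

lemma HH_deriv_bound (k : ℕ) : ∃ C : ℝ, 0 < C ∧ ∀ s : ℂ, 1 ≤ s.re → s.re ≤ 2 →
    ‖iteratedDeriv k HH s‖ ≤ C * (1 + |s.im|) ^ (-(3 / 2) : ℝ) := by
  -- compact part
  have hcont : ContinuousOn (iteratedDeriv k HH) UU := by
    have := AnalyticOnNhd.iterated_deriv (differentiableOn_HH.analyticOnNhd isOpen_UU) k
    rw [iteratedDeriv_eq_iterate]
    exact this.continuousOn
  have hcpt : IsCompact (Set.Icc (1 : ℝ) 2 ×ℂ Set.Icc (-2 : ℝ) 2) :=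
    isCompact_Icc.reProdIm isCompact_Icc
  obtain ⟨M, hM⟩ := hcpt.exists_bound_of_continuousOn (f := iteratedDeriv k HH)
    (hcont.mono fun s hs => by
      rw [Complex.mem_reProdIm] at hs
      exact mem_UU hs.1.1)
  set ε : ℝ := 1 / (2 * (k + 1)) with hε
  have hε0 : 0 < ε := by positivity
  have hε1 : ε < 1 := by
    rw [hε, div_lt_one (by positivity)]
    have : (0 : ℝ) ≤ k := Nat.cast_nonneg k
    linarith
  obtain ⟨c, hc0, hc1, hlow⟩ := zeta1_lower hε0 hε1
  set D : ℝ := k.factorial * (2 * 16 / c) / (c / 2) ^ k with hD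
  have hD0 : 0 < D := by positivity
  refine ⟨(|M| + 1) * (3 : ℝ) ^ (3 / 2 : ℝ) + D, by positivity, fun s hs1 hs2 => ?_⟩
  have h1t : 0 < 1 + |s.im| := by positivity
  by_cases ht : |s.im| ≤ 2
  · have h1 := hM s (by rw [Complex.mem_reProdIm]; exact ⟨⟨hs1, hs2⟩, abs_le.1 ht⟩)
    have h2 : 1 ≤ (3 : ℝ) ^ (3 / 2 : ℝ) * (1 + |s.im|) ^ (-(3 / 2) : ℝ) := by
      rw [Real.rpow_neg h1t.le, ← div_eq_mul_inv, one_le_div (by positivity)]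
      gcongr
      linarith
    have h3 : 0 ≤ D * (1 + |s.im|) ^ (-(3 / 2) : ℝ) := by positivity
    calc ‖iteratedDeriv k HH s‖ ≤ (|M| + 1) * 1 := by linarith [le_abs_self M]
      _ ≤ (|M| + 1) * ((3 : ℝ) ^ (3 / 2 : ℝ) * (1 + |s.im|) ^ (-(3 / 2) : ℝ)) := by gcongr
      _ ≤ _ := by rw [add_mul]; linarith
  · push Not at ht
    set X : ℝ := 3 + |s.im| with hX
    have hXp : 0 < X := by linarith
    have hX5 : 5 ≤ X := by linarith
    set r : ℝ := c / 2 * X ^ (-ε) with hr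
    have hXe1 : X ^ (-ε) ≤ 1 := Real.rpow_le_one_of_one_le_of_nonpos (by linarith) (by linarith)
    have hXe0 : 0 < X ^ (-ε) := by positivity
    have hr0 : 0 < r := by positivity
    have hr1 : r ≤ 1 / 8 := by nlinarith
    have hball : ∀ z : ℂ, ‖z - s‖ ≤ r → c / 2 * X ^ (1 - ε) ≤ ‖riemannZeta₁ z‖ ∧
        X / 4 ≤ ‖z‖ ∧ ‖z - 1‖ ≤ X := by
      intro z hz
      have hre : |(z - s).re| ≤ r := (Complex.abs_re_le_norm _).trans hz
      have him : |(z - s).im| ≤ r := (Complex.abs_im_le_norm _).trans hz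
      rw [abs_le] at hre
      simp only [sub_re, sub_im] at hre him
      have him1 : |s.im| - r ≤ |z.im| := by
        have := abs_sub_abs_le_abs_sub s.im z.im
        rw [abs_sub_comm] at this; linarith
      have him2 : |z.im| ≤ |s.im| + r := by
        have := abs_sub_abs_le_abs_sub z.im s.im
        linarith
      have hX2 : X / 2 ≤ 3 + |z.im| := by linarith
      have hX3 : 3 + |z.im| ≤ 2 * X := by linarith
      refine ⟨?_, ?_, ?_⟩
      · refine le_trans ?_ (hlow z (by linarith) ?_ (by linarith))
        · have : X ^ (1 - ε) / 2 ≤ (3 + |z.im|) ^ (1 - ε) := by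
            calc X ^ (1 - ε) / 2 = X ^ (1 - ε) / 2 ^ (1 : ℝ) := by rw [Real.rpow_one]
              _ ≤ X ^ (1 - ε) / 2 ^ (1 - ε) := by
                gcongr
                · norm_num
                · linarith
              _ = (X / 2) ^ (1 - ε) := by rw [Real.div_rpow hXp.le (by norm_num)]
              _ ≤ _ := by gcongr
          nlinarith
        · have : X ^ (-ε) / 2 ≤ (3 + |z.im|) ^ (-ε) := by
            calc X ^ (-ε) / 2 = X ^ (-ε) * 2 ^ (-1 : ℝ) := by rw [Real.rpow_neg_one]; rfl
              _ ≤ X ^ (-ε) * 2 ^ (-ε) := by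
                gcongr
                · norm_num
              _ = (2 * X) ^ (-ε) := by rw [Real.mul_rpow (by norm_num) hXp.le]; ring
              _ ≤ _ := Real.rpow_le_rpow_of_nonpos (by positivity) hX3 (by linarith)
          nlinarith
      · have := Complex.abs_im_le_norm z
        linarith
      · have h1 := Complex.norm_le_abs_re_add_abs_im (z - 1)
        have h2 : |(z - 1).re| ≤ 2 := abs_le.2 ⟨by simp; linarith, by simp; linarith⟩
        have h3 : |(z - 1).im| = |z.im| := by simp
        linarith
    have hsub : ∀ z : ℂ, ‖z - s‖ ≤ r → z ∈ UU := by
      intro z hz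
      obtain ⟨h1, h2, -⟩ := hball z hz
      refine mul_ne_zero ?_ (pow_ne_zero 2 ?_)
      · rw [← norm_pos_iff]; exact lt_of_lt_of_le (by positivity) h1
      · rw [← norm_pos_iff]; exact lt_of_lt_of_le (by positivity) h2
    have hdc : DiffContOnCl ℂ HH (Metric.ball s r) := by
      apply DifferentiableOn.diffContOnCl
      apply differentiableOn_HH.mono
      intro z hz
      have := Metric.closure_ball_subset_closedBall hz
      exact hsub z (by simpa [dist_eq_norm] using this)
    have hcauchy := Complex.norm_iteratedDeriv_le_of_forall_mem_sphere_norm_le k hr0 hdc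
      (C := 2 * 16 / c * X ^ (-2 + ε)) (fun z hz => by
        have hz' : ‖z - s‖ ≤ r := by
          have : ‖z - s‖ = r := by simpa [dist_eq_norm] using hz
          exact this.le
        obtain ⟨h1, h2, h3⟩ := hball z hz'
        unfold HH
        rw [norm_div, norm_mul, norm_pow]
        calc ‖z - 1‖ / (‖riemannZeta₁ z‖ * ‖z‖ ^ 2)
            ≤ X / ((c / 2 * X ^ (1 - ε)) * (X / 4) ^ 2) := by gcongr
          _ = 2 * 16 / c * X ^ (-2 + ε) := by
            rw [show (-2 + ε) = 1 - (1 - ε) - 2 by ring, Real.rpow_sub hXp, Real.rpow_sub hXp,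
              Real.rpow_one, Real.rpow_ofNat]
            field_simp; norm_num; ring)
    have hfin : (k.factorial : ℝ) * (2 * 16 / c * X ^ (-2 + ε)) / r ^ k = D * X ^ (-(3 / 2) : ℝ) := by
      rw [hr, mul_pow, hD, ← Real.rpow_mul_natCast hXp.le]
      have : X ^ (-2 + ε) = X ^ (-(3 / 2) : ℝ) * X ^ (-ε * k) := by
        rw [← Real.rpow_add hXp]; congr 1; rw [hε]; field_simp; ring
      rw [this]
      field_simp
    rw [hfin] at hcauchy
    refine hcauchy.trans ?_
    have hle : X ^ (-(3 / 2) : ℝ) ≤ (1 + |s.im|) ^ (-(3 / 2) : ℝ) :=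
      Real.rpow_le_rpow_of_nonpos h1t (by linarith) (by norm_num)
    rw [add_mul]
    have : 0 ≤ (|M| + 1) * (3 : ℝ) ^ (3 / 2 : ℝ) * (1 + |s.im|) ^ (-(3 / 2) : ℝ) := by positivity
    have := mul_le_mul_of_nonneg_left hle hD0.le
    linarith

end A2

section A3
open Complex MeasureTheory Filter Topology

lemma base_norm (s : ℂ) (y : ℝ) : ‖((max y 0 : ℝ) : ℂ) * cexp (-s * y)‖ = max y 0 * Real.exp (-s.re * y) := by
  rw [norm_mul, Complex.norm_exp, Complex.norm_real, Real.norm_of_nonneg (le_max_right _ _)]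
  simp

lemma base_eq_ind (s : ℂ) : (fun y : ℝ => ((max y 0 : ℝ) : ℂ) * cexp (-s * y)) =
    (Set.Ioi (0:ℝ)).indicator (fun y : ℝ => (y : ℂ) * cexp (-s * y)) := by
  ext y
  by_cases h : 0 < y
  · rw [Set.indicator_of_mem (by simpa using h), max_eq_left h.le]
  · rw [Set.indicator_of_notMem (by simpa using h), max_eq_right (not_lt.1 h)]; simp

lemma base_intOn {s : ℂ} (hs : 0 < s.re) :
    IntegrableOn (fun y : ℝ => (y : ℂ) * cexp (-s * y)) (Set.Ioi 0) := by
  have h := integrableOn_rpow_mul_exp_neg_mul_rpow (p := 1) (s := 1) (b := s.re) (by norm_num) zero_lt_one hs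
  refine Integrable.mono' h ?_ ?_
  · apply Continuous.aestronglyMeasurable; fun_prop
  · refine (ae_restrict_iff' measurableSet_Ioi).2 (Eventually.of_forall fun y hy => ?_)
    have hy : 0 < y := hy
    have := base_norm s y
    rw [max_eq_left hy.le] at this
    rw [this]; simp

lemma base_int {s : ℂ} (hs : 0 < s.re) :
    Integrable (fun y : ℝ => ((max y 0 : ℝ) : ℂ) * cexp (-s * y)) := by
  rw [base_eq_ind]
  exact (integrable_indicator_iff measurableSet_Ioi).2 (base_intOn hs)

lemma base_val {s : ℂ} (hs : 0 < s.re) :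
    ∫ y : ℝ, ((max y 0 : ℝ) : ℂ) * cexp (-s * y) = 1 / s ^ 2 := by
  have hs0 : s ≠ 0 := by rintro rfl; simp at hs
  rw [base_eq_ind, integral_indicator measurableSet_Ioi]
  have := integral_Ioi_of_hasDerivAt_of_tendsto' (a := 0) (m := 0)
    (f := fun y : ℝ => -(((y : ℂ) / s + 1 / s ^ 2) * cexp (-s * y)))
    (f' := fun y : ℝ => (y : ℂ) * cexp (-s * y)) ?_ (base_intOn hs) ?_
  · rw [this]; simp
  · intro y _
    have h1 : HasDerivAt (fun y : ℝ => (y : ℂ)) 1 y := Complex.ofRealCLM.hasDerivAt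
    have h2 := (((h1.div_const s).add_const (1 / s ^ 2)).mul (h1.const_mul (-s)).cexp).neg
    refine h2.congr_deriv ?_
    field_simp; ring
  · rw [tendsto_zero_iff_norm_tendsto_zero]
    have t1 := tendsto_rpow_mul_exp_neg_mul_atTop_nhds_zero 1 s.re hs
    have t0 := tendsto_rpow_mul_exp_neg_mul_atTop_nhds_zero 0 s.re hs
    have t := (t1.mul_const (1 / ‖s‖)).add (t0.mul_const (1 / ‖s‖ ^ 2))
    simp only [zero_mul, add_zero] at t
    refine squeeze_zero' (Eventually.of_forall fun y => norm_nonneg _) ?_ t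
    filter_upwards [eventually_ge_atTop 0] with y hy
    rw [norm_neg, norm_mul, Complex.norm_exp]
    have : ‖(y : ℂ) / s + 1 / s ^ 2‖ ≤ y / ‖s‖ + 1 / ‖s‖ ^ 2 := by
      refine (norm_add_le _ _).trans (le_of_eq ?_)
      simp [abs_of_nonneg hy]
    have h3 : (-s * (y : ℂ)).re = -s.re * y := by simp
    rw [h3]
    refine (mul_le_mul_of_nonneg_right this (Real.exp_nonneg _)).trans (le_of_eq ?_)
    simp; ring

/-- smoothed summand -/
noncomputable def VV (v : ℝ) : ℝ := ∑' n : ℕ, (ArithmeticFunction.moebius n : ℝ) * max (v - Real.log n) 0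

lemma term_eq (s : ℂ) (n : ℕ) (v : ℝ) (hn : n ≠ 0):
    ((max (v - Real.log n) 0 : ℝ) : ℂ) * cexp (-s * v) =
    (n : ℂ) ^ (-s) * (((max (v - Real.log n) 0 : ℝ) : ℂ) * cexp (-s * ((v - Real.log n : ℝ) : ℂ))) := by
  have hn' : (n : ℂ) ≠ 0 := by exact_mod_cast hn
  rw [Complex.cpow_def_of_ne_zero hn', mul_left_comm, ← Complex.exp_add]
  congr 2
  rw [Complex.ofReal_sub, ← Complex.natCast_log]
  ring

noncomputable def FF (s : ℂ) (n : ℕ) (v : ℝ) : ℂ :=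
  ((ArithmeticFunction.moebius n : ℝ) : ℂ) * (((max (v - Real.log n) 0 : ℝ) : ℂ) * cexp (-s * v))

lemma FF_eq (s : ℂ) (n : ℕ) (v : ℝ) : FF s n v = ((ArithmeticFunction.moebius n : ℝ) : ℂ) * ((n : ℂ) ^ (-s) * (((max (v - Real.log n) 0 : ℝ) : ℂ) * cexp (-s * ((v - Real.log n : ℝ) : ℂ)))) := by
  rcases eq_or_ne n 0 with rfl | hn
  · simp [FF]
  · rw [FF, term_eq s n v hn]

lemma FF_int {s : ℂ} (hs : 0 < s.re) (n : ℕ) : Integrable (FF s n) := by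
  have : FF s n = _ := funext (FF_eq s n)
  rw [this]
  exact (((base_int hs).comp_sub_right (Real.log n)).const_mul _).const_mul _

lemma FF_val {s : ℂ} (hs : 0 < s.re) (n : ℕ) : ∫ v, FF s n v =
   ((ArithmeticFunction.moebius n : ℝ) : ℂ) * ((n : ℂ) ^ (-s)) * (1 / s ^ 2) := by
  simp_rw [FF_eq]
  rw [integral_const_mul, integral_const_mul, integral_sub_right_eq_self (fun y : ℝ => ((max y 0 : ℝ) : ℂ) * cexp (-s * (y:ℂ))), base_val hs]
  ring

lemma FF_norm {s : ℂ} (n : ℕ) (v : ℝ) : ‖FF s n v‖ ≤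
    (n : ℝ) ^ (-s.re) * (max (v - Real.log n) 0 * Real.exp (-s.re * (v - Real.log n))) := by
  rcases eq_or_ne n 0 with rfl | hn
  · simp [FF]; positivity
  have hμ : ‖((ArithmeticFunction.moebius n : ℝ) : ℂ)‖ ≤ 1 := by
    rw [Complex.norm_real, Real.norm_eq_abs]
    exact_mod_cast ArithmeticFunction.abs_moebius_le_one
  rw [FF_eq, norm_mul, norm_mul, base_norm, Complex.norm_natCast_cpow_of_pos (Nat.pos_of_ne_zero hn)]
  simp only [Complex.neg_re]
  exact mul_le_of_le_one_left (by positivity) hμ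

lemma FF_norm_int {s : ℂ} (hs : 0 < s.re) (n : ℕ) : ∫ v, ‖FF s n v‖ ≤ (n : ℝ) ^ (-s.re) * ∫ y : ℝ, ‖((max y 0 : ℝ) : ℂ) * cexp (-s * y)‖ := by
  rw [← integral_sub_right_eq_self (fun y : ℝ => ‖((max y 0 : ℝ) : ℂ) * cexp (-s * (y:ℂ))‖) (Real.log n), ← integral_const_mul]
  refine integral_mono (FF_int hs n).norm ((((base_int hs).comp_sub_right (Real.log n)).norm).const_mul _) fun v => ?_
  simp only [base_norm]
  exact FF_norm n v

lemma VV_eq (s : ℂ) (v : ℝ) : ∑' n, FF s n v = (VV v : ℂ) * cexp (-s * v) := by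
  rw [VV, Complex.ofReal_tsum, ← tsum_mul_right]
  congr 1; ext n; rw [FF]; push_cast; ring

lemma VV_laplace {s : ℂ} (hs : 1 < s.re) : ∫ v : ℝ, (VV v : ℂ) * cexp (-s * v) = HH s := by
  have hs0 : 0 < s.re := by linarith
  have hsum : Summable fun n : ℕ => ∫ v, ‖FF s n v‖ := by
    refine Summable.of_nonneg_of_le (fun n => integral_nonneg fun _ => norm_nonneg _) (FF_norm_int hs0) ?_
    exact (Real.summable_nat_rpow.2 (by linarith)).mul_right _
  have h := hasSum_integral_of_summable_integral_norm (FF_int hs0) hsum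
  simp_rw [VV_eq] at h
  rw [← h.tsum_eq]
  simp_rw [FF_val hs0]
  rw [tsum_mul_right]
  have h1 := ArithmeticFunction.LSeries_zeta_mul_Lseries_moebius hs
  rw [ArithmeticFunction.LSeries_zeta_eq_riemannZeta hs] at h1
  have hne : s ≠ 1 := by rintro rfl; simp at hs
  have h2 : ∑' n : ℕ, ((ArithmeticFunction.moebius n : ℝ) : ℂ) * ((n : ℂ) ^ (-s)) = LSeries (fun n => ((ArithmeticFunction.moebius n : ℤ) : ℂ)) s := by
    rw [LSeries]
    congr 1; ext n
    rw [LSeries.term_def]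
    split_ifs with hn
    · simp [hn]
    · rw [Complex.cpow_neg, div_eq_mul_inv]; push_cast; rfl
  have hz : riemannZeta s ≠ 0 := riemannZeta_ne_zero_of_one_lt_re hs
  have h3 : LSeries (fun n => ((ArithmeticFunction.moebius n : ℤ) : ℂ)) s = 1 / riemannZeta s := by
    field_simp
    rw [mul_comm]; exact h1
  rw [h2, h3, HH, zeta1_eq_mul hne]
  have : s - 1 ≠ 0 := sub_ne_zero.2 hne
  have : s ≠ 0 := by rintro rfl; simp at hs0
  field_simp
end A3

section A4
open Complex MeasureTheory Filter Topology FourierTransform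

lemma GG_cont {c : ℝ} (hc : 1 < c) : Continuous fun v : ℝ => (VV v : ℂ) * cexp (-(c:ℂ) * v) := by
  have : (fun v : ℝ => (VV v : ℂ) * cexp (-(c:ℂ) * v)) = fun v => ∑' n, FF c n v := by
    ext v; rw [VV_eq]
  rw [this]
  refine continuous_tsum (u := fun n : ℕ => (n : ℝ) ^ (-c)) (fun n => ?_) (Real.summable_nat_rpow.2 (by linarith)) fun n v => ?_
  · unfold FF; fun_prop
  · refine (FF_norm n v).trans ?_
    simp only [Complex.ofReal_re]
    refine mul_le_of_le_one_right (by positivity) ?_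
    generalize v - Real.log n = y
    rcases le_total y 0 with hy | hy
    · rw [max_eq_right hy]; simp
    · rw [max_eq_left hy, neg_mul, Real.exp_neg]
      rw [mul_inv_le_iff₀ (Real.exp_pos _), one_mul]
      have := Real.add_one_le_exp (c * y)
      nlinarith

lemma GG_int {c : ℝ} (hc : 1 < c) : Integrable fun v : ℝ => (VV v : ℂ) * cexp (-(c:ℂ) * v) := by
  by_contra h
  have h1 := VV_laplace (s := c) (by simpa using hc)
  rw [integral_undef h] at h1
  have hm : (c : ℂ) ∈ UU := mem_UU (by simpa using hc.le)
  have : HH c ≠ 0 := by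
    unfold HH
    refine div_ne_zero ?_ hm
    rw [sub_ne_zero]
    exact_mod_cast hc.ne'
  exact this h1.symm

noncomputable def hh (c : ℝ) (ξ : ℝ) : ℂ := HH (c + 2 * Real.pi * I * ξ)

lemma GG_fourier {c : ℝ} (hc : 1 < c) : 𝓕 (fun v : ℝ => (VV v : ℂ) * cexp (-(c:ℂ) * v)) = hh c := by
  ext ξ
  rw [Real.fourier_real_eq_integral_exp_smul, hh, ← VV_laplace (by simpa using hc)]
  congr 1; ext v
  rw [smul_eq_mul, mul_left_comm, ← Complex.exp_add]
  congr 2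
  push_cast; ring

lemma arg_re (c ξ : ℝ) : ((c : ℂ) + 2 * Real.pi * I * ξ).re = c := by simp
lemma arg_im (c ξ : ℝ) : ((c : ℂ) + 2 * Real.pi * I * ξ).im = 2 * Real.pi * ξ := by simp

lemma HH_it_diff (k : ℕ) {s : ℂ} (hs : 1 ≤ s.re) : HasDerivAt (iteratedDeriv k HH) (iteratedDeriv (k+1) HH s) s := by
  have h := AnalyticOnNhd.iterated_deriv (differentiableOn_HH.analyticOnNhd isOpen_UU) k s (mem_UU hs)
  rw [← iteratedDeriv_eq_iterate] at h
  rw [iteratedDeriv_succ]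
  exact h.differentiableAt.hasDerivAt

lemma hh_step {c : ℝ} (hc : 1 < c) (k : ℕ) (ξ : ℝ) :
    HasDerivAt (fun ξ : ℝ => (2 * Real.pi * I) ^ k * iteratedDeriv k HH (c + 2 * Real.pi * I * ξ))
     ((2 * Real.pi * I) ^ (k+1) * iteratedDeriv (k+1) HH (c + 2 * Real.pi * I * ξ)) ξ := by
  have h1 : HasDerivAt (fun y : ℝ => (y : ℂ)) 1 ξ := Complex.ofRealCLM.hasDerivAt
  have h2 : HasDerivAt (fun y : ℝ => (c : ℂ) + 2 * Real.pi * I * y) (2 * Real.pi * I * 1) ξ := 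
    (h1.const_mul _).const_add _
  have h3 := (HH_it_diff k (s := c + 2 * Real.pi * I * ξ) (by rw [arg_re]; exact hc.le))
  have h4 := (HasDerivAt.comp_of_eq ξ h3 h2 rfl).const_mul ((2 * Real.pi * I) ^ k)
  refine h4.congr_deriv ?_
  ring

lemma hh_iter {c : ℝ} (hc : 1 < c) (k : ℕ) : iteratedDeriv k (hh c) =
    fun ξ : ℝ => (2 * Real.pi * I) ^ k * iteratedDeriv k HH (c + 2 * Real.pi * I * ξ) := by
  induction k with
  | zero => ext ξ; simp [hh]
  | succ k ih =>
    rw [iteratedDeriv_succ, ih]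
    ext ξ
    exact (hh_step hc k ξ).deriv

lemma hh_diff {c : ℝ} (hc : 1 < c) (k : ℕ) : Differentiable ℝ (iteratedDeriv k (hh c)) := by
  rw [hh_iter hc k]
  exact fun ξ => (hh_step hc k ξ).differentiableAt

lemma int_wt : Integrable fun ξ : ℝ => (1 + |2 * Real.pi * ξ|) ^ (-(3 / 2) : ℝ) := by
  have h := integrable_one_add_norm (E := ℝ) (μ := volume) (r := 3 / 2) (by simp; norm_num)
  have := (integrable_comp_mul_left_iff (fun x : ℝ => (1 + ‖x‖) ^ (-(3 / 2) : ℝ)) (R := 2 * Real.pi) (by positivity)).2 h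
  simpa only [Real.norm_eq_abs] using this

lemma hh_bd (k : ℕ) : ∃ C, 0 < C ∧ ∀ c : ℝ, 1 < c → c ≤ 2 → ∀ ξ, ‖iteratedDeriv k (hh c) ξ‖ ≤
    (2 * Real.pi) ^ k * (C * (1 + |2 * Real.pi * ξ|) ^ (-(3 / 2) : ℝ)) := by
  obtain ⟨C, hC, h⟩ := HH_deriv_bound k
  refine ⟨C, hC, fun c hc hc2 ξ => ?_⟩
  rw [hh_iter hc k]
  have h1 := h (c + 2 * Real.pi * I * ξ) (by rw [arg_re]; exact hc.le) (by rw [arg_re]; exact hc2)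
  rw [arg_im] at h1
  rw [norm_mul, norm_pow]
  have : ‖(2 * Real.pi * I : ℂ)‖ = 2 * Real.pi := by
    simp [abs_of_pos Real.pi_pos]
  rw [this]
  gcongr

lemma hh_int {c : ℝ} (hc : 1 < c) (hc2 : c ≤ 2) (k : ℕ) : Integrable (iteratedDeriv k (hh c)) := by
  obtain ⟨C, hC, h⟩ := hh_bd k
  refine Integrable.mono' ((int_wt.const_mul C).const_mul ((2 * Real.pi) ^ k)) ?_ (Eventually.of_forall (h c hc hc2))
  exact (hh_diff hc k).continuous.aestronglyMeasurable

lemma VV_bound (k : ℕ) : ∃ C, 0 < C ∧ ∀ v : ℝ, 1 < v → |VV v| ≤ C * Real.exp v / v ^ k := by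
  obtain ⟨C, hC, h⟩ := hh_bd k
  set J := ∫ ξ : ℝ, (1 + |2 * Real.pi * ξ|) ^ (-(3 / 2) : ℝ) with hJ
  have hJ0 : 0 ≤ J := integral_nonneg fun ξ => by positivity
  refine ⟨(C * J + 1) * Real.exp 1, by positivity, fun v hv => ?_⟩
  have hv0 : 0 < v := by linarith
  set c := 1 + 1 / v with hcdef
  have hc : 1 < c := by rw [hcdef]; have : 0 < 1 / v := by positivity
                        linarith
  have hc2 : c ≤ 2 := by
    rw [hcdef]; have : 1 / v ≤ 1 := by rw [div_le_one hv0]; exact hv.le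
    linarith
  have h0 : Integrable (hh c) := by simpa using hh_int hc hc2 0
  have inv := Continuous.fourierInv_fourier_eq (GG_cont hc) (GG_int hc) (by rw [GG_fourier hc]; exact h0)
  rw [GG_fourier hc] at inv
  have e1 := congrFun inv v
  rw [Real.fourierInv_eq_fourier_neg] at e1
  have e2 := Real.fourier_iteratedDeriv (f := hh c) (N := ⊤) (n := k)
    (contDiff_of_differentiable_iteratedDeriv fun m _ => hh_diff hc m) (fun n _ => hh_int hc hc2 n) le_top
  have e3 := congrFun e2 (-v)
  rw [e1] at e3
  have e4 : ‖𝓕 (iteratedDeriv k (hh c)) (-v)‖ ≤ ∫ ξ, ‖iteratedDeriv k (hh c) ξ‖ :=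
    VectorFourier.norm_fourierIntegral_le_integral_norm _ _ _ _ _
  have e5 : ∫ ξ, ‖iteratedDeriv k (hh c) ξ‖ ≤ (2 * Real.pi) ^ k * (C * J) := by
    rw [hJ, ← integral_const_mul, ← integral_const_mul]
    exact integral_mono (hh_int hc hc2 k).norm ((int_wt.const_mul C).const_mul ((2 * Real.pi) ^ k)) (h c hc hc2)
  rw [e3] at e4
  have e6 : ‖(2 * Real.pi * I * ((-v : ℝ) : ℂ)) ^ k • ((VV v : ℂ) * cexp (-(c:ℂ) * v))‖ = (2 * Real.pi) ^ k * (v ^ k * (|VV v| * Real.exp (-(v + 1)))) := by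
    rw [norm_smul, norm_pow, norm_mul (VV v : ℂ), Complex.norm_exp]
    have a1 : ‖(2 * Real.pi * I * ((-v : ℝ) : ℂ))‖ = 2 * Real.pi * v := by
      simp [abs_of_pos Real.pi_pos, abs_of_pos hv0]
    have a2 : (-(c:ℂ) * v).re = -(v + 1) := by
      simp [hcdef]; field_simp
    rw [a1, a2, mul_pow, Complex.norm_real, Real.norm_eq_abs]; ring
  rw [e6] at e4
  have e7 := le_of_mul_le_mul_left (e4.trans e5) (by positivity)
  rw [Real.exp_neg] at e7
  have hE := Real.exp_pos (v + 1)
  have hvk : 0 < v ^ k := by positivity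
  have e8 : v ^ k * |VV v| ≤ C * J * Real.exp (v + 1) := by
    rw [← mul_assoc, mul_inv_le_iff₀ hE] at e7
    exact e7
  rw [le_div_iff₀ hvk, mul_comm]
  refine e8.trans ?_
  rw [Real.exp_add]
  have := Real.exp_pos v
  have := Real.exp_pos 1
  nlinarith [mul_pos (Real.exp_pos v) (Real.exp_pos 1)]
end A4

section A5
open Finset

lemma VV_fin (K : ℕ) (v : ℝ) (hv : v ≤ Real.log K) (hK : 1 ≤ K) :
    VV v = ∑ n ∈ Ioc 0 K, (ArithmeticFunction.moebius n : ℝ) * max (v - Real.log n) 0 := by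
  rw [VV]
  refine tsum_eq_sum fun n hn => ?_
  rcases Nat.eq_zero_or_pos n with rfl | hn0
  · simp
  · have : K < n := by simpa [hn0] using hn
    rw [max_eq_right, mul_zero]
    have : Real.log K ≤ Real.log n := Real.log_le_log (by exact_mod_cast hK) (by exact_mod_cast this.le)
    linarith

lemma unsmooth (N : ℕ) (hN : 1 ≤ N) (h : ℝ) (h0 : 0 < h) (hN2 : h ≤ N) :
    |∑ n ∈ Ioc 0 N, (ArithmeticFunction.moebius n : ℝ)| ≤
      h + (|VV (Real.log (N + h))| + |VV (Real.log N)|) * (2 * N / h) := by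
  have hNr : (1:ℝ) ≤ N := by exact_mod_cast hN
  set δ := Real.log (N + h) - Real.log N with hδ
  have hδ1 : h / (2 * N) ≤ δ := by
    have e : δ = Real.log ((N + h) / N) := by rw [hδ, Real.log_div (by positivity) (by positivity)]
    rw [e]
    have := Real.one_sub_inv_le_log_of_pos (x := (N + h) / N) (by positivity)
    refine le_trans ?_ this
    rw [inv_div, one_sub_div (by positivity), add_sub_cancel_left]
    gcongr; linarith
  have hδ0 : 0 < δ := lt_of_lt_of_le (by positivity) hδ1
  set w : ℕ → ℝ := fun n => max (Real.log (N + h) - Real.log n) 0 - max (Real.log N - Real.log n) 0 with hw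
  have e1 : VV (Real.log (N + h)) - VV (Real.log N) = ∑ n ∈ Ioc 0 (2 * N), (ArithmeticFunction.moebius n : ℝ) * w n := by
    rw [VV_fin (2 * N) (Real.log (N + h)) (Real.log_le_log (by positivity) (by push_cast; linarith)) (by omega),
      VV_fin (2 * N) (Real.log N) (Real.log_le_log (by positivity) (by push_cast; linarith)) (by omega), ← sum_sub_distrib]
    exact sum_congr rfl fun n _ => by rw [hw]; ring
  have e2 : ∑ n ∈ Ioc 0 (2 * N), (ArithmeticFunction.moebius n : ℝ) * w n =
     ∑ n ∈ Ioc 0 N, (ArithmeticFunction.moebius n : ℝ) * w n + ∑ n ∈ Ioc N (2 * N), (ArithmeticFunction.moebius n : ℝ) * w n := by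
    rw [sum_Ioc_consecutive _ (by omega) (by omega)]
  have e3 : ∑ n ∈ Ioc 0 N, (ArithmeticFunction.moebius n : ℝ) * w n = (∑ n ∈ Ioc 0 N, (ArithmeticFunction.moebius n : ℝ)) * δ := by
    rw [sum_mul]
    refine sum_congr rfl fun n hn => ?_
    rw [mem_Ioc] at hn
    have l1 : Real.log n ≤ Real.log N := Real.log_le_log (by exact_mod_cast hn.1) (by exact_mod_cast hn.2)
    rw [hw]; simp only
    rw [max_eq_left (by linarith), max_eq_left (by linarith), hδ]; ring
  have e4 : |∑ n ∈ Ioc N (2 * N), (ArithmeticFunction.moebius n : ℝ) * w n| ≤ δ * h := by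
    refine (abs_sum_le_sum_abs _ _).trans ?_
    have : ∀ n ∈ Ioc N (2 * N), |(ArithmeticFunction.moebius n : ℝ) * w n| ≤ if n ≤ N + ⌊h⌋₊ then δ else 0 := by
      intro n hn
      rw [mem_Ioc] at hn
      have hm : |(ArithmeticFunction.moebius n : ℝ)| ≤ 1 := by exact_mod_cast ArithmeticFunction.abs_moebius_le_one
      rw [abs_mul]
      refine (mul_le_of_le_one_left (abs_nonneg _) hm).trans ?_
      have l1 : Real.log N ≤ Real.log n := Real.log_le_log (by positivity) (by exact_mod_cast hn.1.le)
      rw [hw]; simp only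
      rw [max_eq_right (a := Real.log N - Real.log n) (by linarith), sub_zero, abs_of_nonneg (le_max_right _ _)]
      split_ifs with hc
      · exact max_le (by rw [hδ]; linarith) hδ0.le
      · refine max_le ?_ le_rfl
        have : h < (n - N : ℕ) := (Nat.floor_lt h0.le).1 (by omega)
        rw [Nat.cast_sub hn.1.le] at this
        have := Real.log_le_log (x := N + h) (y := n) (by positivity) (by linarith)
        linarith
    refine (sum_le_sum this).trans ?_
    rw [← sum_filter, sum_const, nsmul_eq_mul, mul_comm]
    refine mul_le_mul_of_nonneg_left ?_ hδ0.le
    refine le_trans ?_ (Nat.floor_le h0.le)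
    have : (filter (fun n => n ≤ N + ⌊h⌋₊) (Ioc N (2 * N))) ⊆ Ioc N (N + ⌊h⌋₊) := by
      intro n hn; simp at hn ⊢; omega
    have := card_le_card this
    rw [Nat.card_Ioc, Nat.add_sub_cancel_left] at this
    exact_mod_cast this
  set M := ∑ n ∈ Ioc 0 N, (ArithmeticFunction.moebius n : ℝ)
  set X := VV (Real.log (N + h))
  set Y := VV (Real.log N)
  have e5 : |M| * δ ≤ (|X| + |Y|) + δ * h := by
    rw [← abs_of_pos hδ0, ← abs_mul, ← e3, abs_of_pos hδ0]
    have : ∑ n ∈ Ioc 0 N, (ArithmeticFunction.moebius n : ℝ) * w n = X - Y - ∑ n ∈ Ioc N (2 * N), (ArithmeticFunction.moebius n : ℝ) * w n := by linarith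
    rw [this]
    have := abs_sub (X - Y) (∑ n ∈ Ioc N (2 * N), (ArithmeticFunction.moebius n : ℝ) * w n)
    have := abs_sub X Y
    linarith
  have e6 : (|X| + |Y|) ≤ (|X| + |Y|) * (2 * N / h) * δ := by
    rw [mul_assoc]
    refine le_mul_of_one_le_right (by positivity) ?_
    calc (1:ℝ) = 2 * N / h * (h / (2 * N)) := by field_simp
      _ ≤ _ := by gcongr
  refine le_of_mul_le_mul_right ?_ hδ0
  nlinarith

lemma mertens (A : ℕ) : ∃ C, 0 < C ∧ ∀ N : ℕ, |∑ n ∈ Ioc 0 N, (ArithmeticFunction.moebius n : ℝ)| ≤ C * N / (Real.log (N + 3)) ^ A := by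
  obtain ⟨C, hC, h⟩ := VV_bound (2 * A)
  refine ⟨2 ^ A * (1 + 6 * C), by positivity, fun N => ?_⟩
  have hl3 : 0 < Real.log (N + 3) := Real.log_pos (by linarith [(Nat.cast_nonneg N : (0:ℝ) ≤ N)])
  rcases lt_or_ge N 3 with hN | hN
  · have t : |∑ n ∈ Ioc 0 N, (ArithmeticFunction.moebius n : ℝ)| ≤ N := by
      refine (abs_sum_le_sum_abs _ _).trans ?_
      refine (sum_le_card_nsmul _ _ 1 fun n _ => ?_).trans (by simp)
      exact_mod_cast ArithmeticFunction.abs_moebius_le_one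
    refine t.trans ?_
    rw [le_div_iff₀ (by positivity)]
    have hl : Real.log (N + 3) ≤ 2 := by
      rw [Real.log_le_iff_le_exp (by positivity)]
      have h1 := Real.exp_one_gt_d9
      have : Real.exp 2 = Real.exp 1 * Real.exp 1 := by rw [← Real.exp_add]; norm_num
      have h2 : (N:ℝ) ≤ 2 := by exact_mod_cast (by omega : N ≤ 2)
      rw [this]; nlinarith
    have : Real.log (N + 3) ^ A ≤ 2 ^ A := pow_le_pow_left₀ hl3.le hl A
    have h3 : (0:ℝ) ≤ N := Nat.cast_nonneg N
    calc N * Real.log (N + 3) ^ A ≤ N * 2 ^ A := by gcongr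
      _ = 2 ^ A * 1 * N := by ring
      _ ≤ _ := by gcongr; linarith
  · have hNr : (3:ℝ) ≤ N := by exact_mod_cast hN
    have hL1 : 1 < Real.log N := by
      rw [Real.lt_log_iff_exp_lt (by positivity)]
      linarith [Real.exp_one_lt_d9]
    set L := Real.log N with hL
    have hA1 : 1 ≤ L ^ A := one_le_pow₀ hL1.le
    have hA0 : 0 < L ^ A := by linarith
    set H := N / L ^ A with hH
    have hH0 : 0 < H := by positivity
    have hHN : H ≤ N := div_le_self (by positivity) hA1
    have u := unsmooth N (by omega) H hH0 hHN
    have hlL : L ≤ Real.log (N + H) := Real.log_le_log (by positivity) (by linarith)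
    have b1 := h (Real.log (N + H)) (by linarith)
    have b2 := h L hL1
    rw [Real.exp_log (by positivity)] at b1
    rw [hL, Real.exp_log (by positivity), ← hL] at b2
    have b3 : |VV (Real.log (N + H))| ≤ C * (2 * N) / L ^ (2 * A) := by
      refine b1.trans ?_
      gcongr; linarith
    have b4 : |∑ n ∈ Ioc 0 N, (ArithmeticFunction.moebius n : ℝ)| ≤ (1 + 6 * C) * N / L ^ A := by
      refine u.trans ?_
      calc _ ≤ H + (C * (2 * N) / L ^ (2 * A) + C * N / L ^ (2 * A)) * (2 * N / H) := by gcongr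
        _ = (1 + 6 * C) * N / L ^ A := by
          rw [hH, two_mul A, pow_add]; field_simp; ring
    have hll : Real.log (N + 3) ≤ 2 * L := by
      have : Real.log ((N:ℝ) ^ 2) = 2 * L := by rw [Real.log_pow]; norm_num [hL]
      rw [← this]
      exact Real.log_le_log (by positivity) (by nlinarith)
    refine b4.trans ?_
    rw [div_le_div_iff₀ hA0 (by positivity)]
    have : Real.log (N + 3) ^ A ≤ (2 * L) ^ A := pow_le_pow_left₀ hl3.le hll A
    rw [mul_pow] at this
    calc _ ≤ (1 + 6 * C) * N * (2 ^ A * L ^ A) := by gcongr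
      _ = _ := by ring
end A5

section A6
open Finset ArithmeticFunction

/-- truncation -/
def trunc (y : ℕ) (u : ArithmeticFunction ℤ) : ArithmeticFunction ℤ := ⟨fun n => if n ≤ y then u n else 0, by simp⟩

lemma trunc_apply (y : ℕ) (u : ArithmeticFunction ℤ) (n : ℕ) : trunc y u n = if n ≤ y then u n else 0 := rfl

lemma trunc_sum {y M : ℕ} (h : y ≤ M) (u : ArithmeticFunction ℤ) (F : ℕ → ℤ) :
    ∑ n ∈ Ioc 0 M, trunc y u n * F n = ∑ n ∈ Ioc 0 y, u n * F n := by
  symm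
  refine sum_subset_zero_on_sdiff (Ioc_subset_Ioc_right h) ?_ ?_
  · intro n hn
    simp only [mem_sdiff, mem_Ioc, not_and, not_le] at hn
    rw [trunc_apply, if_neg (by have := hn.2 hn.1.1; omega), zero_mul]
  · intro n hn
    rw [trunc_apply, if_pos (mem_Ioc.1 hn).2]

lemma le_div_sqrt {N a : ℕ} (ha0 : 0 < a) (ha : a ≤ Nat.sqrt N) : Nat.sqrt N ≤ N / a := by
  rw [Nat.le_div_iff_mul_le ha0]
  exact (Nat.mul_le_mul_left _ ha).trans (Nat.sqrt_le N)

lemma hyperbola (u w : ArithmeticFunction ℤ) (N : ℕ) :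
    ∑ n ∈ Ioc 0 N, (u * w) n = ∑ a ∈ Ioc 0 (Nat.sqrt N), u a * (∑ m ∈ Ioc 0 (N / a), w m)
      + ∑ b ∈ Ioc 0 (Nat.sqrt N), w b * (∑ m ∈ Ioc 0 (N / b), u m)
      - (∑ m ∈ Ioc 0 (Nat.sqrt N), u m) * (∑ m ∈ Ioc 0 (Nat.sqrt N), w m) := by
  set y := Nat.sqrt N with hy
  have hyN : y ≤ N := Nat.sqrt_le_self N
  have e : u * w = trunc y u * w + trunc y w * u - trunc y u * trunc y w + (u - trunc y u) * (w - trunc y w) := by ring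
  have z : ∑ n ∈ Ioc 0 N, ((u - trunc y u) * (w - trunc y w)) n = 0 := by
    rw [sum_Ioc_mul_eq_sum_sum]
    refine sum_eq_zero fun n hn => ?_
    rw [mem_Ioc] at hn
    rcases le_or_gt n y with h | h
    · have : (u - trunc y u) n = 0 := by
        rw [sub_eq_add_neg, ArithmeticFunction.add_apply, ArithmeticFunction.neg_apply, trunc_apply, if_pos h]; ring
      rw [this, zero_mul]
    · convert mul_zero _
      refine sum_eq_zero fun m hm => ?_
      have : m ≤ y := by
        refine (mem_Ioc.1 hm).2.trans ?_
        have h1 : N < (y + 1) * (y + 1) := Nat.lt_succ_sqrt N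
        have : N / n < y + 1 := by
          rw [Nat.div_lt_iff_lt_mul hn.1]
          exact h1.trans_le (Nat.mul_le_mul_left _ h)
        omega
      rw [sub_eq_add_neg, ArithmeticFunction.add_apply, ArithmeticFunction.neg_apply, trunc_apply, if_pos this]; ring
  have z3 : ∑ n ∈ Ioc 0 N, (trunc y u * trunc y w) n = (∑ m ∈ Ioc 0 y, u m) * (∑ m ∈ Ioc 0 y, w m) := by
    rw [sum_Ioc_mul_eq_sum_sum, trunc_sum hyN, sum_mul]
    refine sum_congr rfl fun a ha => ?_
    rw [mem_Ioc] at ha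
    have := trunc_sum (le_div_sqrt ha.1 ha.2) w (fun _ => 1)
    simp only [mul_one] at this
    rw [this]
  have z1 : ∑ n ∈ Ioc 0 N, (trunc y u * w) n = ∑ a ∈ Ioc 0 y, u a * (∑ m ∈ Ioc 0 (N / a), w m) := by
    rw [sum_Ioc_mul_eq_sum_sum, trunc_sum hyN]
  have z2 : ∑ n ∈ Ioc 0 N, (trunc y w * u) n = ∑ a ∈ Ioc 0 y, w a * (∑ m ∈ Ioc 0 (N / a), u m) := by
    rw [sum_Ioc_mul_eq_sum_sum, trunc_sum hyN]
  rw [e]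
  simp only [sub_eq_add_neg _ (trunc y u * trunc y w), ArithmeticFunction.add_apply, ArithmeticFunction.neg_apply, sum_add_distrib, sum_neg_distrib]
  rw [z, z1, z2, z3]; ring

/-- the logarithm used -/
noncomputable def lg (N : ℕ) : ℝ := Real.log (N + 3)

lemma lg_ge (N : ℕ) : 1 ≤ lg N := by
  unfold lg
  rw [Real.le_log_iff_exp_le (by positivity)]
  linarith [Real.exp_one_lt_d9, (Nat.cast_nonneg N : (0:ℝ) ≤ N)]

lemma lg_mono {M N : ℕ} (h : M ≤ N) : lg M ≤ lg N := by
  unfold lg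
  have : (M:ℝ) ≤ N := by exact_mod_cast h
  exact Real.log_le_log (by positivity) (by linarith)

lemma lg_sqrt (N : ℕ) : lg N ≤ 2 * lg (Nat.sqrt N) := by
  unfold lg
  have : Real.log (((Nat.sqrt N : ℝ) + 3) ^ 2) = 2 * Real.log (Nat.sqrt N + 3) := by
    rw [Real.log_pow]; norm_num
  rw [← this]
  refine Real.log_le_log (by positivity) ?_
  have h1 : N < (Nat.sqrt N + 1) * (Nat.sqrt N + 1) := Nat.lt_succ_sqrt N
  have h2 : (N:ℝ) < (Nat.sqrt N + 1) * (Nat.sqrt N + 1) := by exact_mod_cast h1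
  nlinarith [(Nat.cast_nonneg (Nat.sqrt N) : (0:ℝ) ≤ (Nat.sqrt N : ℕ))]

def Q1 (u : ArithmeticFunction ℤ) : Prop := ∀ A : ℕ, ∃ C : ℝ, 0 < C ∧ ∀ N : ℕ,
  |∑ n ∈ Ioc 0 N, (u n : ℝ)| ≤ C * Real.sqrt N / lg N ^ A

def Q2 (u : ArithmeticFunction ℤ) : Prop := ∃ C : ℝ, ∃ B : ℕ, 0 < C ∧ ∀ N : ℕ,
  ∑ n ∈ Ioc 0 N, |(u n : ℝ)| / Real.sqrt n ≤ C * lg N ^ B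

noncomputable def absw (u : ArithmeticFunction ℤ) : ArithmeticFunction ℝ := ⟨fun n => |(u n : ℝ)| / Real.sqrt n, by simp⟩

lemma absw_apply (u : ArithmeticFunction ℤ) (n : ℕ) : absw u n = |(u n : ℝ)| / Real.sqrt n := rfl

lemma absw_nonneg (u : ArithmeticFunction ℤ) (n : ℕ) : 0 ≤ absw u n := by rw [absw_apply]; positivity

lemma absw_mul (u w : ArithmeticFunction ℤ) (n : ℕ) : absw (u * w) n ≤ (absw u * absw w) n := by
  rw [absw_apply, mul_apply, mul_apply]
  push_cast
  refine (div_le_div_of_nonneg_right (abs_sum_le_sum_abs _ _) (Real.sqrt_nonneg _)).trans ?_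
  rw [sum_div]
  refine sum_le_sum fun x hx => ?_
  rw [absw_apply, absw_apply, abs_mul, div_mul_div_comm, ← Real.sqrt_mul (Nat.cast_nonneg _)]
  rw [← Nat.cast_mul, (Nat.mem_divisorsAntidiagonal.1 hx).1]

lemma Q2_mul {u w : ArithmeticFunction ℤ} (hu : Q2 u) (hw : Q2 w) : Q2 (u * w) := by
  obtain ⟨C, B, hC, h⟩ := hu
  obtain ⟨C', B', hC', h'⟩ := hw
  refine ⟨C * C', B + B', by positivity, fun N => ?_⟩
  have h0 := h N
  have h0' := h' N
  have hl := lg_ge N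
  simp only [← absw_apply] at *
  calc _ ≤ ∑ n ∈ Ioc 0 N, (absw u * absw w) n := sum_le_sum fun n _ => absw_mul u w n
    _ = ∑ n ∈ Ioc 0 N, absw u n * ∑ m ∈ Ioc 0 (N / n), absw w m := sum_Ioc_mul_eq_sum_sum _ _ _
    _ ≤ ∑ n ∈ Ioc 0 N, absw u n * ∑ m ∈ Ioc 0 N, absw w m := by
      refine sum_le_sum fun n _ => mul_le_mul_of_nonneg_left ?_ (absw_nonneg _ _)
      exact sum_le_sum_of_subset_of_nonneg (Ioc_subset_Ioc_right (Nat.div_le_self _ _)) fun m _ _ => absw_nonneg _ _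
    _ = (∑ n ∈ Ioc 0 N, absw u n) * ∑ m ∈ Ioc 0 N, absw w m := by rw [sum_mul]
    _ ≤ (C * lg N ^ B) * (C' * lg N ^ B') := by
      gcongr
      exact sum_nonneg fun m _ => absw_nonneg _ _
    _ = _ := by rw [pow_add]; ring

lemma sqrt_div_le (N a : ℕ) : Real.sqrt ((N / a : ℕ) : ℝ) ≤ Real.sqrt N / Real.sqrt a := by
  rw [← Real.sqrt_div (Nat.cast_nonneg _)]
  exact Real.sqrt_le_sqrt Nat.cast_div_le

lemma half_bound {u w : ArithmeticFunction ℤ} (hu : Q2 u) (hw : Q1 w) (A : ℕ) : ∃ C : ℝ, 0 < C ∧ ∀ N : ℕ,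
    |∑ a ∈ Ioc 0 (Nat.sqrt N), (u a : ℝ) * (∑ m ∈ Ioc 0 (N / a), (w m : ℝ))| ≤ C * Real.sqrt N / lg N ^ A := by
  obtain ⟨C, B, hC, h⟩ := hu
  obtain ⟨C', hC', h'⟩ := hw (A + B)
  refine ⟨C * C' * 2 ^ (A + B), by positivity, fun N => ?_⟩
  have hl := lg_ge N
  have hl0 : 0 < lg N := by linarith
  set y := Nat.sqrt N with hy
  have t : ∀ a ∈ Ioc 0 y, |(u a : ℝ) * (∑ m ∈ Ioc 0 (N / a), (w m : ℝ))| ≤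
      |(u a : ℝ)| / Real.sqrt a * (C' * Real.sqrt N * 2 ^ (A + B) / lg N ^ (A + B)) := by
    intro a ha
    rw [mem_Ioc] at ha
    have ha0 : 0 < Real.sqrt a := Real.sqrt_pos.2 (by exact_mod_cast ha.1)
    rw [abs_mul]
    have b := h' (N / a)
    have l1 : lg N / 2 ≤ lg (N / a) := by
      have := lg_mono (le_div_sqrt ha.1 ha.2)
      have := lg_sqrt N
      rw [← hy] at *
      linarith
    have : |∑ m ∈ Ioc 0 (N / a), (w m : ℝ)| ≤ C' * (Real.sqrt N / Real.sqrt a) / (lg N / 2) ^ (A + B) := by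
      refine b.trans ?_
      gcongr
      exact sqrt_div_le N a
    refine (mul_le_mul_of_nonneg_left this (abs_nonneg _)).trans (le_of_eq ?_)
    rw [div_pow]; field_simp
  refine (abs_sum_le_sum_abs _ _).trans ((sum_le_sum t).trans ?_)
  rw [← sum_mul]
  have hh : ∑ a ∈ Ioc 0 y, |(u a : ℝ)| / Real.sqrt a ≤ C * lg N ^ B := by
    refine (h y).trans ?_
    have := lg_ge y
    have := lg_mono (Nat.sqrt_le_self N)
    gcongr
  refine (mul_le_mul_of_nonneg_right hh (by positivity)).trans (le_of_eq ?_)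
  rw [pow_add (lg N)]; field_simp

lemma Q1_mul {u w : ArithmeticFunction ℤ} (hu : Q1 u) (hw : Q1 w) (hu2 : Q2 u) (hw2 : Q2 w) : Q1 (u * w) := by
  intro A
  obtain ⟨C1, hC1, h1⟩ := half_bound hu2 hw A
  obtain ⟨C2, hC2, h2⟩ := half_bound hw2 hu A
  obtain ⟨C3, hC3, h3⟩ := hu A
  obtain ⟨C4, hC4, h4⟩ := hw 0
  refine ⟨C1 + C2 + C3 * C4 * 2 ^ A, by positivity, fun N => ?_⟩
  have hl := lg_ge N
  have hl0 : 0 < lg N := by linarith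
  have e : ∑ n ∈ Ioc 0 N, ((u * w) n : ℝ) = ∑ a ∈ Ioc 0 (Nat.sqrt N), (u a : ℝ) * (∑ m ∈ Ioc 0 (N / a), (w m : ℝ))
      + ∑ b ∈ Ioc 0 (Nat.sqrt N), (w b : ℝ) * (∑ m ∈ Ioc 0 (N / b), (u m : ℝ))
      - (∑ m ∈ Ioc 0 (Nat.sqrt N), (u m : ℝ)) * (∑ m ∈ Ioc 0 (Nat.sqrt N), (w m : ℝ)) := by
    exact_mod_cast congrArg (Int.cast : ℤ → ℝ) (hyperbola u w N)
  rw [e]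
  refine (abs_sub _ _).trans ?_
  refine (add_le_add (abs_add_le _ _) le_rfl).trans ?_
  have b1 := h1 N
  have b2 := h2 N
  have b3 := h3 (Nat.sqrt N)
  have b4 := h4 (Nat.sqrt N)
  rw [pow_zero, div_one] at b4
  have b5 : |(∑ m ∈ Ioc 0 (Nat.sqrt N), (u m : ℝ)) * (∑ m ∈ Ioc 0 (Nat.sqrt N), (w m : ℝ))| ≤ C3 * C4 * 2 ^ A * Real.sqrt N / lg N ^ A := by
    rw [abs_mul]
    have hs : Real.sqrt (Nat.sqrt N : ℕ) * Real.sqrt (Nat.sqrt N : ℕ) ≤ Real.sqrt N := by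
      rw [Real.mul_self_sqrt (Nat.cast_nonneg _)]
      exact Real.nat_sqrt_le_real_sqrt
    have l1 : lg N / 2 ≤ lg (Nat.sqrt N) := by linarith [lg_sqrt N]
    calc _ ≤ (C3 * Real.sqrt (Nat.sqrt N : ℕ) / lg (Nat.sqrt N) ^ A) * (C4 * Real.sqrt (Nat.sqrt N : ℕ)) := by
          gcongr
          have := lg_ge (Nat.sqrt N)
          positivity
      _ ≤ (C3 * Real.sqrt (Nat.sqrt N : ℕ) / (lg N / 2) ^ A) * (C4 * Real.sqrt (Nat.sqrt N : ℕ)) := by gcongr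
      _ = C3 * C4 * 2 ^ A * (Real.sqrt (Nat.sqrt N : ℕ) * Real.sqrt (Nat.sqrt N : ℕ)) / lg N ^ A := by
          rw [div_pow]; field_simp
      _ ≤ _ := by gcongr
  calc _ ≤ C1 * Real.sqrt N / lg N ^ A + C2 * Real.sqrt N / lg N ^ A + C3 * C4 * 2 ^ A * Real.sqrt N / lg N ^ A := by gcongr
    _ = _ := by ring
end A6

section A7
open Finset ArithmeticFunction

/-- transport to squares -/
noncomputable def sqf (u : ArithmeticFunction ℤ) : ArithmeticFunction ℤ :=
  ⟨fun n => if Nat.sqrt n ^ 2 = n then u (Nat.sqrt n) else 0, by simp⟩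

lemma sqf_sq (u : ArithmeticFunction ℤ) (k : ℕ) : sqf u (k ^ 2) = u k := by
  change (if Nat.sqrt (k ^ 2) ^ 2 = k ^ 2 then u (Nat.sqrt (k ^ 2)) else 0) = u k
  rw [Nat.sqrt_eq', if_pos rfl]

lemma sqf_of_not (u : ArithmeticFunction ℤ) (n : ℕ) (h : ¬ ∃ k, n = k ^ 2) : sqf u n = 0 := by
  change (if Nat.sqrt n ^ 2 = n then u (Nat.sqrt n) else 0) = 0
  rw [if_neg fun e => h ⟨_, e.symm⟩]

lemma sqf_mult {u : ArithmeticFunction ℤ} (hu : u.IsMultiplicative) : (sqf u).IsMultiplicative := by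
  refine ⟨?_, fun {m n} hmn => ?_⟩
  · have := sqf_sq u 1
    rw [one_pow] at this
    rw [this, hu.map_one]
  · by_cases h : (∃ k, m = k ^ 2) ∧ ∃ k, n = k ^ 2
    · obtain ⟨⟨k, rfl⟩, ⟨l, rfl⟩⟩ := h
      rw [← mul_pow, sqf_sq, sqf_sq, sqf_sq]
      rw [Nat.coprime_pow_left_iff two_pos, Nat.coprime_pow_right_iff two_pos] at hmn
      exact hu.map_mul_of_coprime hmn
    · have h1 : ¬ ∃ k, m * n = k ^ 2 := by
        rintro ⟨k, hk⟩
        refine h ⟨?_, ?_⟩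
        · exact exists_eq_pow_of_mul_eq_pow (by rw [Nat.isUnit_iff]; exact hmn) hk
        · rw [mul_comm] at hk
          exact exists_eq_pow_of_mul_eq_pow (by rw [Nat.isUnit_iff]; exact hmn.symm) hk
      rw [sqf_of_not u _ h1]
      rw [not_and_or] at h
      rcases h with h | h
      · rw [sqf_of_not u _ h, zero_mul]
      · rw [sqf_of_not u _ h, mul_zero]

lemma sum_squares (F : ℕ → ℝ) (hF : ∀ n, (¬ ∃ k, n = k ^ 2) → F n = 0) (N : ℕ) :
    ∑ n ∈ Ioc 0 N, F n = ∑ k ∈ Ioc 0 (Nat.sqrt N), F (k ^ 2) := by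
  rw [← sum_image (f := F) (g := fun k => k ^ 2)]
  · symm
    refine sum_subset ?_ ?_
    · intro n hn
      simp only [mem_image, mem_Ioc] at hn ⊢
      obtain ⟨k, ⟨h1, h2⟩, rfl⟩ := hn
      exact ⟨by positivity, by rw [Nat.le_sqrt'] at h2; exact h2⟩
    · intro n hn hn'
      refine hF n ?_
      rintro ⟨k, rfl⟩
      apply hn'
      simp only [mem_image, mem_Ioc] at hn ⊢
      exact ⟨k, ⟨Nat.pos_of_ne_zero (by rintro rfl; simp at hn), by rw [Nat.le_sqrt']; exact hn.2⟩, rfl⟩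
  · intro a _ b _ h
    exact Nat.pow_left_injective (n := 2) (by norm_num) h

noncomputable def LL : ArithmeticFunction ℤ := sqf moebius
noncomputable def DD : ArithmeticFunction ℤ := sqf (zeta : ArithmeticFunction ℤ)

lemma Q1_LL : Q1 LL := by
  intro A
  obtain ⟨C, hC, h⟩ := mertens A
  refine ⟨C * 2 ^ A, by positivity, fun N => ?_⟩
  rw [sum_squares (fun n => (LL n : ℝ)) (fun n hn => by rw [LL, sqf_of_not _ _ hn]; simp)]
  simp only [LL, sqf_sq]
  have b := h (Nat.sqrt N)
  have hl := lg_ge N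
  have l1 : lg N / 2 ≤ lg (Nat.sqrt N) := by linarith [lg_sqrt N]
  change _ ≤ C * _ / lg (Nat.sqrt N) ^ A at b
  calc _ ≤ _ := b
    _ ≤ C * Real.sqrt N / (lg N / 2) ^ A := by
      gcongr
      exact Real.nat_sqrt_le_real_sqrt
    _ = _ := by rw [div_pow]; field_simp

lemma Q2_LL : Q2 LL := by
  refine ⟨2, 1, by norm_num, fun N => ?_⟩
  rw [sum_squares (fun n => |(LL n : ℝ)| / Real.sqrt n) (fun n hn => by rw [LL, sqf_of_not _ _ hn]; simp)]
  simp only [LL, sqf_sq]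
  have t : ∀ k ∈ Ioc 0 (Nat.sqrt N), |(moebius k : ℝ)| / Real.sqrt ((k ^ 2 : ℕ) : ℝ) ≤ (k : ℝ)⁻¹ := by
    intro k _
    push_cast
    rw [Real.sqrt_sq (Nat.cast_nonneg _), ← one_div]
    gcongr
    exact_mod_cast abs_moebius_le_one
  refine (sum_le_sum t).trans ?_
  have hm := harmonic_le_one_add_log (Nat.sqrt N)
  rw [harmonic_eq_sum_Icc] at hm
  push_cast at hm
  have : Ioc 0 (Nat.sqrt N) = Icc 1 (Nat.sqrt N) := rfl
  rw [this]
  refine hm.trans ?_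
  rw [pow_one]
  have h1 : Real.log (Nat.sqrt N : ℕ) ≤ lg N := by
    rcases Nat.eq_zero_or_pos (Nat.sqrt N) with h | h
    · rw [h]; simp; linarith [lg_ge N]
    · refine le_trans ?_ (lg_mono (Nat.sqrt_le_self N))
      exact Real.log_le_log (by exact_mod_cast h) (by linarith)
  linarith [lg_ge N]

lemma mul_prime_pow (u w : ArithmeticFunction ℤ) {p : ℕ} (hp : p.Prime) (k : ℕ) :
    (u * w) (p ^ k) = ∑ i ∈ range (k + 1), u (p ^ i) * w (p ^ (k - i)) := by
  rw [mul_apply, Nat.sum_divisorsAntidiagonal (fun a b => u a * w b), Nat.divisors_prime_pow hp, sum_map]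
  refine sum_congr rfl fun i hi => ?_
  simp only [Function.Embedding.coeFn_mk]
  rw [Nat.pow_div (by simpa [Nat.lt_succ_iff] using hi) hp.pos]

lemma LL_mult : LL.IsMultiplicative := sqf_mult isMultiplicative_moebius
lemma DD_mult : DD.IsMultiplicative := sqf_mult isMultiplicative_zeta.natCast

lemma sqf_prime_pow_odd (u : ArithmeticFunction ℤ) {p : ℕ} (hp : p.Prime) (k : ℕ) : sqf u (p ^ (2 * k + 1)) = 0 := by
  apply sqf_of_not
  rintro ⟨l, hl⟩
  have := congrArg (fun n => n.factorization p) hl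
  simp [Nat.factorization_pow, hp.factorization] at this
  omega

lemma sqf_prime_pow_even (u : ArithmeticFunction ℤ) (p : ℕ) (k : ℕ) : sqf u (p ^ (2 * k)) = u (p ^ k) := by
  rw [mul_comm, pow_mul, sqf_sq]

lemma DD_pp {p : ℕ} (hp : p.Prime) (k : ℕ) : DD (p ^ (k + 2)) = DD (p ^ k) := by
  rcases Nat.even_or_odd' k with ⟨j, rfl | rfl⟩
  · rw [show 2 * j + 2 = 2 * (j + 1) by ring, DD, sqf_prime_pow_even, sqf_prime_pow_even]
    simp [hp.ne_zero]
  · rw [show 2 * j + 1 + 2 = 2 * (j + 1) + 1 by ring, DD, sqf_prime_pow_odd _ hp, sqf_prime_pow_odd _ hp]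

lemma LL_pp {p : ℕ} (hp : p.Prime) (k : ℕ) : LL (p ^ k) = if k = 0 then 1 else if k = 2 then -1 else 0 := by
  rcases Nat.even_or_odd' k with ⟨j, rfl | rfl⟩
  · rw [LL, sqf_prime_pow_even]
    rcases j with _ | _ | j
    · simp
    · simp [moebius_apply_prime hp]
    · rw [moebius_apply_prime_pow hp (by omega)]
      simp
  · rw [LL, sqf_prime_pow_odd _ hp]
    rw [if_neg (by omega), if_neg (by omega)]

lemma LL_mul_DD : LL * DD = 1 := by
  rw [(LL_mult.mul DD_mult).eq_iff_eq_on_prime_powers _ _ isMultiplicative_one]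
  intro p k hp
  rw [mul_prime_pow _ _ hp]
  rcases k with _ | _ | k
  · simp [LL_mult.map_one, DD_mult.map_one]
  · have : DD p = 0 := by have := sqf_prime_pow_odd (zeta : ArithmeticFunction ℤ) hp 0; simpa [DD] using this
    have h2 := LL_pp hp 1
    simp at h2
    simp [sum_range_succ, this, h2, one_apply, hp.ne_one]
  · have : (1 : ArithmeticFunction ℤ) (p ^ (k + 2)) = 0 := one_apply_ne (by
      have := Nat.one_lt_pow (n := k + 2) (by omega) hp.one_lt
      omega)
    rw [this, add_comm (k + 1 + 1) 1, add_comm 1, sum_range_succ', sum_range_succ', sum_range_succ']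
    have z : ∑ i ∈ range k, LL (p ^ (i + 1 + 1 + 1)) * DD (p ^ (k + 1 + 1 - (i + 1 + 1 + 1))) = 0 :=
      sum_eq_zero fun i _ => by rw [LL_pp hp, if_neg (by omega), if_neg (by omega), zero_mul]
    rw [z, LL_pp hp, LL_pp hp, LL_pp hp]
    simp [DD_pp hp]

lemma Q_pow (m : ℕ) : Q1 (LL ^ (m + 1)) ∧ Q2 (LL ^ (m + 1)) := by
  induction m with
  | zero => simpa using ⟨Q1_LL, Q2_LL⟩
  | succ m ih => rw [pow_succ]; exact ⟨Q1_mul ih.1 Q1_LL ih.2 Q2_LL, Q2_mul ih.2 Q2_LL⟩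

lemma LL_pow_bound (m : ℕ) : ∃ C : ℝ, 0 < C ∧ ∀ N : ℕ, |∑ n ∈ Ioc 0 N, ((LL ^ m) n : ℝ)| ≤ C * Real.sqrt N := by
  rcases m with _ | m
  · refine ⟨1, one_pos, fun N => ?_⟩
    rcases Nat.eq_zero_or_pos N with rfl | hN
    · simp
    · rw [sum_eq_single_of_mem 1 (by simp; omega) (fun b _ hb => by simp [one_apply_ne hb])]
      simp
      exact_mod_cast hN
  · obtain ⟨C, hC, h⟩ := (Q_pow m).1 0
    exact ⟨C, hC, fun N => by simpa using h N⟩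
end A7

section A8
open Finset ArithmeticFunction

def PB (u : ArithmeticFunction ℤ) : Prop := ∃ C : ℝ, ∃ B : ℕ, 0 < C ∧ ∀ p : ℕ, p.Prime → ∀ j : ℕ, |(u (p ^ j) : ℝ)| ≤ C * (1 + j) ^ B

lemma PB_mul {u w : ArithmeticFunction ℤ} (hu : PB u) (hw : PB w) : PB (u * w) := by
  obtain ⟨C, B, hC, h⟩ := hu
  obtain ⟨C', B', hC', h'⟩ := hw
  refine ⟨C * C', B + B' + 1, by positivity, fun p hp j => ?_⟩
  rw [mul_prime_pow _ _ hp]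
  push_cast
  refine (abs_sum_le_sum_abs _ _).trans ?_
  have t : ∀ i ∈ range (j + 1), |(u (p ^ i) : ℝ) * (w (p ^ (j - i)) : ℝ)| ≤ (C * (1 + j) ^ B) * (C' * (1 + j) ^ B') := by
    intro i hi
    have hi : i ≤ j := by simpa [Nat.lt_succ_iff] using hi
    rw [abs_mul]
    have h1 : (i:ℝ) ≤ j := by exact_mod_cast hi
    have h2 : ((j - i : ℕ):ℝ) ≤ j := by exact_mod_cast Nat.sub_le _ _
    refine mul_le_mul ((h p hp i).trans ?_) ((h' p hp (j - i)).trans ?_) (abs_nonneg _) (by positivity) <;> gcongr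
  refine (sum_le_card_nsmul _ _ _ t).trans (le_of_eq ?_)
  rw [card_range, nsmul_eq_mul]; push_cast
  rw [pow_succ, pow_add]; ring

lemma PB_one : PB 1 := by
  refine ⟨1, 0, one_pos, fun p hp j => ?_⟩
  rw [one_apply]; split_ifs <;> simp

lemma PB_pow {u : ArithmeticFunction ℤ} (hu : PB u) (k : ℕ) : PB (u ^ k) := by
  induction k with
  | zero => simpa using PB_one
  | succ k ih => rw [pow_succ]; exact PB_mul ih hu

lemma PB_moebius : PB moebius := by
  refine ⟨1, 0, one_pos, fun p hp j => ?_⟩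
  simp only [pow_zero, mul_one]
  exact_mod_cast abs_moebius_le_one

lemma PB_DD : PB DD := by
  refine ⟨1, 0, one_pos, fun p hp j => ?_⟩
  simp only [pow_zero, mul_one]
  rcases Nat.even_or_odd' j with ⟨j, rfl | rfl⟩
  · rw [DD, sqf_prime_pow_even]
    simp [hp.ne_zero]
  · rw [DD, sqf_prime_pow_odd _ hp]; simp

/-- the function `n ↦ τ(n ^ ν)` -/
def ff (ν : ℕ) : ArithmeticFunction ℤ := ⟨fun n => if n = 0 then 0 else ((n ^ ν).divisors.card : ℤ), by simp⟩

lemma ff_apply (ν : ℕ) {n : ℕ} (hn : n ≠ 0) : ff ν n = ((n ^ ν).divisors.card : ℤ) := if_neg hn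

lemma ff_pp (ν : ℕ) {p : ℕ} (hp : p.Prime) (j : ℕ) : ff ν (p ^ j) = ν * j + 1 := by
  rw [ff_apply _ (pow_ne_zero _ hp.ne_zero), ← pow_mul, Nat.divisors_prime_pow hp]
  simp [mul_comm]

lemma ff_mult (ν : ℕ) : (ff ν).IsMultiplicative := by
  rw [IsMultiplicative.iff_ne_zero]
  refine ⟨by rw [ff_apply _ one_ne_zero]; simp, fun {m n} hm hn hmn => ?_⟩
  rw [ff_apply _ hm, ff_apply _ hn, ff_apply _ (mul_ne_zero hm hn), mul_pow, (hmn.pow ν ν).card_divisors_mul]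
  push_cast; rfl

lemma PB_ff (ν : ℕ) : PB (ff ν) := by
  refine ⟨ν + 1, 1, by positivity, fun p hp j => ?_⟩
  rw [ff_pp ν hp]; push_cast
  rw [abs_of_nonneg (by positivity)]
  nlinarith [(Nat.cast_nonneg ν : (0:ℝ) ≤ ν), (Nat.cast_nonneg j : (0:ℝ) ≤ j)]

lemma mul_p (u w : ArithmeticFunction ℤ) (hu : u 1 = 1) (hw : w 1 = 1) {p : ℕ} (hp : p.Prime) : (u * w) p = u p + w p := by
  have := mul_prime_pow u w hp 1
  simp [sum_range_succ, hu, hw] at this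
  rw [mul_apply, this]; ring

lemma mul_p2 (u w : ArithmeticFunction ℤ) (hu : u 1 = 1) (hw : w 1 = 1) {p : ℕ} (hp : p.Prime) :
    (u * w) (p ^ 2) = u (p ^ 2) + u p * w p + w (p ^ 2) := by
  have := mul_prime_pow u w hp 2
  simp [sum_range_succ, hu, hw] at this
  rw [mul_apply, this]; ring

lemma mult_pow {u : ArithmeticFunction ℤ} (hu : u.IsMultiplicative) (k : ℕ) : (u ^ k).IsMultiplicative := by
  induction k with
  | zero => rw [pow_zero]; exact isMultiplicative_one
  | succ k ih => rw [pow_succ]; exact ih.mul hu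

lemma mu_pow_p {p : ℕ} (hp : p.Prime) (k : ℕ) : (moebius ^ k) p = -k ∧ (moebius ^ k) (p ^ 2) = (k.choose 2 : ℤ) := by
  induction k with
  | zero => simp [one_apply, hp.ne_one]
  | succ k ih =>
    have h1 := (mult_pow isMultiplicative_moebius k).map_one
    have h2 := isMultiplicative_moebius.map_one
    rw [pow_succ, mul_p _ _ h1 h2 hp, mul_p2 _ _ h1 h2 hp, ih.1, ih.2, moebius_apply_prime hp,
      moebius_apply_prime_pow hp (by norm_num), Nat.choose_succ_succ' k 1]
    push_cast
    constructor
    · ring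
    · simp; ring

lemma DD_p {p : ℕ} (hp : p.Prime) : DD p = 0 := by
  have := sqf_prime_pow_odd (zeta : ArithmeticFunction ℤ) hp 0; simpa [DD] using this

lemma DD_pow_p {p : ℕ} (hp : p.Prime) (k : ℕ) : (DD ^ k) p = 0 ∧ (DD ^ k) (p ^ 2) = k := by
  induction k with
  | zero => simp [one_apply, hp.ne_one]
  | succ k ih =>
    have h1 := (mult_pow DD_mult k).map_one
    have h2 := DD_mult.map_one
    have h3 : DD (p ^ 2) = 1 := by rw [DD, sqf_sq]; simp [hp.ne_zero]
    rw [pow_succ, mul_p _ _ h1 h2 hp, mul_p2 _ _ h1 h2 hp, ih.1, ih.2, DD_p hp, h3]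
    constructor <;> simp

noncomputable def aa (ν : ℕ) : ArithmeticFunction ℤ := ff ν * moebius ^ (ν + 1)

lemma aa_mult (ν : ℕ) : (aa ν).IsMultiplicative := (ff_mult ν).mul (mult_pow isMultiplicative_moebius _)

lemma aa_p (ν : ℕ) {p : ℕ} (hp : p.Prime) : aa ν p = 0 := by
  have h1 := (mult_pow isMultiplicative_moebius (ν + 1)).map_one
  have := ff_pp ν hp 1
  rw [pow_one] at this
  rw [aa, mul_p _ _ (ff_mult ν).map_one h1 hp, (mu_pow_p hp _).1, this]
  push_cast; ring

lemma aa_p2 (ν : ℕ) {p : ℕ} (hp : p.Prime) : aa ν (p ^ 2) = -(ν.choose 2 : ℤ) := by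
  have h1 := (mult_pow isMultiplicative_moebius (ν + 1)).map_one
  have := ff_pp ν hp 1
  rw [pow_one] at this
  rw [aa, mul_p2 _ _ (ff_mult ν).map_one h1 hp, (mu_pow_p hp _).1, (mu_pow_p hp _).2, this, ff_pp ν hp,
    Nat.choose_succ_succ' ν 1]
  have h2 : (ν.choose 2 : ℤ) * 2 = ν * (ν - 1) := by
    have := Nat.choose_two_right ν
    have h3 : ν.choose 2 * 2 = ν * (ν - 1) := by
      rw [this]; exact Nat.div_mul_cancel (Nat.even_mul_pred_self ν).two_dvd
    rcases ν with _ | ν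
    · simp
    · have := congrArg (Nat.cast : ℕ → ℤ) h3
      push_cast at this ⊢
      simpa using this
  push_cast
  simp
  linarith

noncomputable def gg (ν : ℕ) : ArithmeticFunction ℤ := aa ν * DD ^ (ν.choose 2)

lemma gg_mult (ν : ℕ) : (gg ν).IsMultiplicative := (aa_mult ν).mul (mult_pow DD_mult _)

lemma gg_p (ν : ℕ) {p : ℕ} (hp : p.Prime) : gg ν p = 0 := by
  rw [gg, mul_p _ _ (aa_mult ν).map_one (mult_pow DD_mult _).map_one hp, aa_p ν hp, (DD_pow_p hp _).1, zero_add]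

lemma gg_p2 (ν : ℕ) {p : ℕ} (hp : p.Prime) : gg ν (p ^ 2) = 0 := by
  rw [gg, mul_p2 _ _ (aa_mult ν).map_one (mult_pow DD_mult _).map_one hp, aa_p ν hp, aa_p2 ν hp, (DD_pow_p hp _).2]
  ring

lemma PB_gg (ν : ℕ) : PB (gg ν) := PB_mul (PB_mul (PB_ff ν) (PB_pow PB_moebius _)) (PB_pow PB_DD _)

lemma gg_mul_LL (ν : ℕ) : aa ν = gg ν * LL ^ (ν.choose 2) := by
  rw [gg, mul_assoc, ← mul_pow, mul_comm DD, LL_mul_DD, one_pow, mul_one]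

lemma aa_mul_zeta (ν : ℕ) : aa ν * (zeta : ArithmeticFunction ℤ) ^ (ν + 1) = ff ν := by
  rw [aa, mul_assoc, ← mul_pow, moebius_mul_coe_zeta, one_pow, mul_one]

/-- local tail summability and bound -/
lemma local_bound (ν : ℕ) : ∃ K : ℝ, 0 < K ∧ ∀ p : ℕ, p.Prime → (Summable fun j => absw (gg ν) (p ^ j)) ∧
    ∑' j, absw (gg ν) (p ^ j) ≤ 1 + K * (p : ℝ) ^ (-(3 / 2) : ℝ) := by
  obtain ⟨C, B, hC, h⟩ := PB_gg ν
  set r : ℝ := (Real.sqrt 2)⁻¹ with hr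
  have h2 : 1 < Real.sqrt 2 := by rw [Real.lt_sqrt] <;> norm_num
  have hr0 : 0 < r := by positivity
  have hr1 : r < 1 := inv_lt_one_of_one_lt₀ h2
  have hs : Summable fun i : ℕ => C * (4 + i : ℝ) ^ B * r ^ i := by
    have s1 := summable_pow_mul_geometric_of_norm_lt_one B (r := r) (by rw [Real.norm_of_nonneg hr0.le]; exact hr1)
    have s2 := ((summable_nat_add_iff 4).2 s1).mul_left (C * (r ^ 4)⁻¹)
    refine s2.congr fun i => ?_
    push_cast
    rw [pow_add]; field_simp; ring
  set K := ∑' i : ℕ, C * (4 + i : ℝ) ^ B * r ^ i with hK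
  have hK0 : 0 ≤ K := tsum_nonneg fun i => by positivity
  refine ⟨K + 1, by positivity, fun p hp => ?_⟩
  have hp0 : (0:ℝ) < p := by exact_mod_cast hp.pos
  have hp2 : (2:ℝ) ≤ p := by exact_mod_cast hp.two_le
  set q := Real.sqrt p with hq
  have hq0 : 0 < q := Real.sqrt_pos.2 hp0
  have hq3 : (p : ℝ) ^ (-(3 / 2) : ℝ) = (q ^ 3)⁻¹ := by
    rw [Real.rpow_neg hp0.le, hq, Real.sqrt_eq_rpow, ← Real.rpow_natCast, ← Real.rpow_mul hp0.le]
    norm_num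
  have t : ∀ i : ℕ, absw (gg ν) (p ^ (i + 3)) ≤ (q ^ 3)⁻¹ * (C * (4 + i : ℝ) ^ B * r ^ i) := by
    intro i
    rw [absw_apply]
    have hsq : Real.sqrt ((p ^ (i + 3) : ℕ) : ℝ) = q ^ i * q ^ 3 := by
      push_cast
      rw [← pow_add]
      rw [Real.sqrt_eq_iff_mul_self_eq (by positivity) (by positivity), ← mul_pow, hq, Real.mul_self_sqrt hp0.le]
    rw [hsq]
    have b := h p hp (i + 3)
    have hb : (1 + ((i + 3 : ℕ) : ℝ)) = 4 + i := by push_cast; ring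
    rw [hb] at b
    have hqr : (q ^ i)⁻¹ ≤ r ^ i := by
      rw [hr, inv_pow]
      gcongr
      exact Real.sqrt_le_sqrt hp2
    calc _ ≤ C * (4 + i : ℝ) ^ B / (q ^ i * q ^ 3) := by gcongr
      _ = (q ^ 3)⁻¹ * (C * (4 + i : ℝ) ^ B * (q ^ i)⁻¹) := by field_simp
      _ ≤ _ := by gcongr
  have s3 : Summable fun i => absw (gg ν) (p ^ (i + 3)) :=
    Summable.of_nonneg_of_le (fun i => absw_nonneg _ _) t (hs.mul_left _)
  have s4 : Summable fun j => absw (gg ν) (p ^ j) := (summable_nat_add_iff 3).1 s3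
  refine ⟨s4, ?_⟩
  rw [← s4.sum_add_tsum_nat_add 3]
  have e : ∑ i ∈ range 3, absw (gg ν) (p ^ i) = 1 := by
    simp [sum_range_succ, absw_apply, gg_p ν hp, gg_p2 ν hp, (gg_mult ν).map_one]
  rw [e, hq3]
  have : ∑' i, absw (gg ν) (p ^ (i + 3)) ≤ (q ^ 3)⁻¹ * K := by
    rw [hK, ← tsum_mul_left]
    exact s3.tsum_le_tsum t (hs.mul_left _)
  nlinarith [inv_pos.2 (pow_pos hq0 3)]

lemma gg_sum_bound (ν : ℕ) : ∃ S : ℝ, 0 < S ∧ ∀ N : ℕ, ∑ n ∈ Ioc 0 N, absw (gg ν) n ≤ S := by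
  obtain ⟨K, hK, h⟩ := local_bound ν
  have hz : Summable fun n : ℕ => (n : ℝ) ^ (-(3 / 2) : ℝ) := Real.summable_nat_rpow.2 (by norm_num)
  refine ⟨Real.exp (K * ∑' n : ℕ, (n : ℝ) ^ (-(3 / 2) : ℝ)), Real.exp_pos _, fun N => ?_⟩
  have hmul : ∀ {m n : ℕ}, Nat.Coprime m n → absw (gg ν) (m * n) = absw (gg ν) m * absw (gg ν) n := by
    intro m n hmn
    rw [absw_apply, absw_apply, absw_apply, (gg_mult ν).map_mul_of_coprime hmn]
    push_cast
    rw [abs_mul, Real.sqrt_mul (Nat.cast_nonneg _), div_mul_div_comm]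
  have h1 : absw (gg ν) 1 = 1 := by simp [absw_apply, (gg_mult ν).map_one]
  obtain ⟨a1, a2⟩ := EulerProduct.summable_and_hasSum_smoothNumbers_prod_primesBelow_tsum (f := absw (gg ν)) h1 hmul
    (fun {p} hp => (h p hp).1.norm) (N + 1)
  have b1 : ∑ n ∈ Ioc 0 N, absw (gg ν) n ≤ ∏ p ∈ (N + 1).primesBelow, ∑' n : ℕ, absw (gg ν) (p ^ n) := by
    rw [← a2.tsum_eq]
    have hmem : ∀ n ∈ Ioc 0 N, n ∈ (N + 1).smoothNumbers := fun n hn => by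
      rw [mem_Ioc] at hn
      exact Nat.mem_smoothNumbers_of_lt hn.1 (by omega)
    have : ∑ n ∈ Ioc 0 N, absw (gg ν) n = ∑ x ∈ (Ioc 0 N).attach.image (fun n => (⟨n.1, hmem n.1 n.2⟩ : (N + 1).smoothNumbers)), absw (gg ν) x := by
      rw [sum_image]
      · exact (sum_attach (Ioc 0 N) (fun n => absw (gg ν) n)).symm
      · intro a _ b _ hab
        exact Subtype.ext (congrArg (fun x : (N + 1).smoothNumbers => (x : ℕ)) hab)
    rw [this]
    exact a2.summable.sum_le_tsum _ fun i _ => absw_nonneg _ _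
  refine b1.trans ?_
  calc _ ≤ ∏ p ∈ (N + 1).primesBelow, Real.exp (K * (p : ℝ) ^ (-(3 / 2) : ℝ)) := by
        refine prod_le_prod (fun p _ => tsum_nonneg fun _ => absw_nonneg _ _) fun p hp => ?_
        refine (h p (Nat.prime_of_mem_primesBelow hp)).2.trans ?_
        linarith [Real.add_one_le_exp (K * (p : ℝ) ^ (-(3 / 2) : ℝ))]
    _ = Real.exp (K * ∑ p ∈ (N + 1).primesBelow, (p : ℝ) ^ (-(3 / 2) : ℝ)) := by
        rw [← Real.exp_sum, mul_sum]
    _ ≤ _ := by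
        gcongr
        exact hz.sum_le_tsum _ fun i _ => by positivity

lemma aa_sum_bound (ν : ℕ) : ∃ c : ℝ, 0 < c ∧ ∀ N : ℕ, |∑ n ∈ Ioc 0 N, (aa ν n : ℝ)| ≤ c * Real.sqrt N := by
  obtain ⟨S, hS, h⟩ := gg_sum_bound ν
  obtain ⟨C, hC, h'⟩ := LL_pow_bound (ν.choose 2)
  refine ⟨C * S, by positivity, fun N => ?_⟩
  have e : ∑ n ∈ Ioc 0 N, (aa ν n : ℝ) = ∑ n ∈ Ioc 0 N, (gg ν n : ℝ) * ∑ m ∈ Ioc 0 (N / n), ((LL ^ (ν.choose 2)) m : ℝ) := by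
    rw [gg_mul_LL]
    exact_mod_cast congrArg (Int.cast : ℤ → ℝ) (sum_Ioc_mul_eq_sum_sum (gg ν) (LL ^ (ν.choose 2)) N)
  rw [e]
  refine (abs_sum_le_sum_abs _ _).trans ?_
  calc _ ≤ ∑ n ∈ Ioc 0 N, absw (gg ν) n * (C * Real.sqrt N) := by
        refine sum_le_sum fun n _ => ?_
        rw [abs_mul, absw_apply]
        have : |∑ m ∈ Ioc 0 (N / n), ((LL ^ (ν.choose 2)) m : ℝ)| ≤ C * (Real.sqrt N / Real.sqrt n) := by
          refine (h' _).trans ?_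
          gcongr
          exact sqrt_div_le N n
        refine (mul_le_mul_of_nonneg_left this (abs_nonneg _)).trans (le_of_eq ?_)
        ring
    _ = (∑ n ∈ Ioc 0 N, absw (gg ν) n) * (C * Real.sqrt N) := by rw [sum_mul]
    _ ≤ S * (C * Real.sqrt N) := by gcongr; exact h N
    _ = _ := by ring

end A8

lemma tauK_eq (k n : ℕ) : (tauK k n : ℤ) = ((ArithmeticFunction.zeta : ArithmeticFunction ℤ) ^ k) n := by
  induction k generalizing n with
  | zero => rw [pow_zero, ArithmeticFunction.one_apply, tauK]; split_ifs <;> simp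
  | succ k ih =>
    rw [pow_succ, ArithmeticFunction.coe_mul_zeta_apply, tauK]
    push_cast
    exact Finset.sum_congr rfl fun d _ => ih d

theorem dirichlet_series_factorization (ν : ℕ) (hν : 1 ≤ ν) :
    ∃ (a : ℕ → ℤ) (c : ℝ), 0 < c ∧
      (∀ n : ℕ, ¬ Squarefull n → a n = 0) ∧
      (∀ z : ℕ, 1 ≤ z →
        (((z ^ ν).divisors.card : ℤ) = ∑ d ∈ z.divisors, a d * (tauK (ν + 1) (z / d) : ℤ))) ∧
      (∀ N : ℕ, 1 ≤ N → |(∑ n ∈ Finset.Icc 1 N, (a n : ℝ))| ≤ c * Real.sqrt N) := by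
  obtain ⟨c, hc, h⟩ := aa_sum_bound ν
  refine ⟨aa ν, c, hc, ?_, ?_, ?_⟩
  · intro n hn
    unfold Squarefull at hn
    push Not at hn
    obtain ⟨p, hp, ⟨m, rfl⟩, hp2⟩ := hn
    have hcop : Nat.Coprime p m := by
      rw [Nat.Prime.coprime_iff_not_dvd hp]
      intro hd
      exact hp2 (by rw [pow_two]; exact Nat.mul_dvd_mul_left p hd)
    rw [(aa_mult ν).map_mul_of_coprime hcop, aa_p ν hp, zero_mul]
  · intro z hz
    rw [← ff_apply ν (by omega), ← aa_mul_zeta ν, ArithmeticFunction.mul_apply,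
      Nat.sum_divisorsAntidiagonal (fun a b => aa ν a * ((ArithmeticFunction.zeta : ArithmeticFunction ℤ) ^ (ν + 1)) b)]
    exact Finset.sum_congr rfl fun d _ => by rw [tauK_eq]
  · intro N _
    exact h N
end

section
/- Let m, t ≥ 1 and let ℒ be the lattice in ℝ^{C(t+m,m)} generated by the coefficient vectors of the polynomials f_e(x₁,…,x_m) = a₀^{max(k−|e|,0)} ∏_{i=1}^m (X_i x_i + a_i)^{e_i}, ranging over tuples e with 1 ≤ e₁+⋯+e_m ≤ t (together with the constant polynomial a₀^k so the lattice has full rank C(t+m,m)). Then dim ℒ = C(t+m,m), and (for t = k and with the stated indexing) det ℒ = (X₁⋯X_m)^{C(t+m,m)·t/(m+1)} · a₀^{C(k+m,m)·k/(m+1)}. -/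
/-- The index set of exponent tuples `e` with `|e| ≤ t`. -/
abbrev ExpIdx (m t : ℕ) := {e : Fin m → Fin (t + 1) // ∑ i, (e i : ℕ) ≤ t}

/-- The Coppersmith polynomial `f_e = a₀^{max(k-|e|,0)} ∏ (Xᵢ xᵢ + aᵢ)^{eᵢ}`. -/
noncomputable def coppersmithPoly (m t k a₀ : ℕ) (a Xv : Fin m → ℕ) (e : ExpIdx m t) :
    MvPolynomial (Fin m) ℝ :=
  MvPolynomial.C ((a₀ : ℝ) ^ (k - ∑ i, (e.1 i : ℕ))) *
    ∏ i, ((Xv i : ℝ) • MvPolynomial.X i + MvPolynomial.C (a i : ℝ)) ^ (e.1 i : ℕ)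

theorem cop_coeff {m : ℕ} (e d : Fin m → ℕ) (c : Fin m → ℕ → ℝ) :
    MvPolynomial.coeff (Finsupp.equivFunOnFinite.symm d)
      (∏ i, ∑ n ∈ Finset.range (e i + 1),
        (MvPolynomial.C (c i n) * MvPolynomial.X i ^ n : MvPolynomial (Fin m) ℝ)) =
      if ∀ i, d i ≤ e i then ∏ i, c i (d i) else 0 := by
  classical
  rw [Finset.prod_univ_sum, MvPolynomial.coeff_sum]
  have h : ∀ x : Fin m → ℕ, MvPolynomial.coeff (Finsupp.equivFunOnFinite.symm d)
      (∏ i, (MvPolynomial.C (c i (x i)) * MvPolynomial.X i ^ (x i) : MvPolynomial (Fin m) ℝ)) =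
      if d = x then ∏ i, c i (d i) else 0 := by
    intro x
    have h1 : (∏ i, (MvPolynomial.X i ^ (x i) : MvPolynomial (Fin m) ℝ)) =
        MvPolynomial.monomial (Finsupp.equivFunOnFinite.symm x) 1 := by
      rw [MvPolynomial.monomial_eq, Finsupp.prod_fintype _ _ (by simp)]
      simp
    rw [Finset.prod_mul_distrib, h1, ← map_prod, MvPolynomial.coeff_C_mul,
      MvPolynomial.coeff_monomial]
    by_cases hx : d = x
    · simp [hx]
    · have : ¬ (x = d) := fun h => hx h.symm
      simp [hx, this]
  simp only [h, Finset.sum_ite_eq, Fintype.mem_piFinset, Finset.mem_range, Nat.lt_succ_iff]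

theorem cop_poly_coeff (m t k a₀ : ℕ) (a Xv : Fin m → ℕ) (e : ExpIdx m t) (d : Fin m → ℕ) :
    MvPolynomial.coeff (Finsupp.equivFunOnFinite.symm d) (coppersmithPoly m t k a₀ a Xv e) =
      (a₀ : ℝ) ^ (k - ∑ i, (e.1 i : ℕ)) *
      if ∀ i, d i ≤ (e.1 i : ℕ) then ∏ i, ((Xv i : ℝ) ^ (d i) * (a i : ℝ) ^ ((e.1 i : ℕ) - d i) *
        (((e.1 i : ℕ).choose (d i) : ℕ) : ℝ)) else 0 := by
  unfold coppersmithPoly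
  rw [MvPolynomial.coeff_C_mul, ← cop_coeff (fun i => (e.1 i : ℕ)) d
    (fun i n => (Xv i : ℝ) ^ n * (a i : ℝ) ^ ((e.1 i : ℕ) - n) * (((e.1 i : ℕ).choose n : ℕ) : ℝ))]
  congr 2
  refine Finset.prod_congr rfl fun i _ => ?_
  rw [add_pow]
  refine Finset.sum_congr rfl fun n _ => ?_
  rw [MvPolynomial.smul_eq_C_mul]
  simp only [map_mul, map_pow, map_natCast]
  ring

theorem cop_det {n α : Type*} [Fintype n] [DecidableEq n] [LinearOrder α] (f : n → α)
    (hf : Function.Injective f) (M : Matrix n n ℝ) (h : ∀ i j, f i < f j → M i j = 0) :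
    M.det = ∏ i, M i i := by
  let _ : LinearOrder n := LinearOrder.lift' f hf
  exact Matrix.det_of_isLowerTriangular M (fun i j hij => h i j hij)

theorem cop_card (m t : ℕ) : Fintype.card (ExpIdx m t) = (t + m).choose m := by
  classical
  have h1 : Fintype.card (Sym (Option (Fin m)) t) = (t + m).choose m := by
    rw [Sym.card_sym_eq_choose]
    simp only [Fintype.card_option, Fintype.card_fin]
    rw [show m + 1 + t - 1 = t + m by omega]
    exact Nat.choose_symm_add
  rw [← h1]
  refine Fintype.card_congr (Equiv.trans ?_ (Sym.equivNatSumOfFintype (Option (Fin m)) t).symm)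
  refine
    { toFun := fun e => ⟨fun o => o.elim (t - ∑ i, (e.1 i : ℕ)) (fun i => (e.1 i : ℕ)), ?_⟩
      invFun := fun P => ⟨fun i => ⟨P.1 (some i), ?_⟩, ?_⟩
      left_inv := ?_
      right_inv := ?_ }
  · have := e.2
    simp only [Fintype.sum_option, Option.elim]
    omega
  · have := P.2
    have h2 := Finset.single_le_sum (f := P.1) (fun _ _ => Nat.zero_le _) (Finset.mem_univ (some i))
    omega
  · have := P.2
    rw [Fintype.sum_option] at this
    simp only
    omega
  · intro e
    rfl
  · intro P
    ext o
    have := P.2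
    rw [Fintype.sum_option] at this
    cases o with
    | none => simp only [Option.elim]; omega
    | some i => rfl

theorem cop_upd {m t : ℕ} (i : Fin m) (e : ExpIdx m t) :
    ∑ j, ((Function.update e.1 i ⟨t - ∑ i, (e.1 i : ℕ), by omega⟩ : Fin m → Fin (t+1)) j : ℕ)
      + e.1 i = t := by
  have := e.2
  have h1 := Finset.add_sum_erase Finset.univ (fun j => (e.1 j : ℕ)) (Finset.mem_univ i)
  rw [← Finset.add_sum_erase Finset.univ _ (Finset.mem_univ i)]
  have h2 : ∀ v : Fin (t + 1), ∑ j ∈ Finset.univ.erase i,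
      ((Function.update e.1 i v : Fin m → Fin (t + 1)) j : ℕ) =
      ∑ j ∈ Finset.univ.erase i, (e.1 j : ℕ) := by
    intro v
    refine Finset.sum_congr rfl fun j hj => ?_
    rw [Function.update_of_ne (Finset.ne_of_mem_erase hj)]
  rw [h2]
  simp only [Function.update_self]
  omega

def copSwap {m t : ℕ} (i : Fin m) (e : ExpIdx m t) : ExpIdx m t :=
  ⟨Function.update e.1 i ⟨t - ∑ i, (e.1 i : ℕ), by omega⟩, by have := cop_upd i e; omega⟩

theorem copSwap_sum {m t : ℕ} (i : Fin m) (e : ExpIdx m t) :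
    t - ∑ j, ((copSwap i e).1 j : ℕ) = e.1 i := by
  have := cop_upd i e
  unfold copSwap
  simp only
  omega

theorem copSwap_invol {m t : ℕ} (i : Fin m) : Function.Involutive (copSwap (t := t) i) := by
  intro e
  apply Subtype.ext
  funext j
  by_cases hj : j = i
  · subst hj
    apply Fin.ext
    rw [← copSwap_sum j e]
    conv_lhs => unfold copSwap
    simp only [Function.update_self]
    rfl
  · simp [copSwap, Function.update_of_ne hj]

theorem cop_sum_eq {m t : ℕ} (i : Fin m) :
    ∑ e : ExpIdx m t, (e.1 i : ℕ) = ∑ e : ExpIdx m t, (t - ∑ j, (e.1 j : ℕ)) := by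
  rw [← Equiv.sum_comp (copSwap_invol (t := t) i).toPerm (fun e => t - ∑ j, (e.1 j : ℕ))]
  exact Finset.sum_congr rfl fun e _ => (copSwap_sum i e).symm

theorem cop_slack (m t : ℕ) :
    (m + 1) * ∑ e : ExpIdx m t, (t - ∑ j, (e.1 j : ℕ)) = (t + m).choose m * t := by
  have h : ∑ e : ExpIdx m t, ((t - ∑ j, (e.1 j : ℕ)) + ∑ j, (e.1 j : ℕ)) =
      (t + m).choose m * t := by
    rw [Finset.sum_congr rfl (g := fun _ => t) (fun e _ => Nat.sub_add_cancel e.2)]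
    rw [Finset.sum_const, Finset.card_univ, cop_card, smul_eq_mul]
  rw [Finset.sum_add_distrib, Finset.sum_comm,
    Finset.sum_congr rfl (fun i _ => cop_sum_eq i)] at h
  rw [← h]
  simp
  ring

theorem coppersmith_lattice_dim_det (m t k a₀ : ℕ) (hm : 1 ≤ m) (ht : 1 ≤ t)
    (hk : 1 ≤ k) (ha₀ : 0 < a₀) (a Xv : Fin m → ℕ)
    (ha : ∀ i, 0 < a i) (hX : ∀ i, 0 < Xv i) :
    Fintype.card (ExpIdx m t) = (t + m).choose m ∧
    (t = k →
      |Matrix.det (Matrix.of fun e j : ExpIdx m t =>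
          MvPolynomial.coeff (Finsupp.equivFunOnFinite.symm fun i => (j.1 i : ℕ))
            (coppersmithPoly m t k a₀ a Xv e))| =
        (∏ i, (Xv i : ℝ)) ^ ((((t + m).choose m * t : ℕ) : ℝ) / (m + 1)) *
          (a₀ : ℝ) ^ ((((k + m).choose m * k : ℕ) : ℝ) / (m + 1))) := by
  refine ⟨cop_card m t, ?_⟩
  rintro rfl
  have hexp : ((((t + m).choose m * t : ℕ) : ℝ) / (m + 1)) =
      ((∑ e : ExpIdx m t, (t - ∑ j, (e.1 j : ℕ)) : ℕ) : ℝ) := by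
    rw [← cop_slack, Nat.cast_mul]
    push_cast
    field_simp
  rw [hexp, Real.rpow_natCast, Real.rpow_natCast]
  rw [cop_det (fun e : ExpIdx m t => toLex e.1)
    (fun x y h => Subtype.ext (toLex.injective h))]
  · have hd : ∀ e : ExpIdx m t, (Matrix.of fun e j : ExpIdx m t =>
          MvPolynomial.coeff (Finsupp.equivFunOnFinite.symm fun i => (j.1 i : ℕ))
            (coppersmithPoly m t t a₀ a Xv e)) e e =
        (a₀ : ℝ) ^ (t - ∑ i, (e.1 i : ℕ)) * ∏ i, (Xv i : ℝ) ^ (e.1 i : ℕ) := by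
      intro e
      rw [Matrix.of_apply, cop_poly_coeff]
      simp
    rw [Finset.prod_congr rfl (fun e _ => hd e), Finset.prod_mul_distrib, Finset.prod_comm,
      Finset.prod_pow_eq_pow_sum]
    simp only [Finset.prod_pow_eq_pow_sum, cop_sum_eq]
    rw [Finset.prod_pow, abs_of_nonneg (by positivity), mul_comm]
  · intro e j hlt
    rw [Matrix.of_apply, cop_poly_coeff, if_neg, mul_zero]
    intro hle
    exact absurd hlt (not_lt.mpr (Pi.toLex_monotone (a := j.1) (b := e.1) (fun i => hle i)))
end
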